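/- For every N ≥ 2, θ ∈ (0, π/2], ã > 0, d > 0 and m > 0 there exists a constant C > 0, depending only on N, θ, ã, d and m, such that the following holds: for every bounded domain Ω ⊂ ℝ^N with diameter at most d satisfying the (θ,ã)-uniform interior cone condition and every torsion function u on Ω which is C¹ up to the boundary with |∇u(x)| ≥ m for all x ∈ ∂Ω and ∫_Ω |∇²u|² dx < ∞, the function h(x) := |x−z|²/2 − u(x), with z the barycenter of Ω and R := N|Ω|/H^{N−1}(∂Ω), satisfies ∫_Ω (−u) |∇²h|² dx ≤ C ∫_{∂Ω} (|∇u|² − R²)² dH^{N−1}. -/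

import Mathlib

open MeasureTheory Metric Set Real RealInnerProductSpace

noncomputable section

/-- Euclidean space `ℝ^N`. -/
abbrev Euc (N : ℕ) : Type := EuclideanSpace ℝ (Fin N)

/-- The `(i,j)` entry of the Hessian matrix of `u` at `x`. -/
def hessEntry {N : ℕ} (u : Euc N → ℝ) (x : Euc N) (i j : Fin N) : ℝ :=
  fderiv ℝ (fun y => fderiv ℝ u y (EuclideanSpace.single j (1 : ℝ))) x
    (EuclideanSpace.single i (1 : ℝ))

/-- Squared Frobenius norm of the Hessian of `u` at `x`. -/
def hessNormSq {N : ℕ} (u : Euc N → ℝ) (x : Euc N) : ℝ :=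
  ∑ i, ∑ j, (hessEntry u x i j) ^ 2

/-- The Laplacian of `u` at `x` (trace of the Hessian). -/
def lap {N : ℕ} (u : Euc N → ℝ) (x : Euc N) : ℝ := ∑ i, hessEntry u x i i

/-- `u` is a torsion function on `Ω`: continuous on the closure, `C²` inside,
`Δu = N` in `Ω` and `u = 0` on `∂Ω`. -/
def IsTorsion {N : ℕ} (Ω : Set (Euc N)) (u : Euc N → ℝ) : Prop :=
  ContinuousOn u (closure Ω) ∧ ContDiffOn ℝ 2 u Ω ∧
    (∀ x ∈ Ω, lap u x = N) ∧ ∀ x ∈ frontier Ω, u x = 0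

/-- `G` is a `b₀`-John domain. -/
def IsJohn {N : ℕ} (b₀ : ℝ) (G : Set (Euc N)) : Prop :=
  ∀ a ∈ G, ∀ b ∈ G, a ≠ b → ∃ γ : ℝ → Euc N,
    ContinuousOn γ (Icc 0 1) ∧ γ 0 = a ∧ γ 1 = b ∧ (∀ t ∈ Icc (0:ℝ) 1, γ t ∈ G) ∧
    ∀ t ∈ Icc (0:ℝ) 1, b₀⁻¹ * min (dist (γ t) a) (dist (γ t) b) ≤ infDist (γ t) (frontier G)

/-- `(θ, a)`-uniform interior cone condition. -/
def UnifConeCond {N : ℕ} (θ a : ℝ) (G : Set (Euc N)) : Prop :=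
  ∀ x ∈ frontier G, ∃ ω : Euc N, ‖ω‖ = 1 ∧
    ∀ w ∈ ball x a ∩ closure G, ∀ y : Euc N,
      ⟪y, ω⟫ > ‖y‖ * Real.cos θ → ‖y‖ < a → w + y ∈ G

/-- `r`-uniform interior sphere condition. -/
def IntSphere {N : ℕ} (r : ℝ) (Ω : Set (Euc N)) : Prop :=
  ∀ x ∈ frontier Ω, ∃ c : Euc N, ball c r ⊆ Ω ∧ dist x c = r

/-- `r`-uniform exterior sphere condition. -/
def ExtSphere {N : ℕ} (r : ℝ) (Ω : Set (Euc N)) : Prop :=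
  ∀ x ∈ frontier Ω, ∃ c : Euc N, ball c r ⊆ (closure Ω)ᶜ ∧ dist x c = r

section Auxiliary

open Filter Topology
open scoped ENNReal NNReal

section Lintegral

variable {α : Type*} [MeasurableSpace α] {μ : Measure α}

/-- Cauchy–Schwarz for the lower Lebesgue integral. -/
lemma sq_lintegral_mul_le {f g : α → ℝ≥0∞} (hf : AEMeasurable f μ) (hg : AEMeasurable g μ) :
    (∫⁻ x, f x * g x ∂μ) ^ 2 ≤ (∫⁻ x, f x ^ 2 ∂μ) * ∫⁻ x, g x ^ 2 ∂μ := by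
  have h := ENNReal.lintegral_mul_le_Lp_mul_Lq μ Real.HolderConjugate.two_two hf hg
  have h2 : ∀ a : ℝ≥0∞, (a ^ (1 / 2 : ℝ)) ^ 2 = a := fun a => by
    rw [← ENNReal.rpow_natCast, ← ENNReal.rpow_mul]; norm_num
  calc (∫⁻ x, f x * g x ∂μ) ^ 2
      ≤ ((∫⁻ x, f x ^ (2 : ℝ) ∂μ) ^ (1 / 2 : ℝ) * (∫⁻ x, g x ^ (2 : ℝ) ∂μ) ^ (1 / 2 : ℝ)) ^ 2 := by
        gcongr; exact h
    _ = _ := by rw [mul_pow, h2, h2]; simp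

lemma sq_lintegral_le {f : α → ℝ≥0∞} (hf : AEMeasurable f μ) :
    (∫⁻ x, f x ∂μ) ^ 2 ≤ μ univ * ∫⁻ x, f x ^ 2 ∂μ := by
  simpa using sq_lintegral_mul_le (μ := μ) (f := fun _ => 1) aemeasurable_const hf

lemma enorm_add_sq_le (a b : ℝ) : ‖a + b‖ₑ ^ 2 ≤ 2 * ‖a‖ₑ ^ 2 + 2 * ‖b‖ₑ ^ 2 := by
  have h : ∀ c : ℝ, ‖c‖ₑ ^ 2 = ENNReal.ofReal (c ^ 2) := fun c => by
    rw [Real.enorm_eq_ofReal_abs, ← ENNReal.ofReal_pow (abs_nonneg c), sq_abs]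
  have h2 : (2 : ℝ≥0∞) = ENNReal.ofReal 2 := by simp
  rw [h, h, h, h2, ← ENNReal.ofReal_mul (by norm_num), ← ENNReal.ofReal_mul (by norm_num),
    ← ENNReal.ofReal_add (by positivity) (by positivity)]
  exact ENNReal.ofReal_le_ofReal (by nlinarith [sq_nonneg (a - b)])

lemma enorm_setAverage_sq_le {f : α → ℝ} {B : Set α} (h0 : μ B ≠ 0) (ht : μ B ≠ ∞)
    (hf : AEMeasurable f (μ.restrict B)) :
    ‖⨍ x in B, f x ∂μ‖ₑ ^ 2 ≤ (μ B)⁻¹ * ∫⁻ x in B, ‖f x‖ₑ ^ 2 ∂μ := by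
  have h1 : ‖⨍ x in B, f x ∂μ‖ₑ ≤ (μ B)⁻¹ * ∫⁻ x in B, ‖f x‖ₑ ∂μ := by
    rw [setAverage_eq, enorm_smul]
    gcongr
    · rw [measureReal_def, ← ENNReal.toReal_inv, Real.enorm_eq_ofReal ENNReal.toReal_nonneg,
        ENNReal.ofReal_toReal (ENNReal.inv_ne_top.2 h0)]
    · exact enorm_integral_le_lintegral_enorm _
  calc ‖⨍ x in B, f x ∂μ‖ₑ ^ 2 ≤ ((μ B)⁻¹ * ∫⁻ x in B, ‖f x‖ₑ ∂μ) ^ 2 := by gcongr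
    _ ≤ ((μ B)⁻¹) ^ 2 * (μ B * ∫⁻ x in B, ‖f x‖ₑ ^ 2 ∂μ) := by
        rw [mul_pow]; gcongr
        simpa using sq_lintegral_le hf.enorm
    _ = _ := by
        rw [← mul_assoc, sq, mul_assoc (μ B)⁻¹, ENNReal.inv_mul_cancel h0 ht, mul_one]

end Lintegral

section Translation

variable {N : ℕ} {Ω : Set (Euc N)} {v : Euc N → ℝ}

/-- The fundamental theorem of calculus along a segment, as an inequality of lower integrals. -/
lemma enorm_sub_le_lintegral_fderiv (hΩ : IsOpen Ω) (hv : ContDiffOn ℝ 1 v Ω) {x y : Euc N}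
    {L : ℝ} (hL : 0 ≤ L) (hseg : ∀ s ∈ Icc 0 L, x + s • y ∈ Ω) :
    ‖v (x + L • y) - v x‖ₑ ≤ ∫⁻ s in Icc 0 L, ‖fderiv ℝ v (x + s • y)‖ₑ * ‖y‖ₑ := by
  have hd : ∀ s ∈ uIcc 0 L,
      HasDerivAt (fun s : ℝ => v (x + s • y)) (fderiv ℝ v (x + s • y) y) s := by
    intro s hs
    rw [uIcc_of_le hL] at hs
    have h1 : HasFDerivAt v (fderiv ℝ v (x + s • y)) (x + s • y) :=
      ((hv.differentiableOn one_ne_zero).differentiableAt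
        (hΩ.mem_nhds (hseg s hs))).hasFDerivAt
    have h2 : HasDerivAt (fun s : ℝ => x + s • y) y s := by
      simpa using ((hasDerivAt_id s).smul_const y).const_add x
    exact h1.comp_hasDerivAt s h2
  have hc : ContinuousOn (fun s : ℝ => fderiv ℝ v (x + s • y) y) (uIcc 0 L) := by
    have h1 : ContinuousOn (fderiv ℝ v) Ω := hv.continuousOn_fderiv_of_isOpen hΩ le_rfl
    have h2 : ContinuousOn (fun s : ℝ => fderiv ℝ v (x + s • y)) (uIcc 0 L) := by
      refine h1.comp (by fun_prop) fun s hs => hseg s ?_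
      rwa [uIcc_of_le hL] at hs
    exact h2.clm_apply continuousOn_const
  have := intervalIntegral.integral_eq_sub_of_hasDerivAt hd hc.intervalIntegrable
  simp only [zero_smul, add_zero] at this
  rw [← this, intervalIntegral.integral_of_le hL]
  calc _ ≤ ∫⁻ s in Ioc 0 L, ‖fderiv ℝ v (x + s • y) y‖ₑ := enorm_integral_le_lintegral_enorm _
    _ ≤ ∫⁻ s in Icc 0 L, ‖fderiv ℝ v (x + s • y) y‖ₑ :=
      lintegral_mono_set Ioc_subset_Icc_self
    _ ≤ _ := lintegral_mono fun s => ContinuousLinearMap.le_opENorm _ _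

/-- `L²` modulus of continuity of translations. -/
lemma lintegral_translate_sub_sq_le (hΩ : IsOpen Ω) (hv : ContDiffOn ℝ 1 v Ω)
    {A S : Set (Euc N)} (hA : MeasurableSet A) (hS : MeasurableSet S) (hSΩ : S ⊆ Ω) {y : Euc N}
    (hAS : ∀ x ∈ A, ∀ s ∈ Icc (0 : ℝ) 1, x + s • y ∈ S) :
    ∫⁻ x in A, ‖v (x + y) - v x‖ₑ ^ 2 ≤ ‖y‖ₑ ^ 2 * ∫⁻ x in S, ‖fderiv ℝ v x‖ₑ ^ 2 := by
  have hm : Measurable fun x => ‖fderiv ℝ v x‖ₑ ^ 2 := (measurable_fderiv ℝ v).enorm.pow_const 2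
  have h1 : ∀ x ∈ A, ‖v (x + y) - v x‖ₑ ^ 2 ≤
      ∫⁻ s in Icc (0 : ℝ) 1, ‖y‖ₑ ^ 2 * ‖fderiv ℝ v (x + s • y)‖ₑ ^ 2 := by
    intro x hx
    have h := enorm_sub_le_lintegral_fderiv hΩ hv zero_le_one
      (fun s hs => hSΩ (hAS x hx s hs))
    rw [one_smul] at h
    calc _ ≤ (∫⁻ s in Icc (0 : ℝ) 1, ‖fderiv ℝ v (x + s • y)‖ₑ * ‖y‖ₑ) ^ 2 := by gcongr
      _ ≤ _ := sq_lintegral_le (by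
        have := (measurable_fderiv ℝ v).enorm
        have h2 : Measurable fun s : ℝ => x + s • y := by fun_prop
        exact ((this.comp h2).mul_const _).aemeasurable)
      _ = _ := by
        simp [mul_pow, mul_comm]
  calc ∫⁻ x in A, ‖v (x + y) - v x‖ₑ ^ 2
      ≤ ∫⁻ x in A, ∫⁻ s in Icc (0 : ℝ) 1, ‖y‖ₑ ^ 2 * ‖fderiv ℝ v (x + s • y)‖ₑ ^ 2 :=
        setLIntegral_mono' hA h1
    _ = ∫⁻ s in Icc (0 : ℝ) 1, ∫⁻ x in A, ‖y‖ₑ ^ 2 * ‖fderiv ℝ v (x + s • y)‖ₑ ^ 2 := by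
        refine lintegral_lintegral_swap (Measurable.aemeasurable ?_)
        have h2 : Measurable fun p : Euc N × ℝ => p.1 + p.2 • y := by fun_prop
        exact (hm.comp h2).const_mul _
    _ ≤ ∫⁻ s in Icc (0 : ℝ) 1, ‖y‖ₑ ^ 2 * ∫⁻ x in S, ‖fderiv ℝ v x‖ₑ ^ 2 := by
        refine setLIntegral_mono' measurableSet_Icc fun s hs => ?_
        rw [lintegral_const_mul']
        swap; · simp
        refine mul_le_mul' le_rfl ?_
        rw [← lintegral_indicator hA, ← lintegral_indicator hS,
          ← lintegral_add_right_eq_self (S.indicator _) (s • y)]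
        refine lintegral_mono fun x => ?_
        by_cases hx : x ∈ A
        · simp [hx, hAS x hx s hs]
        · simp [hx]
    _ = _ := by simp

end Translation

section InteriorBalls

variable {N : ℕ} {Ω : Set (Euc N)} {σ b : ℝ}

/-- The form in which the cone condition is used: near every boundary point, translating by `t • ω`
carries the closure of `Ω` into `Ω` at depth `σ * t`. -/
def BallConeCond (σ b : ℝ) (Ω : Set (Euc N)) : Prop :=
  ∀ p ∈ frontier Ω, ∃ ω : Euc N, ‖ω‖ = 1 ∧ ∀ w ∈ closure Ω, dist w p < b →
    ∀ t, 0 < t → t ≤ b → ∀ e : Euc N, ‖e‖ < σ * t → w + t • ω + e ∈ Ω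

/-- The points of `Ω` at depth at least `ρ`. -/
def deepPart (ρ : ℝ) (Ω : Set (Euc N)) : Set (Euc N) := {x | ball x ρ ⊆ Ω}

lemma deepPart_subset {ρ : ℝ} (hρ : 0 < ρ) : deepPart ρ Ω ⊆ Ω := fun _ hx => hx (mem_ball_self hρ)

lemma add_mem_of_mem_deepPart {ρ : ℝ} {x y : Euc N} (hx : x ∈ deepPart ρ Ω) (hy : ‖y‖ < ρ) :
    x + y ∈ Ω := hx (by simpa [mem_ball, dist_eq_norm] using hy)

lemma add_mem_deepPart {ρ ρ' : ℝ} {x y : Euc N} (hx : x ∈ deepPart ρ Ω) (hy : ‖y‖ + ρ' ≤ ρ) :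
    x + y ∈ deepPart ρ' Ω := by
  intro z hz
  refine hx ?_
  rw [mem_ball] at hz ⊢
  calc dist z x ≤ dist z (x + y) + dist (x + y) x := dist_triangle _ _ _
    _ < ρ := by rw [dist_self_add_left]; linarith

lemma exists_frontier_dist_lt (hΩ : IsOpen Ω) {ρ : ℝ} {x : Euc N} (hx : x ∈ Ω) (h : x ∉ deepPart ρ Ω) :
    ∃ p ∈ frontier Ω, dist x p < ρ := by
  by_contra! hcon
  refine h fun y hy => ?_
  by_contra hyΩ
  have hpre : IsPreconnected (ball x ρ) := (convex_ball x ρ).isPreconnected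
  have hρ : 0 < ρ := pos_of_mem_ball hy
  have hnf : ∀ z ∈ ball x ρ, z ∉ frontier Ω := fun z hz hzf =>
    (hcon z hzf).not_gt (by rwa [dist_comm, ← mem_ball])
  have hcl : ∀ z ∈ ball x ρ, z ∉ Ω → z ∈ (closure Ω)ᶜ := fun z hz hzΩ hzc =>
    hnf z hz (by rw [hΩ.frontier_eq]; exact ⟨hzc, hzΩ⟩)
  obtain ⟨z, -, hz1, hz2⟩ := hpre Ω (closure Ω)ᶜ hΩ isClosed_closure.isOpen_compl
    (fun z hz => or_iff_not_imp_left.2 (hcl z hz)) ⟨x, mem_ball_self hρ, hx⟩ ⟨y, hy, hcl y hy hyΩ⟩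
  exact hz2 (subset_closure hz1)

lemma isClosed_deepPart (ρ : ℝ) : IsClosed (deepPart ρ Ω) := by
  have : deepPart ρ Ω = ⋂ y ∈ Ωᶜ, {x | ρ ≤ dist y x} := by
    ext x
    simp only [deepPart, mem_ofPred_eq, mem_iInter, mem_compl_iff, subset_def, mem_ball]
    exact ⟨fun h y hy => not_lt.1 fun hlt => hy (h y hlt),
      fun h y hy => by_contra fun hyΩ => (h y hyΩ).not_gt hy⟩
  rw [this]
  exact isClosed_biInter fun y _ => isClosed_le continuous_const (by fun_prop)

/-- Under the cone condition, the deep part of a connected open set is connected. -/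
lemma isPreconnected_deepPart (hΩ : IsOpen Ω) (hconn : IsPreconnected Ω) (hσ : 0 < σ)
    (hσ1 : σ ≤ 1) (hcone : BallConeCond σ b Ω) {L : ℝ} (hL : 0 < L) (hLb : 4 * L ≤ b) :
    IsPreconnected (deepPart (σ * L) Ω) := by
  have hσL : 0 < σ * L := by positivity
  have hσL' : σ * L ≤ L := by nlinarith
  choose! ω hω1 hω using hcone
  set K := deepPart (σ * L) Ω with hK
  have hKΩ : K ⊆ Ω := deepPart_subset hσL
  -- the lifts of a point of `Ω` to `K`
  let Lift : Euc N → Euc N → Prop := fun x l =>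
    (x ∈ K ∧ l = x) ∨ ∃ p ∈ frontier Ω, dist x p < 2 * L ∧ l = x + L • ω p
  have hshift : ∀ p ∈ frontier Ω, ∀ x ∈ Ω, dist x p < 2 * L → x + L • ω p ∈ K := by
    intro p hp x hx hd z hz
    have := hω p hp x (subset_closure hx) (by linarith) L hL (by linarith) (z - (x + L • ω p))
      (by rwa [← dist_eq_norm])
    simpa using this
  have hcarry : ∀ p ∈ frontier Ω, ∀ x ∈ K, dist x p < 3 * L → JoinedIn K x (x + L • ω p) := by
    intro p hp x hx hd
    apply JoinedIn.of_segment_subset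
    rintro _ ⟨α, β, hα, hβ, hαβ, rfl⟩ z hz
    have hrw : α • x + β • (x + L • ω p) = x + (β * L) • ω p := by
      rw [smul_add, ← add_assoc, ← add_smul, hαβ, one_smul, smul_smul]
    rw [hrw] at hz
    rcases hβ.eq_or_lt with rfl | hβ
    · exact hx (by simpa using hz)
    have hz' : z - (β * L) • ω p ∈ ball x (σ * L) := by
      rw [mem_ball, dist_eq_norm] at hz ⊢
      convert hz using 2; abel
    have h1 : z - (β * L) • ω p ∈ Ω := hx hz'
    have h2 : dist (z - (β * L) • ω p) p < b := by
      have := dist_triangle (z - (β * L) • ω p) x p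
      rw [mem_ball] at hz'
      linarith
    have h3 := hω p hp _ (subset_closure h1) h2 (β * L) (by positivity) (by nlinarith) 0
      (by simp; positivity)
    simpa using h3
  have hliftK : ∀ x ∈ Ω, ∀ l, Lift x l → l ∈ K := by
    rintro x hx l (⟨h, rfl⟩ | ⟨p, hp, hd, rfl⟩)
    · exact h
    · exact hshift p hp x hx hd
  have hself : ∀ x ∈ Ω, ∀ l l', Lift x l → Lift x l' → JoinedIn K l l' := by
    rintro x hx l l' (⟨h, rfl⟩ | ⟨p, hp, hd, rfl⟩) (⟨h', rfl⟩ | ⟨p', hp', hd', rfl⟩)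
    · exact JoinedIn.refl h
    · exact hcarry p' hp' _ h (by linarith)
    · exact (hcarry p hp _ h' (by linarith)).symm
    · have hn : ∀ q ∈ frontier Ω, ∀ q' ∈ frontier Ω, dist x q < 2 * L → dist x q' < 2 * L →
          JoinedIn K (x + L • ω q) (x + L • ω q + L • ω q') := fun q hq q' hq' hdq hdq' => by
        refine hcarry q' hq' _ (hshift q hq x hx hdq) ?_
        have := dist_triangle (x + L • ω q) x q'
        rw [dist_self_add_left, norm_smul, hω1 q hq, mul_one, Real.norm_of_nonneg hL.le] at this
        linarith
      have h1 := hn p hp p' hp' hd hd'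
      have h2 := hn p' hp' p hp hd' hd
      rw [add_right_comm] at h2
      exact h1.trans h2.symm
  have hex : ∀ x ∈ Ω, ∃ l, Lift x l := by
    intro x hx
    by_cases h : x ∈ K
    · exact ⟨x, Or.inl ⟨h, rfl⟩⟩
    · obtain ⟨p, hp, hd⟩ := exists_frontier_dist_lt hΩ hx h
      exact ⟨_, Or.inr ⟨p, hp, by linarith, rfl⟩⟩
  -- nearby points have lifts which are joined
  have hlocal : ∀ x ∈ Ω, ∀ᶠ y in 𝓝[Ω] x, ∃ l l', Lift x l ∧ Lift y l' ∧ JoinedIn K l l' := by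
    intro x hx
    by_cases h : x ∈ deepPart (3 / 2 * L) Ω
    · have hball : ∀ y, dist y x < L / 2 → y ∈ K := fun y hy => by
        have := add_mem_deepPart (ρ' := σ * L) (y := y - x) h
          (by rw [← dist_eq_norm]; linarith)
        simpa using this
      have : ∀ᶠ y in 𝓝[Ω] x, y ∈ ball x (L / 2) :=
        nhdsWithin_le_nhds (ball_mem_nhds x (by positivity))
      filter_upwards [this] with y hy
      have hseg : segment ℝ x y ⊆ K := fun z hz => by
        refine hball z ?_
        exact (convex_ball x (L / 2)).segment_subset (mem_ball_self (by positivity)) hy hz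
      exact ⟨x, y, Or.inl ⟨hball x (by simpa using hL), rfl⟩, Or.inl ⟨hball y hy, rfl⟩,
        JoinedIn.of_segment_subset hseg⟩
    · obtain ⟨p, hp, hd⟩ := exists_frontier_dist_lt hΩ hx h
      obtain ⟨r, hr, hrΩ⟩ := Metric.isOpen_iff.1 hΩ x hx
      have : ∀ᶠ y in 𝓝[Ω] x, y ∈ ball x (min r (L / 2)) :=
        nhdsWithin_le_nhds (ball_mem_nhds x (by positivity))
      filter_upwards [this] with y hy
      have hpt : ∀ z ∈ ball x (min r (L / 2)), z ∈ Ω ∧ dist z p < 2 * L := fun z hz => by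
        rw [mem_ball, lt_min_iff] at hz
        have := dist_triangle z x p
        exact ⟨hrΩ hz.1, by linarith [hz.2]⟩
      have hmin : 0 < min r (L / 2) := by positivity
      refine ⟨x + L • ω p, y + L • ω p, Or.inr ⟨p, hp, by linarith, rfl⟩,
        Or.inr ⟨p, hp, (hpt y hy).2, rfl⟩, JoinedIn.of_segment_subset ?_⟩
      rintro _ ⟨α, β, hα, hβ, hαβ, rfl⟩
      have hz : α • x + β • y ∈ ball x (min r (L / 2)) :=
        (convex_ball x _) (mem_ball_self hmin) hy hα hβ hαβ
      have hrw : α • (x + L • ω p) + β • (y + L • ω p) = α • x + β • y + L • ω p := by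
        rw [smul_add, smul_add, add_add_add_comm, ← add_smul, hαβ, one_smul]
      rw [hrw]
      exact hshift p hp _ (hpt _ hz).1 (hpt _ hz).2
  have key : ∀ x ∈ Ω, ∀ y ∈ Ω, ∀ l l', Lift x l → Lift y l' → JoinedIn K l l' := by
    intro x hx y hy
    refine hconn.induction₂' (fun x y => ∀ l l', Lift x l → Lift y l' → JoinedIn K l l')
      ?_ ?_ hx hy
    · intro x hx
      filter_upwards [hlocal x hx, self_mem_nhdsWithin] with y hy hyΩ
      obtain ⟨m, m', hm, hm', hj⟩ := hy
      exact ⟨fun l l' hl hl' =>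
          ((hself x hx l m hl hm).trans hj).trans (hself y hyΩ m' l' hm' hl'),
        fun l l' hl hl' =>
          ((hself y hyΩ l m' hl hm').trans hj.symm).trans (hself x hx m l' hm hl')⟩
    · intro x y z hx hy hz hxy hyz l l' hl hl'
      obtain ⟨m, hm⟩ := hex y hy
      exact (hxy l m hl hm).trans (hyz m l' hm hl')
  rcases K.eq_empty_or_nonempty with h0 | ⟨k, hk⟩
  · rw [h0]; exact isPreconnected_empty
  · refine IsPathConnected.isConnected ⟨k, hk, fun {y} hy => ?_⟩ |>.isPreconnected
    exact key k (hKΩ hk) y (hKΩ hy) k y (Or.inl ⟨hk, rfl⟩) (Or.inl ⟨hy, rfl⟩)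

end InteriorBalls

section DeepPoincare

variable {N : ℕ} {Ω : Set (Euc N)} {v : Euc N → ℝ}

/-- The average of `v` over the closed ball of radius `r` centered at `x`. -/
def ballAverage (r : ℝ) (v : Euc N → ℝ) (x : Euc N) : ℝ := ⨍ y in closedBall 0 r, v (x + y)

lemma continuous_ballAverage (r : ℝ) (hv : Continuous v) : Continuous (ballAverage r v) := by
  have h : Continuous fun x => ∫ y in closedBall (0 : Euc N) r, v (x + y) :=
    continuous_parametric_integral_of_continuous (by fun_prop) (isCompact_closedBall 0 r)
  unfold ballAverage
  simp_rw [setAverage_eq, smul_eq_mul]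
  exact continuous_const.mul h

lemma integrableOn_closedBall_comp_add (r : ℝ) (hv : Continuous v) (x : Euc N) :
    IntegrableOn (fun y => v (x + y)) (closedBall 0 r) :=
  ContinuousOn.integrableOn_compact (isCompact_closedBall 0 r) (by fun_prop)

lemma enorm_ballAverage_sub_sq_le (hΩ : IsOpen Ω) (hvc : Continuous v)
    (hv : ContDiffOn ℝ 1 v Ω) {ρ : ℝ} (hρ : 0 < ρ) {x x' : Euc N}
    (hx' : x' ∈ deepPart ρ Ω) (hxx' : dist x x' ≤ ρ / 4) :
    ‖ballAverage (ρ / 4) v x - ballAverage (ρ / 4) v x'‖ₑ ^ 2 ≤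
      (volume (closedBall (0 : Euc N) (ρ / 4)))⁻¹ *
        (ENNReal.ofReal (ρ / 4) ^ 2 * ∫⁻ x in deepPart (ρ / 2) Ω, ‖fderiv ℝ v x‖ₑ ^ 2) := by
  have h0 : volume (closedBall (0 : Euc N) (ρ / 4)) ≠ 0 :=
    (measure_closedBall_pos _ _ (by positivity)).ne'
  have ht : volume (closedBall (0 : Euc N) (ρ / 4)) ≠ ∞ := measure_closedBall_lt_top.ne
  have h1 : ballAverage (ρ / 4) v x - ballAverage (ρ / 4) v x' =
      ⨍ y in closedBall 0 (ρ / 4), (v (x + y) - v (x' + y)) := by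
    simp only [ballAverage, setAverage_eq]
    rw [← smul_sub, integral_sub (integrableOn_closedBall_comp_add _ hvc x)
      (integrableOn_closedBall_comp_add _ hvc x')]
  rw [h1]
  refine (enorm_setAverage_sq_le h0 ht (by fun_prop)).trans ?_
  refine mul_le_mul' le_rfl ?_
  have h2 : ∫⁻ y in closedBall (0 : Euc N) (ρ / 4), ‖v (x + y) - v (x' + y)‖ₑ ^ 2 =
      ∫⁻ z in closedBall x' (ρ / 4), ‖v (z + (x - x')) - v z‖ₑ ^ 2 := by
    rw [← lintegral_indicator measurableSet_closedBall,
      ← lintegral_indicator measurableSet_closedBall,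
      ← lintegral_add_left_eq_self ((closedBall x' (ρ / 4)).indicator _) x']
    refine lintegral_congr fun y => ?_
    have : x' + y + (x - x') = x + y := by abel
    simp [indicator, this, dist_eq_norm]
  rw [h2]
  refine (lintegral_translate_sub_sq_le hΩ hv measurableSet_closedBall
    (isClosed_deepPart (ρ / 2)).measurableSet (deepPart_subset (by positivity)) ?_).trans ?_
  · intro z hz s hs
    have hrw : z + s • (x - x') = x' + ((z - x') + s • (x - x')) := by abel
    rw [hrw]
    refine add_mem_deepPart hx' ?_
    have h3 : ‖s • (x - x')‖ ≤ ρ / 4 := by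
      rw [norm_smul, ← dist_eq_norm, Real.norm_of_nonneg hs.1]
      nlinarith [hs.1, hs.2, dist_nonneg (x := x) (y := x')]
    have h4 : ‖z - x'‖ ≤ ρ / 4 := by rwa [← dist_eq_norm]
    linarith [norm_add_le (z - x') (s • (x - x'))]
  · gcongr
    rw [← ofReal_norm, ← dist_eq_norm]
    exact ENNReal.ofReal_le_ofReal hxx'

lemma lintegral_sub_ballAverage_sq_le (hΩ : IsOpen Ω) (hvc : Continuous v)
    (hv : ContDiffOn ℝ 1 v Ω) {ρ : ℝ} (hρ : 0 < ρ) :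
    ∫⁻ x in deepPart ρ Ω, ‖v x - ballAverage (ρ / 4) v x‖ₑ ^ 2 ≤
      ENNReal.ofReal (ρ / 4) ^ 2 * ∫⁻ x in deepPart (ρ / 2) Ω, ‖fderiv ℝ v x‖ₑ ^ 2 := by
  set J := ∫⁻ x in deepPart (ρ / 2) Ω, ‖fderiv ℝ v x‖ₑ ^ 2
  set B := closedBall (0 : Euc N) (ρ / 4)
  have h0 : volume B ≠ 0 := (measure_closedBall_pos _ _ (by positivity)).ne'
  have ht : volume B ≠ ∞ := measure_closedBall_lt_top.ne
  have hpt : ∀ x, ‖v x - ballAverage (ρ / 4) v x‖ₑ ^ 2 ≤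
      (volume B)⁻¹ * ∫⁻ y in B, ‖v (x + y) - v x‖ₑ ^ 2 := by
    intro x
    have h1 : ballAverage (ρ / 4) v x - v x = ⨍ y in B, (v (x + y) - v x) := by
      simp only [ballAverage, setAverage_eq]
      rw [integral_sub (integrableOn_closedBall_comp_add _ hvc x) (integrableOn_const ht),
        smul_sub]
      congr 1
      rw [setIntegral_const, smul_smul, inv_mul_cancel₀, one_smul]
      exact (ENNReal.toReal_pos h0 ht).ne'
    rw [← enorm_neg, neg_sub, h1]
    exact enorm_setAverage_sq_le h0 ht (by fun_prop)
  calc ∫⁻ x in deepPart ρ Ω, ‖v x - ballAverage (ρ / 4) v x‖ₑ ^ 2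
      ≤ ∫⁻ x in deepPart ρ Ω, (volume B)⁻¹ * ∫⁻ y in B, ‖v (x + y) - v x‖ₑ ^ 2 :=
        lintegral_mono fun x => hpt x
    _ = (volume B)⁻¹ * ∫⁻ y in B, ∫⁻ x in deepPart ρ Ω, ‖v (x + y) - v x‖ₑ ^ 2 := by
        rw [lintegral_const_mul' _ _ (ENNReal.inv_ne_top.2 h0), lintegral_lintegral_swap]
        exact Measurable.aemeasurable (by fun_prop)
    _ ≤ (volume B)⁻¹ * ∫⁻ y in B, ENNReal.ofReal (ρ / 4) ^ 2 * J := by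
        refine mul_le_mul' le_rfl (setLIntegral_mono' measurableSet_closedBall fun y hy => ?_)
        have hy' : ‖y‖ ≤ ρ / 4 := by simpa [B] using hy
        refine (lintegral_translate_sub_sq_le hΩ hv (isClosed_deepPart ρ).measurableSet
          (isClosed_deepPart (ρ / 2)).measurableSet (deepPart_subset (by positivity)) ?_).trans ?_
        · intro x hx s hs
          refine add_mem_deepPart hx ?_
          rw [norm_smul, Real.norm_of_nonneg hs.1]
          nlinarith [hs.1, hs.2, norm_nonneg y]
        · refine mul_le_mul' ?_ le_rfl
          gcongr
          rw [← ofReal_norm]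
          exact ENNReal.ofReal_le_ofReal hy'
    _ = _ := by
        rw [setLIntegral_const, mul_comm _ (volume B), ← mul_assoc,
          ENNReal.inv_mul_cancel h0 ht, one_mul]

/-- A continuous function on a connected set covered by `n` sets on each of which it oscillates
by at most `D` oscillates by at most `n * D`. -/
lemma abs_sub_le_card_mul {X ι : Type*} [TopologicalSpace X] {K : Set X} (hK : IsPreconnected K)
    {E : X → ℝ} (hE : ContinuousOn E K) (T : Finset ι) (U : ι → Set X)
    (hT : K ⊆ ⋃ i ∈ T, U i) {D : ℝ} (hD : 0 ≤ D)
    (hosc : ∀ i ∈ T, ∀ x ∈ K ∩ U i, ∀ y ∈ K ∩ U i, |E x - E y| ≤ D)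
    {x y : X} (hx : x ∈ K) (hy : y ∈ K) : |E x - E y| ≤ T.card * D := by
  wlog hxy : E y ≤ E x generalizing x y
  · rw [abs_sub_comm]; exact this hy hx (le_of_not_ge hxy)
  have hsub : Icc (E y) (E x) ⊆ ⋃ i ∈ T, E '' (K ∩ U i) := by
    refine ((hK.image E hE).Icc_subset (mem_image_of_mem E hy) (mem_image_of_mem E hx)).trans ?_
    rintro _ ⟨z, hz, rfl⟩
    obtain ⟨i, hi, hzi⟩ := mem_iUnion₂.1 (hT hz)
    exact mem_iUnion₂.2 ⟨i, hi, z, ⟨hz, hzi⟩, rfl⟩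
  have hvol : ENNReal.ofReal (E x - E y) ≤ ENNReal.ofReal (T.card * D) := by
    calc ENNReal.ofReal (E x - E y) = volume (Icc (E y) (E x)) := Real.volume_Icc.symm
      _ ≤ volume (⋃ i ∈ T, E '' (K ∩ U i)) := measure_mono hsub
      _ ≤ ∑ i ∈ T, volume (E '' (K ∩ U i)) := measure_biUnion_finset_le _ _
      _ ≤ ∑ _i ∈ T, ENNReal.ofReal D := by
        refine Finset.sum_le_sum fun i hi => (Real.volume_le_diam _).trans ?_
        refine Metric.ediam_le ?_
        rintro _ ⟨a, ha, rfl⟩ _ ⟨c, hc, rfl⟩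
        rw [edist_dist, Real.dist_eq]
        exact ENNReal.ofReal_le_ofReal (hosc i hi a ha c hc)
      _ = _ := by
        rw [Finset.sum_const, nsmul_eq_mul, ENNReal.ofReal_mul (by positivity),
          ENNReal.ofReal_natCast]
  rw [abs_of_nonneg (by linarith)]
  exact (ENNReal.ofReal_le_ofReal_iff (by positivity)).1 hvol

/-- The Poincaré inequality on the deep part of a domain. -/
lemma exists_lintegral_deepPart_sub_sq_le (hΩ : IsOpen Ω) (hvc : Continuous v)
    (hv : ContDiffOn ℝ 1 v Ω) {ρ : ℝ} (hρ : 0 < ρ) (hK : IsPreconnected (deepPart ρ Ω))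
    (T : Finset (Euc N)) (hT : deepPart ρ Ω ⊆ ⋃ k ∈ T, ball k (ρ / 8)) :
    ∃ c : ℝ, ∫⁻ x in deepPart ρ Ω, ‖v x - c‖ₑ ^ 2 ≤
      (2 + 2 * (volume (deepPart ρ Ω) * (T.card ^ 2 *
        (volume (closedBall (0 : Euc N) (ρ / 4)))⁻¹))) *
      (ENNReal.ofReal (ρ / 4) ^ 2 * ∫⁻ x in deepPart (ρ / 2) Ω, ‖fderiv ℝ v x‖ₑ ^ 2) := by
  set J := ENNReal.ofReal (ρ / 4) ^ 2 * ∫⁻ x in deepPart (ρ / 2) Ω, ‖fderiv ℝ v x‖ₑ ^ 2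
    with hJ
  set κ := volume (closedBall (0 : Euc N) (ρ / 4)) with hκ
  have h0 : κ ≠ 0 := (measure_closedBall_pos _ _ (by positivity)).ne'
  rcases eq_or_ne J ∞ with hJt | hJt
  · refine ⟨0, ?_⟩
    rw [hJt, ENNReal.mul_top (by simp)]
    exact le_top
  rcases (deepPart ρ Ω).eq_empty_or_nonempty with he | ⟨k, hk⟩
  · exact ⟨0, by simp [he]⟩
  set E := ballAverage (ρ / 4) v with hE
  have hQt : κ⁻¹ * J ≠ ∞ := ENNReal.mul_ne_top (ENNReal.inv_ne_top.2 h0) hJt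
  set D := √(κ⁻¹ * J).toReal with hD
  have henorm : ∀ t : ℝ, ‖t‖ₑ ^ 2 = ENNReal.ofReal (t ^ 2) := fun t => by
    rw [Real.enorm_eq_ofReal_abs, ← ENNReal.ofReal_pow (abs_nonneg t), sq_abs]
  have hosc : ∀ i ∈ T, ∀ x ∈ deepPart ρ Ω ∩ ball i (ρ / 8), ∀ y ∈ deepPart ρ Ω ∩ ball i (ρ / 8),
      |E x - E y| ≤ D := by
    rintro i - x ⟨hx, hxi⟩ y ⟨hy, hyi⟩
    have h := enorm_ballAverage_sub_sq_le hΩ hvc hv hρ (x := x) hy (by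
      have := dist_triangle_right x y i
      rw [mem_ball] at hxi hyi
      linarith)
    rw [henorm, ENNReal.ofReal_le_iff_le_toReal hQt] at h
    exact Real.abs_le_sqrt h
  have hall := fun x hx => abs_sub_le_card_mul hK (continuous_ballAverage (ρ / 4) hvc).continuousOn
    T (fun k => ball k (ρ / 8)) hT (Real.sqrt_nonneg _) hosc (x := x) hx hk
  refine ⟨E k, ?_⟩
  have hEpt : ∀ x ∈ deepPart ρ Ω, ‖v x - E k‖ₑ ^ 2 ≤
      2 * ‖v x - E x‖ₑ ^ 2 + 2 * (T.card ^ 2 * (κ⁻¹ * J)) := by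
    intro x hx
    have h1 : v x - E k = (v x - E x) + (E x - E k) := by ring
    rw [h1]
    refine (enorm_add_sq_le _ _).trans (add_le_add le_rfl (mul_le_mul' le_rfl ?_))
    rw [henorm]
    have h2 : (E x - E k) ^ 2 ≤ T.card ^ 2 * (κ⁻¹ * J).toReal := by
      have := pow_le_pow_left₀ (abs_nonneg _) (hall x hx) 2
      rwa [sq_abs, mul_pow, Real.sq_sqrt ENNReal.toReal_nonneg] at this
    refine (ENNReal.ofReal_le_ofReal h2).trans ?_
    rw [ENNReal.ofReal_mul (by positivity), ENNReal.ofReal_toReal hQt,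
      ENNReal.ofReal_pow (by positivity), ENNReal.ofReal_natCast]
  calc ∫⁻ x in deepPart ρ Ω, ‖v x - E k‖ₑ ^ 2
      ≤ ∫⁻ x in deepPart ρ Ω, (2 * ‖v x - E x‖ₑ ^ 2 + 2 * (T.card ^ 2 * (κ⁻¹ * J))) :=
        setLIntegral_mono' (isClosed_deepPart ρ).measurableSet hEpt
    _ = 2 * (∫⁻ x in deepPart ρ Ω, ‖v x - E x‖ₑ ^ 2) +
        2 * (T.card ^ 2 * (κ⁻¹ * J)) * volume (deepPart ρ Ω) := by
        rw [lintegral_add_right _ measurable_const, lintegral_const_mul' _ _ (by simp),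
          setLIntegral_const]
    _ ≤ 2 * J + 2 * (T.card ^ 2 * (κ⁻¹ * J)) * volume (deepPart ρ Ω) := by
        refine add_le_add (mul_le_mul' le_rfl ?_) le_rfl
        exact lintegral_sub_ballAverage_sq_le hΩ hvc hv hρ
    _ = _ := by ring

end DeepPoincare

section Hardy

variable {N : ℕ} {Ω : Set (Euc N)} {v : Euc N → ℝ} {σ : ℝ}

lemma lintegral_Ici_add_rpow_le {c : ℝ} (hc : 0 < c) :
    ∫⁻ s in Ici 0, ENNReal.ofReal (c + s) ^ (-(3 / 2) : ℝ) ≤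
      2 * ENNReal.ofReal c ^ (-(1 / 2) : ℝ) := by
  have h1 : ∫⁻ s in Ici 0, ENNReal.ofReal (c + s) ^ (-(3 / 2) : ℝ) =
      ∫⁻ t in Ioi c, ENNReal.ofReal (t ^ (-(3 / 2) : ℝ)) := by
    rw [← restrict_Ioi_eq_restrict_Ici, ← lintegral_indicator measurableSet_Ioi,
      ← lintegral_indicator measurableSet_Ioi,
      ← lintegral_add_left_eq_self ((Ioi c).indicator _) c]
    refine lintegral_congr fun s => ?_
    by_cases hs : 0 < s
    · rw [indicator_of_mem (by simpa using hs), indicator_of_mem (by simpa using hs),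
        ENNReal.ofReal_rpow_of_pos (by linarith)]
    · rw [indicator_of_notMem (by simpa using hs), indicator_of_notMem (by simpa using hs)]
  rw [h1, ← ofReal_integral_eq_lintegral_ofReal (integrableOn_Ioi_rpow_of_lt (by norm_num) hc)
    ((ae_restrict_iff' measurableSet_Ioi).2 (ae_of_all _ fun t ht =>
      Real.rpow_nonneg (hc.le.trans (le_of_lt ht)) _)),
    integral_Ioi_rpow_of_lt (by norm_num) hc, ENNReal.ofReal_rpow_of_pos hc,
    ← ENNReal.ofReal_ofNat 2, ← ENNReal.ofReal_mul (by norm_num)]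
  refine ENNReal.ofReal_le_ofReal (le_of_eq ?_)
  norm_num
  ring

lemma lintegral_Ico_sub_rpow_le {c : ℝ} (hc : 0 ≤ c) :
    ∫⁻ s in Ico 0 c, ENNReal.ofReal (c - s) ^ (-(1 / 2) : ℝ) ≤
      2 * ENNReal.ofReal c ^ (1 / 2 : ℝ) := by
  have h1 : ∫⁻ s in Ico 0 c, ENNReal.ofReal (c - s) ^ (-(1 / 2) : ℝ) =
      ∫⁻ t in Ioc 0 c, ENNReal.ofReal (t ^ (-(1 / 2) : ℝ)) := by
    rw [← lintegral_indicator measurableSet_Ico, ← lintegral_indicator measurableSet_Ioc,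
      ← lintegral_sub_left_eq_self ((Ioc 0 c).indicator _) c]
    refine lintegral_congr fun s => ?_
    by_cases hs : s ∈ Ico 0 c
    · rw [indicator_of_mem hs, indicator_of_mem (by simpa [and_comm] using hs),
        ENNReal.ofReal_rpow_of_pos (by linarith [hs.2])]
    · rw [indicator_of_notMem hs, indicator_of_notMem (by simpa [and_comm] using hs)]
  have hi : IntervalIntegrable (fun t : ℝ => t ^ (-(1 / 2) : ℝ)) volume 0 c :=
    intervalIntegral.intervalIntegrable_rpow' (by norm_num)
  rw [h1, ← ofReal_integral_eq_lintegral_ofReal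
      ((intervalIntegrable_iff_integrableOn_Ioc_of_le hc).1 hi)
    ((ae_restrict_iff' measurableSet_Ioc).2 (ae_of_all _ fun t ht => Real.rpow_nonneg ht.1.le _)),
    ← intervalIntegral.integral_of_le hc, integral_rpow (Or.inl (by norm_num)),
    ENNReal.ofReal_rpow_of_nonneg hc (by norm_num),
    ← ENNReal.ofReal_ofNat 2, ← ENNReal.ofReal_mul (by norm_num)]
  refine ENNReal.ofReal_le_ofReal (le_of_eq ?_)
  norm_num
  ring

/-- The constant of the Hardy type inequality `lintegral_shift_sub_sq_le`. -/
def hardyConst (σ : ℝ) : ℝ≥0∞ :=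
  2 * ENNReal.ofReal (4 / σ) ^ (3 / 2 : ℝ) * (2 * ENNReal.ofReal (1 / σ))

lemma hardyConst_ne_top (σ : ℝ) : hardyConst σ ≠ ∞ := by
  refine ENNReal.mul_ne_top (ENNReal.mul_ne_top (by simp) ?_) (ENNReal.mul_ne_top (by simp) (by simp))
  exact ENNReal.rpow_ne_top_of_nonneg (by norm_num) ENNReal.ofReal_ne_top

lemma mul_le_infDist_compl (hne : (Ωᶜ).Nonempty) {x : Euc N} {r : ℝ}
    (h : ∀ e : Euc N, ‖e‖ < r → x + e ∈ Ω) : r ≤ infDist x Ωᶜ := by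
  refine (le_infDist hne).2 fun y hy => ?_
  by_contra! hlt
  refine hy ?_
  have := h (y - x) (by rwa [← dist_eq_norm, dist_comm])
  simpa using this

/-- A Hardy type inequality in a direction pointing inwards. -/
lemma lintegral_shift_sub_sq_le (hΩ : IsOpen Ω) (hv : ContDiffOn ℝ 1 v Ω) (hne : (Ωᶜ).Nonempty)
    (hσ : 0 < σ) (hσ1 : σ ≤ 1) {A : Set (Euc N)} (hA : MeasurableSet A) (hAΩ : A ⊆ Ω)
    {ω : Euc N} (hω : ‖ω‖ = 1) {L : ℝ} (hL : 0 < L)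
    (hcone : ∀ w ∈ A, ∀ t, 0 < t → t ≤ L → ∀ e : Euc N, ‖e‖ < σ * t → w + t • ω + e ∈ Ω) :
    ∫⁻ x in A, ‖v (x + L • ω) - v x‖ₑ ^ 2 ≤ hardyConst σ *
      ∫⁻ x in Ω, ENNReal.ofReal (infDist x Ωᶜ) ^ 2 * ‖fderiv ℝ v x‖ₑ ^ 2 := by
  set D : Euc N → ℝ≥0∞ := fun x => ENNReal.ofReal (infDist x Ωᶜ) with hD
  set F : Euc N → ℝ≥0∞ := fun x => ‖fderiv ℝ v x‖ₑ with hF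
  have hDm : Measurable D := (continuous_infDist_pt _).measurable.ennreal_ofReal
  have hFm : Measurable F := (measurable_fderiv ℝ v).enorm
  have hpos : ∀ x ∈ Ω, 0 < infDist x Ωᶜ := fun x hx =>
    (hΩ.isClosed_compl.notMem_iff_infDist_pos hne).1 (by simpa using hx)
  have hlow : ∀ w ∈ A, ∀ t, 0 ≤ t → t ≤ L → σ * t ≤ infDist (w + t • ω) Ωᶜ := by
    intro w hw t ht htL
    rcases ht.eq_or_lt with rfl | ht
    · simpa using infDist_nonneg
    · exact mul_le_infDist_compl hne (hcone w hw t ht htL)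
  have hmem : ∀ w ∈ A, ∀ t, 0 ≤ t → t ≤ L → w + t • ω ∈ Ω := by
    intro w hw t ht htL
    rcases ht.eq_or_lt with rfl | ht
    · simpa using hAΩ hw
    · simpa using hcone w hw t ht htL 0 (by simpa using by positivity)
  set H : Euc N → ℝ≥0∞ := fun x => D x ^ (3 / 2 : ℝ) * F x ^ 2 with hH
  have hHm : Measurable H := (hDm.pow_const _).mul (hFm.pow_const 2)
  set κ : ℝ≥0∞ := ENNReal.ofReal (4 / σ) ^ (3 / 2 : ℝ) with hκ
  have hpt : ∀ x ∈ A, ‖v (x + L • ω) - v x‖ₑ ^ 2 ≤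
      2 * κ * (D x ^ (-(1 / 2) : ℝ) * ∫⁻ s in Icc 0 L, H (x + s • ω)) := by
    intro x hx
    have hδ := hpos x (hAΩ hx)
    have h1 := enorm_sub_le_lintegral_fderiv hΩ hv (y := ω) hL.le
      (fun s hs => hmem x hx s hs.1 hs.2)
    have hω' : ‖ω‖ₑ = 1 := by rw [← ofReal_norm, hω, ENNReal.ofReal_one]
    simp only [hω', mul_one] at h1
    have hline : Measurable fun s : ℝ => x + s • ω := by fun_prop
    set P : ℝ → ℝ≥0∞ := fun s => ENNReal.ofReal (infDist x Ωᶜ + s) with hP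
    have hPm : Measurable P := by fun_prop
    have h2 : ∫⁻ s in Icc 0 L, F (x + s • ω) =
        ∫⁻ s in Icc 0 L, P s ^ (-(3 / 4) : ℝ) * (P s ^ (3 / 4 : ℝ) * F (x + s • ω)) := by
      refine setLIntegral_congr_fun measurableSet_Icc fun s hs => ?_
      have hPs : P s ≠ 0 := by
        simp only [hP, ne_eq, ENNReal.ofReal_eq_zero, not_le]; linarith [hs.1]
      rw [← mul_assoc, ← ENNReal.rpow_add _ _ hPs ENNReal.ofReal_ne_top]
      norm_num
    have hsq : ∀ (a : ℝ≥0∞) (r : ℝ), (a ^ r) ^ 2 = a ^ (r * 2) := fun a r => by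
      rw [← ENNReal.rpow_natCast, ← ENNReal.rpow_mul]; norm_num
    have h3 : (∫⁻ s in Icc 0 L, F (x + s • ω)) ^ 2 ≤
        (∫⁻ s in Icc 0 L, P s ^ (-(3 / 2) : ℝ)) *
          ∫⁻ s in Icc 0 L, P s ^ (3 / 2 : ℝ) * F (x + s • ω) ^ 2 := by
      rw [h2]
      refine (sq_lintegral_mul_le (hPm.pow_const _).aemeasurable
        ((hPm.pow_const _).mul (hFm.comp hline)).aemeasurable).trans (le_of_eq ?_)
      have e1 : (-(3 / 4) : ℝ) * 2 = -(3 / 2) := by norm_num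
      have e2 : (3 / 4 : ℝ) * 2 = 3 / 2 := by norm_num
      simp only [Pi.mul_apply, Function.comp_apply, mul_pow, hsq, e1, e2]
    have h4 : ∫⁻ s in Icc 0 L, P s ^ (-(3 / 2) : ℝ) ≤ 2 * D x ^ (-(1 / 2) : ℝ) :=
      (lintegral_mono_set Icc_subset_Ici_self).trans (lintegral_Ici_add_rpow_le hδ)
    have h5 : ∫⁻ s in Icc 0 L, P s ^ (3 / 2 : ℝ) * F (x + s • ω) ^ 2 ≤
        κ * ∫⁻ s in Icc 0 L, H (x + s • ω) := by
      rw [← lintegral_const_mul _ (by fun_prop)]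
      refine setLIntegral_mono' measurableSet_Icc fun s hs => ?_
      simp only [hH, ← mul_assoc, hκ]
      refine mul_le_mul' ?_ le_rfl
      rw [← ENNReal.mul_rpow_of_nonneg _ _ (by norm_num)]
      refine ENNReal.rpow_le_rpow ?_ (by norm_num)
      simp only [hP, hD]
      rw [← ENNReal.ofReal_mul (by positivity)]
      refine ENNReal.ofReal_le_ofReal ?_
      have h6 := hlow x hx s hs.1 hs.2
      have h7 : infDist x Ωᶜ ≤ infDist (x + s • ω) Ωᶜ + s := by
        have := infDist_le_infDist_add_dist (x := x) (y := x + s • ω) (s := Ωᶜ)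
        rwa [dist_self_add_right, norm_smul, hω, mul_one, Real.norm_of_nonneg hs.1] at this
      rw [div_mul_eq_mul_div, le_div_iff₀ hσ]
      have h8 : σ * infDist x Ωᶜ ≤ σ * (infDist (x + s • ω) Ωᶜ + s) :=
        mul_le_mul_of_nonneg_left h7 hσ.le
      have h9 : σ * infDist (x + s • ω) Ωᶜ ≤ 1 * infDist (x + s • ω) Ωᶜ :=
        mul_le_mul_of_nonneg_right hσ1 infDist_nonneg
      linarith [infDist_nonneg (x := x + s • ω) (s := Ωᶜ)]
    calc ‖v (x + L • ω) - v x‖ₑ ^ 2 ≤ (∫⁻ s in Icc 0 L, F (x + s • ω)) ^ 2 := by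
          exact pow_le_pow_left' h1 2
      _ ≤ _ := h3
      _ ≤ 2 * D x ^ (-(1 / 2) : ℝ) * (κ * ∫⁻ s in Icc 0 L, H (x + s • ω)) := mul_le_mul' h4 h5
      _ = _ := by ring
  have hinner : ∀ y, ∫⁻ s in Icc 0 L, A.indicator (fun x => D x ^ (-(1 / 2) : ℝ)) (y - s • ω) ≤
      2 * ENNReal.ofReal (1 / σ) * D y ^ (1 / 2 : ℝ) := by
    intro y
    set T : Set ℝ := {s | s ∈ Icc 0 L ∧ y - s • ω ∈ A} with hT
    rcases T.eq_empty_or_nonempty with he | hTne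
    · have : ∫⁻ s in Icc 0 L, A.indicator (fun x => D x ^ (-(1 / 2) : ℝ)) (y - s • ω) = 0 := by
        rw [setLIntegral_congr_fun measurableSet_Icc (g := fun _ => 0), lintegral_zero]
        intro s hs
        refine indicator_of_notMem (fun h => ?_) _
        exact (he ▸ (⟨hs, h⟩ : s ∈ T) : s ∈ (∅ : Set ℝ))
      rw [this]; exact bot_le
    have hTb : BddAbove T := ⟨L, fun s hs => hs.1.2⟩
    set c := sSup T with hc
    have hc0 : 0 ≤ c := hTne.elim fun s hs => hs.1.1.trans (le_csSup hTb hs)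
    have hcy : σ * c ≤ infDist y Ωᶜ := by
      rw [← le_div_iff₀' hσ]
      refine csSup_le hTne fun s hs => ?_
      rw [le_div_iff₀' hσ]
      simpa using hlow _ hs.2 s hs.1.1 hs.1.2
    have hTs : ∀ s ∈ T, σ * (c - s) ≤ infDist (y - s • ω) Ωᶜ := by
      intro s hs
      have : c ≤ s + infDist (y - s • ω) Ωᶜ / σ := by
        refine csSup_le hTne fun s' hs' => ?_
        rcases le_or_gt s' s with h | h
        · have : 0 ≤ infDist (y - s • ω) Ωᶜ / σ := div_nonneg infDist_nonneg hσ.le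
          linarith
        · have h8 := hlow _ hs'.2 (s' - s) (by linarith) (by linarith [hs'.1.2, hs.1.1])
          have h9 : y - s' • ω + (s' - s) • ω = y - s • ω := by rw [sub_smul]; abel
          rw [h9, ← le_div_iff₀' hσ] at h8
          linarith
      rw [← le_div_iff₀' hσ]; linarith
    calc ∫⁻ s in Icc 0 L, A.indicator (fun x => D x ^ (-(1 / 2) : ℝ)) (y - s • ω)
        ≤ ∫⁻ s, (Icc 0 c).indicator (fun s => ENNReal.ofReal (σ * (c - s)) ^ (-(1 / 2) : ℝ)) s := by
          rw [← lintegral_indicator measurableSet_Icc]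
          refine lintegral_mono fun s => ?_
          by_cases hs : s ∈ T
          · rw [indicator_of_mem hs.1, indicator_of_mem hs.2,
              indicator_of_mem (show s ∈ Icc 0 c from ⟨hs.1.1, le_csSup hTb hs⟩)]
            simp only [ENNReal.rpow_neg]
            exact ENNReal.inv_le_inv' (ENNReal.rpow_le_rpow
              (ENNReal.ofReal_le_ofReal (hTs s hs)) (by norm_num))
          · by_cases hs' : s ∈ Icc 0 L
            · rw [indicator_of_mem hs', indicator_of_notMem (fun h => hs ⟨hs', h⟩)]
              exact bot_le
            · rw [indicator_of_notMem hs']; exact bot_le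
      _ = ∫⁻ s in Ico 0 c, ENNReal.ofReal σ ^ (-(1 / 2) : ℝ) *
            ENNReal.ofReal (c - s) ^ (-(1 / 2) : ℝ) := by
          rw [lintegral_indicator measurableSet_Icc, restrict_Ico_eq_restrict_Icc]
          refine setLIntegral_congr_fun measurableSet_Icc fun s hs => ?_
          rw [ENNReal.ofReal_mul hσ.le, ENNReal.mul_rpow_eq_ite, if_neg]
          simp
      _ ≤ ENNReal.ofReal σ ^ (-(1 / 2) : ℝ) * (2 * ENNReal.ofReal c ^ (1 / 2 : ℝ)) := by
          rw [lintegral_const_mul _ (by fun_prop)]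
          exact mul_le_mul' le_rfl (lintegral_Ico_sub_rpow_le hc0)
      _ ≤ ENNReal.ofReal σ ^ (-(1 / 2) : ℝ) * (2 * (ENNReal.ofReal (1 / σ) * D y) ^ (1 / 2 : ℝ)) := by
          refine mul_le_mul' le_rfl (mul_le_mul' le_rfl (ENNReal.rpow_le_rpow ?_ (by norm_num)))
          rw [hD, ← ENNReal.ofReal_mul (by positivity)]
          refine ENNReal.ofReal_le_ofReal ?_
          rw [one_div, inv_mul_eq_div, le_div_iff₀' hσ]
          exact hcy
      _ = _ := by
          rw [ENNReal.mul_rpow_of_nonneg _ _ (by norm_num)]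
          have : ENNReal.ofReal σ ^ (-(1 / 2) : ℝ) * ENNReal.ofReal (1 / σ) ^ (1 / 2 : ℝ) =
              ENNReal.ofReal (1 / σ) := by
            rw [ENNReal.rpow_neg, ← ENNReal.inv_rpow, ← ENNReal.ofReal_inv_of_pos hσ, ← one_div σ,
              ← ENNReal.rpow_add_of_nonneg _ _ (by norm_num) (by norm_num), add_halves,
              ENNReal.rpow_one]
          rw [← mul_assoc, mul_comm _ (2 : ℝ≥0∞), mul_assoc, ← mul_assoc (_ ^ (-(1 / 2) : ℝ)), this,
            mul_assoc]
  have hmeas : Measurable fun q : Euc N × ℝ =>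
      A.indicator (fun x => D x ^ (-(1 / 2) : ℝ)) q.1 * H (q.1 + q.2 • ω) :=
    (((hDm.pow_const _).indicator hA).comp measurable_fst).mul (hHm.comp (by fun_prop))
  calc ∫⁻ x in A, ‖v (x + L • ω) - v x‖ₑ ^ 2
      ≤ ∫⁻ x in A, 2 * κ * (D x ^ (-(1 / 2) : ℝ) * ∫⁻ s in Icc 0 L, H (x + s • ω)) :=
        setLIntegral_mono' hA hpt
    _ = 2 * κ * ∫⁻ x in A, (D x ^ (-(1 / 2) : ℝ) * ∫⁻ s in Icc 0 L, H (x + s • ω)) := by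
        refine lintegral_const_mul' _ _ (ENNReal.mul_ne_top (by simp) ?_)
        exact ENNReal.rpow_ne_top_of_nonneg (by norm_num) ENNReal.ofReal_ne_top
    _ = 2 * κ * ∫⁻ x, ∫⁻ s in Icc 0 L,
          A.indicator (fun x => D x ^ (-(1 / 2) : ℝ)) x * H (x + s • ω) := by
        rw [← lintegral_indicator hA]
        congr 1
        refine lintegral_congr fun x => ?_
        rw [lintegral_const_mul _ (by fun_prop)]
        by_cases hx : x ∈ A <;> simp [hx]
    _ = 2 * κ * ∫⁻ s in Icc 0 L, ∫⁻ x,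
          A.indicator (fun x => D x ^ (-(1 / 2) : ℝ)) x * H (x + s • ω) := by
        rw [lintegral_lintegral_swap hmeas.aemeasurable]
    _ = 2 * κ * ∫⁻ s in Icc 0 L, ∫⁻ y,
          A.indicator (fun x => D x ^ (-(1 / 2) : ℝ)) (y - s • ω) * H y := by
        congr 1
        refine lintegral_congr fun s => ?_
        rw [← lintegral_add_right_eq_self (fun y =>
          A.indicator (fun x => D x ^ (-(1 / 2) : ℝ)) (y - s • ω) * H y) (s • ω)]
        simp
    _ = 2 * κ * ∫⁻ y, (∫⁻ s in Icc 0 L,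
          A.indicator (fun x => D x ^ (-(1 / 2) : ℝ)) (y - s • ω)) * H y := by
        rw [lintegral_lintegral_swap]
        · congr 1
          refine lintegral_congr fun y => lintegral_mul_const _ ?_
          exact ((hDm.pow_const _).indicator hA).comp (by fun_prop)
        · exact ((((hDm.pow_const _).indicator hA).comp (by fun_prop)).mul
            (hHm.comp measurable_snd)).aemeasurable
    _ ≤ 2 * κ * ∫⁻ y, 2 * ENNReal.ofReal (1 / σ) * (D y ^ 2 * F y ^ 2) := by
        refine mul_le_mul' le_rfl (lintegral_mono fun y => ?_)
        refine (mul_le_mul' (hinner y) le_rfl).trans (le_of_eq ?_)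
        have : D y ^ 2 = D y ^ (1 / 2 : ℝ) * D y ^ (3 / 2 : ℝ) := by
          rw [← ENNReal.rpow_add_of_nonneg _ _ (by norm_num) (by norm_num)]
          norm_num
        rw [this]; ring
    _ = hardyConst σ * ∫⁻ x in Ω, D x ^ 2 * F x ^ 2 := by
        rw [lintegral_const_mul _ (by fun_prop), ← mul_assoc, hardyConst]
        congr 1
        rw [← lintegral_indicator hΩ.measurableSet]
        refine lintegral_congr fun y => ?_
        by_cases hy : y ∈ Ω
        · simp [hy]
        · simp [hy, hD, infDist_zero_of_mem (show y ∈ Ωᶜ from hy)]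

end Hardy

section WeightedPoincare

variable {N : ℕ}

lemma setLIntegral_biUnion_finset_le {α ι : Type*} [MeasurableSpace α] {μ : Measure α}
    (f : α → ℝ≥0∞) (s : Finset ι) (t : ι → Set α) :
    ∫⁻ x in ⋃ i ∈ s, t i, f x ∂μ ≤ ∑ i ∈ s, ∫⁻ x in t i, f x ∂μ := by
  classical
  induction s using Finset.induction_on with
  | empty => simp
  | insert a s ha ih =>
    rw [Finset.sum_insert ha, Finset.set_biUnion_insert]
    exact (lintegral_union_le _ _ _).trans (add_le_add le_rfl ih)

/-- A Poincaré inequality weighted by the distance to the boundary, with a constant which is uniform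
in the class of domains satisfying a given interior cone condition. -/
theorem exists_weighted_poincare (N : ℕ) {σ b : ℝ} (d : ℝ) (hσ : 0 < σ) (hσ1 : σ ≤ 1)
    (hb : 0 < b) : ∃ C : ℝ≥0∞, C ≠ ∞ ∧ ∀ Ω : Set (Euc N), IsOpen Ω → IsConnected Ω →
      (Ωᶜ).Nonempty → (∀ x ∈ Ω, ∀ y ∈ Ω, dist x y ≤ d) → BallConeCond σ b Ω →
      ∀ v : Euc N → ℝ, Continuous v → ContDiffOn ℝ 1 v Ω → ∃ c : ℝ,
        ∫⁻ x in Ω, ‖v x - c‖ₑ ^ 2 ≤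
          C * ∫⁻ x in Ω, ENNReal.ofReal (infDist x Ωᶜ) ^ 2 * ‖fderiv ℝ v x‖ₑ ^ 2 := by
  set L := b / 8 with hL
  have hL0 : 0 < L := by positivity
  set ρ := σ * L with hρ
  have hρ0 : 0 < ρ := by positivity
  have hρL : ρ ≤ L := by nlinarith
  obtain ⟨T₀, -, hT₀f, hT₀⟩ := (isCompact_closedBall (0 : Euc N) d).finite_cover_balls
    (show 0 < ρ / 8 by positivity)
  set n := hT₀f.toFinset.card with hn
  set κ := volume (closedBall (0 : Euc N) (ρ / 4)) with hκ
  have hκ0 : κ ≠ 0 := (measure_closedBall_pos _ _ (by positivity)).ne'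
  set C₁ : ℝ≥0∞ := 2 + 2 * (volume (closedBall (0 : Euc N) d) * (n ^ 2 * κ⁻¹)) with hC₁
  have hC₁t : C₁ ≠ ∞ := by
    refine ENNReal.add_ne_top.2 ⟨by simp, ENNReal.mul_ne_top (by simp)
      (ENNReal.mul_ne_top measure_closedBall_lt_top.ne (ENNReal.mul_ne_top (by simp) ?_))⟩
    exact ENNReal.inv_ne_top.2 hκ0
  refine ⟨C₁ + n * (2 * hardyConst σ + 2 * C₁), ?_, ?_⟩
  · exact ENNReal.add_ne_top.2 ⟨hC₁t, ENNReal.mul_ne_top (by simp) (ENNReal.add_ne_top.2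
      ⟨ENNReal.mul_ne_top (by simp) (hardyConst_ne_top σ), ENNReal.mul_ne_top (by simp) hC₁t⟩)⟩
  intro Ω hΩ hconn hne hdiam hcone v hvc hv
  set I := ∫⁻ x in Ω, ENNReal.ofReal (infDist x Ωᶜ) ^ 2 * ‖fderiv ℝ v x‖ₑ ^ 2 with hI
  obtain ⟨x₀, hx₀⟩ := hconn.nonempty
  set T := hT₀f.toFinset.map (addRightEmbedding x₀) with hT
  have hcover : ∀ x ∈ Ω, ∃ k ∈ T, x ∈ ball k (ρ / 8) := by
    intro x hx
    have h1 : x - x₀ ∈ closedBall (0 : Euc N) d := by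
      simpa [← dist_eq_norm] using hdiam x hx x₀ hx₀
    obtain ⟨k, hk, hxk⟩ := mem_iUnion₂.1 (hT₀ h1)
    refine ⟨k + x₀, by simpa [hT] using hk, ?_⟩
    rw [mem_ball, dist_eq_norm] at hxk ⊢
    rwa [← sub_sub, sub_right_comm]
  have hTcard : T.card = n := by simp [hT, hn]
  set K := deepPart ρ Ω with hK
  have hKΩ : K ⊆ Ω := deepPart_subset hρ0
  have hKm : MeasurableSet K := (isClosed_deepPart ρ).measurableSet
  obtain ⟨c, hc⟩ := exists_lintegral_deepPart_sub_sq_le hΩ hvc hv hρ0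
    (isPreconnected_deepPart hΩ hconn.isPreconnected hσ hσ1 hcone hL0 (by rw [hL]; linarith)) T
    (fun x hx => by simpa using hcover x (hKΩ hx))
  refine ⟨c, ?_⟩
  set M := ∫⁻ x in K, ‖v x - c‖ₑ ^ 2 with hM
  have hMI : M ≤ C₁ * I := by
    refine hc.trans (mul_le_mul' ?_ ?_)
    · rw [hC₁, hTcard]
      refine add_le_add le_rfl (mul_le_mul' le_rfl (mul_le_mul' ?_ le_rfl))
      rw [← Measure.addHaar_closedBall_center volume x₀ d]
      exact measure_mono fun x hx => hdiam x (hKΩ hx) x₀ hx₀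
    · rw [← lintegral_const_mul' _ _ (by simp)]
      refine (setLIntegral_mono' (isClosed_deepPart _).measurableSet fun x hx => ?_).trans
        (lintegral_mono_set (deepPart_subset (by positivity)))
      refine mul_le_mul' (pow_le_pow_left' (ENNReal.ofReal_le_ofReal ?_) 2) le_rfl
      have : ρ / 2 ≤ infDist x Ωᶜ := mul_le_infDist_compl hne fun e he =>
        add_mem_of_mem_deepPart hx he
      linarith
  have hpiece : ∀ k ∈ T, ∫⁻ x in (Ω ∩ ball k (ρ / 8)) \ K, ‖v x - c‖ₑ ^ 2 ≤
      2 * (hardyConst σ * I) + 2 * M := by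
    intro k _
    rcases ((Ω ∩ ball k (ρ / 8)) \ K).eq_empty_or_nonempty with he | ⟨x, ⟨hxΩ, hxk⟩, hxK⟩
    · simp [he]
    obtain ⟨p, hp, hxp⟩ := exists_frontier_dist_lt hΩ hxΩ hxK
    obtain ⟨ω, hω, hcone'⟩ := hcone p hp
    set A := Ω ∩ ball k (ρ / 8) with hA
    have hAm : MeasurableSet A := hΩ.measurableSet.inter measurableSet_ball
    have hcA : ∀ w ∈ A, ∀ t, 0 < t → t ≤ L → ∀ e : Euc N, ‖e‖ < σ * t → w + t • ω + e ∈ Ω := by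
      intro w hw t ht htL
      refine hcone' w (subset_closure hw.1) ?_ t ht (by linarith)
      have h1 := hw.2
      rw [mem_ball] at h1 hxk
      have h2 := dist_triangle w x p
      have h3 := dist_triangle_right w x k
      linarith
    have h1 := lintegral_shift_sub_sq_le hΩ hv hne hσ hσ1 hAm inter_subset_left hω hL0 hcA
    have h2 : ∫⁻ x in A, ‖v (x + L • ω) - c‖ₑ ^ 2 ≤ M := by
      rw [hM, ← lintegral_indicator hAm, ← lintegral_indicator hKm,
        ← lintegral_add_right_eq_self (K.indicator _) (L • ω)]
      refine lintegral_mono fun x => ?_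
      by_cases hx : x ∈ A
      · have hxK : x + L • ω ∈ K := by
          intro y hy
          have := hcA x hx L hL0 le_rfl (y - (x + L • ω)) (by rwa [← dist_eq_norm, ← mem_ball])
          simpa using this
        simp [hx, hxK]
      · simp [hx]
    have hsh : Measurable fun x => ‖v (x + L • ω) - v x‖ₑ ^ 2 := by fun_prop
    calc ∫⁻ x in A \ K, ‖v x - c‖ₑ ^ 2 ≤ ∫⁻ x in A, ‖v x - c‖ₑ ^ 2 :=
          lintegral_mono_set sdiff_subset
      _ ≤ ∫⁻ x in A, (2 * ‖v (x + L • ω) - v x‖ₑ ^ 2 + 2 * ‖v (x + L • ω) - c‖ₑ ^ 2) := by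
          refine lintegral_mono fun x => ?_
          have h3 : v x - c = -(v (x + L • ω) - v x) + (v (x + L • ω) - c) := by ring
          rw [h3]
          refine (enorm_add_sq_le _ _).trans ?_
          rw [enorm_neg]
      _ = 2 * (∫⁻ x in A, ‖v (x + L • ω) - v x‖ₑ ^ 2) +
          2 * ∫⁻ x in A, ‖v (x + L • ω) - c‖ₑ ^ 2 := by
          rw [lintegral_add_left (hsh.const_mul 2), lintegral_const_mul' _ _ (by simp),
            lintegral_const_mul' _ _ (by simp)]
      _ ≤ _ := add_le_add (mul_le_mul' le_rfl h1) (mul_le_mul' le_rfl h2)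
  have hΩsub : Ω ⊆ K ∪ ⋃ k ∈ T, (Ω ∩ ball k (ρ / 8)) \ K := by
    intro x hx
    by_cases hxK : x ∈ K
    · exact Or.inl hxK
    · obtain ⟨k, hk, hxk⟩ := hcover x hx
      exact Or.inr (mem_iUnion₂.2 ⟨k, hk, ⟨hx, hxk⟩, hxK⟩)
  calc ∫⁻ x in Ω, ‖v x - c‖ₑ ^ 2
      ≤ ∫⁻ x in K ∪ ⋃ k ∈ T, (Ω ∩ ball k (ρ / 8)) \ K, ‖v x - c‖ₑ ^ 2 := lintegral_mono_set hΩsub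
    _ ≤ M + ∑ k ∈ T, ∫⁻ x in (Ω ∩ ball k (ρ / 8)) \ K, ‖v x - c‖ₑ ^ 2 :=
        (lintegral_union_le _ _ _).trans (add_le_add le_rfl (setLIntegral_biUnion_finset_le _ _ _))
    _ ≤ M + T.card • (2 * (hardyConst σ * I) + 2 * M) :=
        add_le_add le_rfl (Finset.sum_le_card_nsmul _ _ _ hpiece)
    _ ≤ C₁ * I + n * (2 * (hardyConst σ * I) + 2 * (C₁ * I)) := by
        rw [hTcard, nsmul_eq_mul]
        gcongr
    _ = _ := by ring

/-- The weighted Poincaré inequality for functions with zero mean. -/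
theorem exists_weighted_poincare_of_integral_eq_zero (N : ℕ) {σ b : ℝ} (d : ℝ) (hσ : 0 < σ)
    (hσ1 : σ ≤ 1) (hb : 0 < b) : ∃ C : ℝ, 0 ≤ C ∧ ∀ Ω : Set (Euc N), IsOpen Ω → IsConnected Ω →
      Bornology.IsBounded Ω → (Ωᶜ).Nonempty → (∀ x ∈ Ω, ∀ y ∈ Ω, dist x y ≤ d) →
      BallConeCond σ b Ω → ∀ v : Euc N → ℝ, Continuous v → ContDiffOn ℝ 1 v Ω →
      ∫ x in Ω, v x = 0 → ∀ w : Euc N → ℝ, IntegrableOn w Ω →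
      (∀ x ∈ Ω, infDist x Ωᶜ ^ 2 * ‖fderiv ℝ v x‖ ^ 2 ≤ w x) →
      ∫ x in Ω, v x ^ 2 ≤ C * ∫ x in Ω, w x := by
  obtain ⟨C, hC, h⟩ := exists_weighted_poincare N d hσ hσ1 hb
  refine ⟨C.toReal, ENNReal.toReal_nonneg, ?_⟩
  intro Ω hΩ hconn hbdd hne hdiam hcone v hvc hv hmean w hw hvw
  obtain ⟨c, hc⟩ := h Ω hΩ hconn hne hdiam hcone v hvc hv
  have hint : ∀ f : Euc N → ℝ, Continuous f → IntegrableOn f Ω := fun f hf =>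
    (hf.continuousOn.integrableOn_compact hbdd.isCompact_closure).mono_set subset_closure
  have hw0 : ∀ x ∈ Ω, 0 ≤ w x := fun x hx => (by positivity : (0 : ℝ) ≤ _).trans (hvw x hx)
  have henorm : ∀ t : ℝ, ‖t‖ₑ ^ 2 = ENNReal.ofReal (t ^ 2) := fun t => by
    rw [Real.enorm_eq_ofReal_abs, ← ENNReal.ofReal_pow (abs_nonneg t), sq_abs]
  have h1 : ∫ x in Ω, v x ^ 2 ≤ ∫ x in Ω, (v x - c) ^ 2 := by
    have h2 : ∫ x in Ω, (v x - c) ^ 2 = (∫ x in Ω, v x ^ 2) - 2 * c * (∫ x in Ω, v x) +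
        ∫ x in Ω, c ^ 2 := by
      rw [← integral_const_mul, ← integral_sub (hint _ (by fun_prop)) (hint _ (by fun_prop)),
        ← integral_add (hint _ (by fun_prop)) (hint _ (by fun_prop))]
      exact integral_congr_ae (ae_of_all _ fun x => by ring)
    rw [h2, hmean]
    have : 0 ≤ ∫ x in Ω, c ^ 2 := integral_nonneg fun x => sq_nonneg c
    linarith
  refine h1.trans ?_
  have h3 : ENNReal.ofReal (∫ x in Ω, (v x - c) ^ 2) = ∫⁻ x in Ω, ‖v x - c‖ₑ ^ 2 := by
    rw [ofReal_integral_eq_lintegral_ofReal (hint _ (by fun_prop)) (ae_of_all _ fun x => sq_nonneg _)]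
    simp only [henorm]
  have h4 : ∫⁻ x in Ω, ENNReal.ofReal (infDist x Ωᶜ) ^ 2 * ‖fderiv ℝ v x‖ₑ ^ 2 ≤
      ENNReal.ofReal (∫ x in Ω, w x) := by
    rw [ofReal_integral_eq_lintegral_ofReal hw
      ((ae_restrict_iff' hΩ.measurableSet).2 (ae_of_all _ hw0))]
    refine setLIntegral_mono' hΩ.measurableSet fun x hx => ?_
    rw [← ofReal_norm, ← ENNReal.ofReal_pow infDist_nonneg, ← ENNReal.ofReal_pow (norm_nonneg _),
      ← ENNReal.ofReal_mul (by positivity)]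
    exact ENNReal.ofReal_le_ofReal (hvw x hx)
  have h5 : 0 ≤ ∫ x in Ω, w x := setIntegral_nonneg hΩ.measurableSet hw0
  rw [← ENNReal.ofReal_le_ofReal_iff (by positivity), h3, ENNReal.ofReal_mul ENNReal.toReal_nonneg,
    ENNReal.ofReal_toReal hC]
  exact hc.trans (mul_le_mul' le_rfl h4)

end WeightedPoincare

section Cone

variable {N : ℕ} {Ω : Set (Euc N)}

lemma UnifConeCond.ballConeCond {θ a : ℝ} (hθ : θ ∈ Ioc (0 : ℝ) (π / 2))
    (h : UnifConeCond θ a Ω) : BallConeCond (Real.sin θ) (a / 4) Ω := by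
  have hs : 0 < Real.sin θ := Real.sin_pos_of_pos_of_lt_pi hθ.1 (by linarith [hθ.2, Real.pi_pos])
  have hc : 0 ≤ Real.cos θ := Real.cos_nonneg_of_mem_Icc ⟨by linarith [hθ.1, Real.pi_pos], hθ.2⟩
  have hsc := Real.sin_sq_add_cos_sq θ
  have hs1 := Real.sin_le_one θ
  intro p hp
  obtain ⟨ω, hω, hcone⟩ := h p hp
  refine ⟨ω, hω, fun w hw hwp t ht hta e he => ?_⟩
  rw [add_assoc]
  have hαe : |⟪e, ω⟫| ≤ ‖e‖ := by simpa [hω] using abs_real_inner_le_norm e ω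
  have hα := (abs_le.1 hαe).1
  have hst : Real.sin θ * t ≤ t := by nlinarith
  have hin : ⟪t • ω + e, ω⟫ = t + ⟪e, ω⟫ := by
    rw [inner_add_left, real_inner_smul_left, real_inner_self_eq_norm_sq, hω]; ring
  have hno : ‖t • ω + e‖ ^ 2 = t ^ 2 + 2 * t * ⟪e, ω⟫ + ‖e‖ ^ 2 := by
    rw [norm_add_sq_real, norm_smul, hω, real_inner_smul_left, Real.norm_of_nonneg ht.le,
      real_inner_comm]; ring
  refine hcone w ⟨by rw [mem_ball]; linarith, hw⟩ _ ?_ ?_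
  · rw [hin]
    rcases hc.eq_or_lt with hc0 | hc0
    · rw [← hc0]; linarith
    · refine lt_of_pow_lt_pow_left₀ 2 (by linarith) ?_
      rw [mul_pow, hno]
      have h1 : ‖e‖ ^ 2 < (Real.sin θ * t) ^ 2 := pow_lt_pow_left₀ he (norm_nonneg e) two_ne_zero
      have h2 : Real.cos θ ^ 2 = 1 - Real.sin θ ^ 2 := by linarith
      have h3 : ‖e‖ ^ 2 * Real.cos θ ^ 2 < (Real.sin θ * t) ^ 2 * Real.cos θ ^ 2 :=
        mul_lt_mul_of_pos_right h1 (by positivity)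
      nlinarith [sq_nonneg (⟪e, ω⟫ + Real.sin θ ^ 2 * t)]
  · refine (norm_add_le _ _).trans_lt ?_
    rw [norm_smul, hω, Real.norm_of_nonneg ht.le]
    linarith

end Cone

section MaximumPrinciple

variable {N : ℕ} {Ω : Set (Euc N)} {u : Euc N → ℝ}

lemma hasDerivAt_comp_add_smul {f : Euc N → ℝ} {x e : Euc N} {t : ℝ}
    (hf : DifferentiableAt ℝ f (x + t • e)) :
    HasDerivAt (fun s : ℝ => f (x + s • e)) (fderiv ℝ f (x + t • e) e) t := by
  have h : HasDerivAt (fun s : ℝ => x + s • e) e t := by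
    simpa using ((hasDerivAt_id t).smul_const e).const_add x
  exact hf.hasFDerivAt.comp_hasDerivAt t h

/-- A `C²` function of one variable does not have a local maximum where its second derivative is
positive. -/
lemma not_isLocalMax_of_deriv_deriv_pos {φ φ' : ℝ → ℝ} {t₀ k : ℝ} (hk : 0 < k)
    (h1 : ∀ᶠ t in 𝓝 t₀, HasDerivAt φ (φ' t) t) (h2 : HasDerivAt φ' k t₀) :
    ¬ IsLocalMax φ t₀ := by
  intro hmax
  have hd : deriv φ =ᶠ[𝓝 t₀] φ' := h1.mono fun t ht => ht.deriv
  have hdd : deriv (deriv φ) t₀ = k := by rw [hd.deriv_eq]; exact h2.deriv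
  have hmin : IsLocalMin φ t₀ := isLocalMin_of_deriv_deriv_pos (by rwa [hdd])
    hmax.deriv_eq_zero h1.self_of_nhds.continuousAt
  have hconst : φ =ᶠ[𝓝 t₀] fun _ => φ t₀ := by
    filter_upwards [hmax, hmin] with t ha hb using le_antisymm ha hb
  have h3 : deriv φ =ᶠ[𝓝 t₀] fun _ => 0 := by simpa using hconst.deriv
  have h4 : deriv (deriv φ) t₀ = 0 := by rw [h3.deriv_eq]; simp
  linarith

/-- The torsion function lies below the paraboloid vanishing on the largest inscribed ball. -/
lemma IsTorsion.infDist_sq_le (hN : 0 < N) (hΩ : IsOpen Ω) (hb : Bornology.IsBounded Ω)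
    (hu : IsTorsion Ω u) {x : Euc N} (hx : x ∈ Ω) : infDist x Ωᶜ ^ 2 / 2 ≤ -u x := by
  obtain ⟨huc, hu2, hlap, hu0⟩ := hu
  have key : ∀ c : ℝ, 0 ≤ c → c < 1 → c * (infDist x Ωᶜ ^ 2 / 2) ≤ -u x := by
    intro c hc0 hc1
    set w : Euc N → ℝ := fun y => u y - c * (‖y - x‖ ^ 2 / 2) with hw
    have hwc : ContinuousOn w (closure Ω) := huc.sub (by fun_prop)
    obtain ⟨y, hy, hmax⟩ := hb.isCompact_closure.exists_isMaxOn ⟨x, subset_closure hx⟩ hwc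
    by_cases hyΩ : y ∈ Ω
    · exfalso
      have hpos : 0 < ∑ i : Fin N, (hessEntry u y i i - c) := by
        have : ∑ i : Fin N, hessEntry u y i i = N := hlap y hyΩ
        rw [Finset.sum_sub_distrib, this]
        simp only [Finset.sum_const, Finset.card_univ, Fintype.card_fin, nsmul_eq_mul]
        have : (0 : ℝ) < N := by exact_mod_cast hN
        nlinarith
      obtain ⟨i, -, hi⟩ := Finset.exists_lt_of_sum_lt (s := Finset.univ)
        (f := fun _ : Fin N => (0 : ℝ))
        (g := fun i => hessEntry u y i i - c) (by rw [Finset.sum_const_zero]; exact hpos)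
      set e : Euc N := EuclideanSpace.single i (1 : ℝ) with he
      have hline : Continuous fun t : ℝ => y + t • e := by fun_prop
      have hnear : ∀ᶠ t : ℝ in 𝓝 0, y + t • e ∈ Ω :=
        hline.continuousAt.eventually_mem (hΩ.mem_nhds (by simpa using hyΩ))
      have hq : ∀ t : ℝ, HasDerivAt (fun s : ℝ => c * (‖y + s • e - x‖ ^ 2 / 2))
          (c * (⟪y - x, e⟫ + t)) t := by
        intro t
        have h1 : (fun s : ℝ => c * (‖y + s • e - x‖ ^ 2 / 2)) =
            fun s : ℝ => c * ((‖y - x‖ ^ 2 + 2 * s * ⟪y - x, e⟫ + s ^ 2) / 2) := by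
          funext s
          have : y + s • e - x = (y - x) + s • e := by abel
          rw [this, norm_add_sq_real, real_inner_smul_right, norm_smul, mul_pow]
          have he1 : ‖e‖ = 1 := by simp [he]
          rw [he1, Real.norm_eq_abs, sq_abs]
          ring
        rw [h1]
        have h2 : HasDerivAt (fun s : ℝ => c * ((‖y - x‖ ^ 2 + 2 * s * ⟪y - x, e⟫ + s ^ 2) / 2))
            (c * ((2 * 1 * ⟪y - x, e⟫ + (2 : ℕ) * t ^ (2 - 1) * 1) / 2)) t :=
          (((((((hasDerivAt_id t).const_mul 2).mul_const _).const_add _).add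
            ((hasDerivAt_id t).pow 2)).div_const 2).const_mul c)
        convert h2 using 1
        push_cast
        ring
      refine not_isLocalMax_of_deriv_deriv_pos (φ := fun t : ℝ => w (y + t • e))
        (φ' := fun t : ℝ => fderiv ℝ u (y + t • e) e - c * (⟪y - x, e⟫ + t)) (t₀ := 0) hi ?_ ?_ ?_
      · filter_upwards [hnear] with t ht
        exact (hasDerivAt_comp_add_smul ((hu2.differentiableOn two_ne_zero).differentiableAt
          (hΩ.mem_nhds ht))).sub (hq t)
      · have h1 : DifferentiableAt ℝ (fun z => fderiv ℝ u z e) (y + (0 : ℝ) • e) := by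
          have : ContDiffOn ℝ 1 (fderiv ℝ u) Ω := hu2.fderiv_of_isOpen hΩ (by norm_num)
          exact ((this.differentiableOn one_ne_zero).differentiableAt
            (hΩ.mem_nhds (by simpa using hyΩ))).clm_apply (differentiableAt_const e)
        have h2 := hasDerivAt_comp_add_smul h1
        have h3 : HasDerivAt (fun t : ℝ => c * (⟪y - x, e⟫ + t)) c 0 := by
          simpa using ((hasDerivAt_id (0 : ℝ)).const_add ⟪y - x, e⟫).const_mul c
        have h4 := h2.sub h3
        simp only [zero_smul, add_zero] at h4
        exact h4
      · filter_upwards [hnear] with t ht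
        simpa using hmax (subset_closure ht)
    · have hyf : y ∈ frontier Ω := ⟨hy, by rwa [hΩ.interior_eq]⟩
      have h1 : w x ≤ w y := hmax (subset_closure hx)
      simp only [hw, sub_self, norm_zero, hu0 y hyf] at h1
      have h2 : infDist x Ωᶜ ≤ ‖y - x‖ := by
        rw [← dist_eq_norm, dist_comm]
        exact infDist_le_dist_of_mem hyΩ
      have h3 : infDist x Ωᶜ ^ 2 ≤ ‖y - x‖ ^ 2 := pow_le_pow_left₀ infDist_nonneg h2 2
      nlinarith
  have hlim : Tendsto (fun c : ℝ => c * (infDist x Ωᶜ ^ 2 / 2)) (𝓝[<] 1)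
      (𝓝 (1 * (infDist x Ωᶜ ^ 2 / 2))) :=
    ((continuous_id.mul continuous_const).tendsto 1).mono_left nhdsWithin_le_nhds
  rw [one_mul] at hlim
  refine le_of_tendsto hlim ?_
  filter_upwards [Ioo_mem_nhdsLT (show (0 : ℝ) < 1 by norm_num)] with c hc using key c hc.1.le hc.2

lemma IsTorsion.neg_of_mem (hN : 0 < N) (hΩ : IsOpen Ω) (hb : Bornology.IsBounded Ω)
    (hu : IsTorsion Ω u) (hne : (Ωᶜ).Nonempty) {x : Euc N} (hx : x ∈ Ω) : u x < 0 := by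
  have h1 := hu.infDist_sq_le hN hΩ hb hx
  have h2 : 0 < infDist x Ωᶜ := (hΩ.isClosed_compl.notMem_iff_infDist_pos hne).1 (by simpa using hx)
  nlinarith

end MaximumPrinciple

section DefiningFunction

/-- The volume constant of a boundary layer. -/
def layerConst (N : ℕ) (σ m : ℝ) : ℝ≥0∞ :=
  2 ^ N * volume (ball (0 : Euc N) 1) * ENNReal.ofReal (4 / (m * σ))

lemma layerConst_ne_top (N : ℕ) (σ m : ℝ) : layerConst N σ m ≠ ∞ :=
  ENNReal.mul_ne_top (ENNReal.mul_ne_top (by simp) measure_ball_lt_top.ne) ENNReal.ofReal_ne_top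

/-- `U` is negative in the bounded open set `Ω`, vanishes outside, and has in `Ω` a gradient which
agrees with the continuous field `G`, nondegenerate at the boundary. The set `Ω` satisfies an
interior cone condition. -/
structure IsDefiningFn {N : ℕ} (σ b m : ℝ) (Ω : Set (Euc N)) (U : Euc N → ℝ)
    (G : Euc N → Euc N) : Prop where
  σ_pos : 0 < σ
  σ_le_one : σ ≤ 1
  b_pos : 0 < b
  m_pos : 0 < m
  isOpen : IsOpen Ω
  isBounded : Bornology.IsBounded Ω
  cone : BallConeCond σ b Ω
  continuous : Continuous U
  continuous_grad : Continuous G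
  eq_zero : ∀ x ∉ Ω, U x = 0
  neg : ∀ x ∈ Ω, U x < 0
  hasFDerivAt : ∀ x ∈ Ω, HasFDerivAt U (innerSL ℝ (G x)) x
  le_norm : ∀ p ∈ frontier Ω, m ≤ ‖G p‖

namespace IsDefiningFn

variable {N : ℕ} {σ b m : ℝ} {Ω : Set (Euc N)} {U : Euc N → ℝ} {G : Euc N → Euc N}

lemma isCompact_frontier (h : IsDefiningFn σ b m Ω U G) : IsCompact (frontier Ω) :=
  h.isBounded.isCompact_closure.of_isClosed_subset isClosed_frontier frontier_subset_closure

lemma notMem_of_mem_frontier (h : IsDefiningFn σ b m Ω U G) {p : Euc N} (hp : p ∈ frontier Ω) :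
    p ∉ Ω := by
  have := hp.2
  rwa [h.isOpen.interior_eq] at this

lemma hasDerivAt_line (h : IsDefiningFn σ b m Ω U G) {x y : Euc N} {t : ℝ} (ht : x + t • y ∈ Ω) :
    HasDerivAt (fun s : ℝ => U (x + s • y)) ⟪G (x + t • y), y⟫ t := by
  have h1 := hasDerivAt_comp_add_smul (h.hasFDerivAt _ ht).differentiableAt
  rwa [(h.hasFDerivAt _ ht).fderiv, innerSL_apply_apply] at h1

lemma inner_grad_nonpos (h : IsDefiningFn σ b m Ω U G) {p y : Euc N} (hp : p ∈ frontier Ω)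
    {r : ℝ} (hr : 0 < r) (hy : ∀ t, 0 < t → t ≤ r → p + t • y ∈ Ω) : ⟪G p, y⟫ ≤ 0 := by
  by_contra! hpos
  have hc : Continuous fun t : ℝ => ⟪G (p + t • y), y⟫ :=
    (h.continuous_grad.comp (by fun_prop)).inner continuous_const
  have hev : ∀ᶠ t : ℝ in 𝓝 0, 0 < ⟪G (p + t • y), y⟫ :=
    hc.continuousAt.eventually_const_lt (by simpa using hpos)
  obtain ⟨δ, hδ, hδ'⟩ := Metric.eventually_nhds_iff.1 hev
  set s := min r (δ / 2) with hs
  have hs0 : 0 < s := lt_min hr (by positivity)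
  have hmono : StrictMonoOn (fun t : ℝ => U (p + t • y)) (Icc 0 s) := by
    refine strictMonoOn_of_deriv_pos (convex_Icc 0 s)
      (h.continuous.comp (by fun_prop)).continuousOn fun t ht => ?_
    rw [interior_Icc] at ht
    rw [(h.hasDerivAt_line (hy t ht.1 (ht.2.le.trans (min_le_left _ _)))).deriv]
    refine hδ' ?_
    rw [Real.dist_eq, sub_zero, abs_of_pos ht.1]
    linarith [ht.2, min_le_right r (δ / 2)]
  have h1 := hmono (left_mem_Icc.2 hs0.le) (right_mem_Icc.2 hs0.le) hs0
  simp only [zero_smul, add_zero, h.eq_zero p (h.notMem_of_mem_frontier hp)] at h1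
  exact h1.not_gt (h.neg _ (hy s hs0 (min_le_left _ _)))

lemma inner_grad_le (h : IsDefiningFn σ b m Ω U G) {p ω : Euc N} (hp : p ∈ frontier Ω)
    (hω : ∀ t, 0 < t → t ≤ b → ∀ e : Euc N, ‖e‖ < σ * t → p + t • ω + e ∈ Ω) :
    ⟪G p, ω⟫ ≤ -(m * σ) := by
  have hGm := h.le_norm p hp
  have hm := h.m_pos
  have hG : 0 < ‖G p‖ := hm.trans_le hGm
  have key : ∀ s, 0 ≤ s → s < σ → ⟪G p, ω⟫ + s * ‖G p‖ ≤ 0 := by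
    intro s hs0 hs
    have h1 := h.inner_grad_nonpos hp h.b_pos (y := ω + (s / ‖G p‖) • G p) (fun t ht htb => by
      rw [smul_add, ← add_assoc]
      refine hω t ht htb _ ?_
      rw [norm_smul, norm_smul, norm_div, norm_norm, Real.norm_of_nonneg ht.le,
        Real.norm_of_nonneg hs0, div_mul_cancel₀ _ hG.ne']
      nlinarith)
    rw [inner_add_right, real_inner_smul_right, real_inner_self_eq_norm_sq] at h1
    have h2 : s / ‖G p‖ * ‖G p‖ ^ 2 = s * ‖G p‖ := by field_simp
    linarith
  have h0 := key 0 le_rfl h.σ_pos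
  by_contra! hlt
  set A := -⟪G p, ω⟫ with hA
  have hAσ : A / m < σ := by rw [div_lt_iff₀ hm]; linarith
  have hA0 : 0 ≤ A / m := div_nonneg (by linarith) hm.le
  have h1 := key ((A / m + σ) / 2) (by linarith [h.σ_pos]) (by linarith)
  have h2 : A / m * m = A := div_mul_cancel₀ _ hm.ne'
  have h3 : (A / m + σ) / 2 * m ≤ (A / m + σ) / 2 * ‖G p‖ :=
    mul_le_mul_of_nonneg_left hGm (by linarith [h.σ_pos])
  nlinarith

/-- Near the boundary the function `U` decreases at a definite rate in the direction of the axis of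
the interior cone. -/
lemma exists_radius (h : IsDefiningFn σ b m Ω U G) : ∃ r₀ > 0, r₀ ≤ b ∧ ∀ p ∈ frontier Ω,
    ∃ ω : Euc N, ‖ω‖ = 1 ∧ (∀ w ∈ closure Ω, dist w p < b →
      ∀ t, 0 < t → t ≤ b → ∀ e : Euc N, ‖e‖ < σ * t → w + t • ω + e ∈ Ω) ∧
      ∀ x, dist x p < r₀ → ⟪G x, ω⟫ ≤ -(m * σ / 2) := by
  have hmσ : 0 < m * σ / 2 := by have := h.m_pos; have := h.σ_pos; positivity
  obtain ⟨r, hr, hr'⟩ := Metric.mem_uniformity_dist.1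
    (h.isCompact_frontier.uniformContinuousAt_of_continuousAt G
      (fun a _ => h.continuous_grad.continuousAt) (Metric.dist_mem_uniformity hmσ))
  refine ⟨min r b, lt_min hr h.b_pos, min_le_right _ _, fun p hp => ?_⟩
  obtain ⟨ω, hω, hcone⟩ := h.cone p hp
  refine ⟨ω, hω, hcone, fun x hx => ?_⟩
  have h1 := h.inner_grad_le hp (hcone p (frontier_subset_closure hp) (by simpa using h.b_pos))
  have h2 : dist (G p) (G x) < m * σ / 2 :=
    hr' (by rw [dist_comm]; exact hx.trans_le (min_le_left _ _)) hp
  have h3 : |⟪G x - G p, ω⟫| ≤ ‖G x - G p‖ := by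
    simpa [hω] using abs_real_inner_le_norm (G x - G p) ω
  rw [← dist_eq_norm, dist_comm, inner_sub_left] at h3
  linarith [(abs_le.1 h3).2]

lemma le_sub_of_inner_grad_le (h : IsDefiningFn σ b m Ω U G) {x ω : Euc N} {k c : ℝ} (hk : 0 ≤ k)
    (hmem : ∀ t ∈ Icc 0 k, x + t • ω ∈ Ω) (hG : ∀ t ∈ Icc 0 k, ⟪G (x + t • ω), ω⟫ ≤ -c) :
    U (x + k • ω) ≤ U x - c * k := by
  have h1 := Convex.image_sub_le_mul_sub_of_deriv_le (D := Icc 0 k)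
    (f := fun t : ℝ => U (x + t • ω)) (C := -c) (convex_Icc 0 k)
    (h.continuous.comp (by fun_prop)).continuousOn
    (fun t ht => (h.hasDerivAt_line
      (hmem t (interior_subset ht))).differentiableAt.differentiableWithinAt)
    (fun t ht => by
      rw [(h.hasDerivAt_line (hmem t (interior_subset ht))).deriv]
      exact hG t (interior_subset ht)) 0 (left_mem_Icc.2 hk) k (right_mem_Icc.2 hk) hk
  simp only [zero_smul, add_zero, sub_zero] at h1
  linarith

/-- The part of a boundary layer of height `2 * ε` in a small ball of radius `r` centered on the
boundary has volume of order at most `r ^ (N - 1) * ε`. -/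
lemma exists_volume_layer_le (h : IsDefiningFn σ b m Ω U G) : ∃ r₀ > 0, ∀ p ∈ frontier Ω,
    ∀ r, 0 < r → r ≤ r₀ → ∀ ε, 0 < ε → ENNReal.ofReal r *
      volume {x | x ∈ Ω ∧ dist x p < r ∧ -U x ≤ 2 * ε} ≤
        layerConst N σ m * ENNReal.ofReal r ^ N * ENNReal.ofReal ε := by
  obtain ⟨r₁, hr₁, hr₁b, hrad⟩ := h.exists_radius
  have hm := h.m_pos
  have hσ := h.σ_pos
  refine ⟨r₁ / 3, by positivity, fun p hp r hr hrr ε hε => ?_⟩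
  obtain ⟨ω, hω, hcone, hG⟩ := hrad p hp
  set S := {x | x ∈ Ω ∧ dist x p < r ∧ -U x ≤ 2 * ε} with hS
  have hSm : MeasurableSet S := by
    have h1 : S = Ω ∩ ({x | dist x p < r} ∩ {x | -U x ≤ 2 * ε}) := rfl
    rw [h1]
    exact h.isOpen.measurableSet.inter
      ((isOpen_lt (by fun_prop) continuous_const).measurableSet.inter
        (isClosed_le h.continuous.neg continuous_const).measurableSet)
  have hline : ∀ y : Euc N, volume {t : ℝ | y - t • ω ∈ S} ≤ ENNReal.ofReal (4 * ε / (m * σ)) := by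
    intro y
    refine (Real.volume_le_diam _).trans (Metric.ediam_le ?_)
    have key : ∀ t t' : ℝ, t ≤ t' → y - t • ω ∈ S → y - t' • ω ∈ S → t' - t ≤ 4 * ε / (m * σ) := by
      rintro t t' htt' ⟨-, htp, htε⟩ ⟨hΩ', htp', -⟩
      have hsum : y - t • ω = (y - t' • ω) + (t' - t) • ω := by rw [sub_smul]; abel
      have hlen : t' - t < 2 * r := by
        have h1 : dist (y - t • ω) (y - t' • ω) = t' - t := by
          rw [hsum, dist_self_add_left, norm_smul, hω, mul_one,
            Real.norm_of_nonneg (by linarith)]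
        linarith [dist_triangle_right (y - t • ω) (y - t' • ω) p]
      have h2 := h.le_sub_of_inner_grad_le (x := y - t' • ω) (ω := ω) (k := t' - t)
        (c := m * σ / 2) (by linarith) (fun s hs => by
          rcases hs.1.eq_or_lt with rfl | hs0
          · simpa using hΩ'
          · simpa using hcone _ (subset_closure hΩ') (by linarith) s hs0 (by linarith [hs.2]) 0
              (by simpa using by positivity)) (fun s hs => hG _ (by
          have h3 := dist_triangle (y - t' • ω + s • ω) (y - t' • ω) p
          rw [dist_self_add_left, norm_smul, hω, mul_one, Real.norm_of_nonneg hs.1] at h3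
          linarith [hs.2]))
      rw [← hsum] at h2
      rw [le_div_iff₀ (by positivity)]
      have := h.neg _ hΩ'
      linarith
    intro t ht t' ht'
    rw [edist_dist, Real.dist_eq]
    refine ENNReal.ofReal_le_ofReal ?_
    rcases le_total t t' with hle | hle
    · rw [abs_sub_comm, abs_of_nonneg (by linarith)]; exact key t t' hle ht ht'
    · rw [abs_of_nonneg (by linarith)]; exact key t' t hle ht' ht
  have hmeas : MeasurableSet {q : ℝ × Euc N | q.2 - q.1 • ω ∈ S} :=
    (show Measurable fun q : ℝ × Euc N => q.2 - q.1 • ω by fun_prop) hSm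
  set B := ball p (2 * r) with hB
  have hvolB : volume B = 2 ^ N * ENNReal.ofReal r ^ N * volume (ball (0 : Euc N) 1) := by
    rw [hB, Measure.addHaar_ball_of_pos volume p (by positivity), finrank_euclideanSpace_fin,
      ENNReal.ofReal_pow (by positivity), ENNReal.ofReal_mul (by norm_num), mul_pow]
    simp
  calc ENNReal.ofReal r * volume S
      = ∫⁻ t in Icc 0 r, ∫⁻ y, S.indicator 1 (y - t • ω) := by
        have h1 : ∀ t : ℝ, ∫⁻ y, S.indicator (1 : Euc N → ℝ≥0∞) (y - t • ω) = volume S := fun t => by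
          rw [lintegral_sub_right_eq_self (S.indicator 1) (t • ω), lintegral_indicator_one hSm]
        simp only [h1, setLIntegral_const, Real.volume_Icc, sub_zero]
        rw [mul_comm]
    _ ≤ ∫⁻ t in Icc 0 r, ∫⁻ y in B, S.indicator 1 (y - t • ω) := by
        refine setLIntegral_mono' measurableSet_Icc fun t ht => ?_
        rw [← lintegral_indicator measurableSet_ball]
        refine lintegral_mono fun y => ?_
        by_cases hy : y - t • ω ∈ S
        · have : y ∈ B := by
            have h1 := hy.2.1
            have h2 := dist_triangle y (y - t • ω) p
            rw [dist_self_sub_right, norm_smul, hω, mul_one, Real.norm_of_nonneg ht.1] at h2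
            rw [hB, mem_ball]
            linarith [ht.2]
          rw [indicator_of_mem this]
        · rw [indicator_of_notMem hy]; exact bot_le
    _ = ∫⁻ y in B, ∫⁻ t in Icc 0 r, S.indicator 1 (y - t • ω) := by
        refine lintegral_lintegral_swap (Measurable.aemeasurable ?_)
        exact (measurable_one.indicator hSm).comp (by fun_prop)
    _ ≤ ∫⁻ y in B, ENNReal.ofReal (4 * ε / (m * σ)) := by
        refine lintegral_mono fun y => ?_
        have hm1 : MeasurableSet {t : ℝ | y - t • ω ∈ S} :=
          (show Measurable fun t : ℝ => y - t • ω by fun_prop) hSm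
        refine (setLIntegral_le_lintegral _ _).trans ((le_of_eq ?_).trans (hline y))
        rw [← lintegral_indicator_one hm1]
        rfl
    _ = layerConst N σ m * ENNReal.ofReal r ^ N * ENNReal.ofReal ε := by
        rw [setLIntegral_const, hvolB, layerConst, mul_div_right_comm,
          ENNReal.ofReal_mul (by positivity)]
        ring

end IsDefiningFn

end DefiningFunction

section LayerMeasure

/-- A continuous probability density on the line supported in `[1, 2]`. -/
def profile (t : ℝ) : ℝ := max 0 (6 * (t - 1) * (2 - t))

lemma profile_nonneg (t : ℝ) : 0 ≤ profile t := le_max_left _ _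

lemma continuous_profile : Continuous profile := by unfold profile; fun_prop

lemma profile_le (t : ℝ) : profile t ≤ 2 :=
  max_le (by norm_num) (by nlinarith [sq_nonneg (2 * t - 3)])

lemma profile_of_le_one {t : ℝ} (ht : t ≤ 1) : profile t = 0 := max_eq_left (by nlinarith)

lemma profile_of_two_le {t : ℝ} (ht : 2 ≤ t) : profile t = 0 := max_eq_left (by nlinarith)

variable {N : ℕ} {σ b m : ℝ} {Ω : Set (Euc N)} {U : Euc N → ℝ} {G : Euc N → Euc N}

/-- Lebesgue measure concentrated on the boundary layer where `-U` has order `ε`. -/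
def layerMeasure (Ω : Set (Euc N)) (U : Euc N → ℝ) (ε : ℝ) : Measure (Euc N) :=
  (volume.restrict Ω).withDensity fun x => ENNReal.ofReal (profile (-U x / ε) / ε)

lemma layerMeasure_le (hU : Continuous U) (hΩ : IsOpen Ω) {ε : ℝ} (hε : 0 < ε) {A : Set (Euc N)}
    (hA : MeasurableSet A) : layerMeasure Ω U ε A ≤
      ENNReal.ofReal (2 / ε) * volume {x | x ∈ Ω ∧ x ∈ A ∧ -U x ≤ 2 * ε} := by
  have hm : MeasurableSet {x | x ∈ Ω ∧ x ∈ A ∧ -U x ≤ 2 * ε} := by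
    have h1 : {x | x ∈ Ω ∧ x ∈ A ∧ -U x ≤ 2 * ε} = Ω ∩ (A ∩ {x | -U x ≤ 2 * ε}) := rfl
    rw [h1]
    exact hΩ.measurableSet.inter (hA.inter (isClosed_le hU.neg continuous_const).measurableSet)
  rw [layerMeasure, withDensity_apply _ hA, Measure.restrict_restrict hA,
    ← setLIntegral_const, ← lintegral_indicator (hA.inter hΩ.measurableSet),
    ← lintegral_indicator hm]
  refine lintegral_mono fun x => ?_
  by_cases hx : x ∈ A ∩ Ω
  · rw [indicator_of_mem hx]
    by_cases hxε : -U x ≤ 2 * ε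
    · rw [indicator_of_mem (show x ∈ {x | x ∈ Ω ∧ x ∈ A ∧ -U x ≤ 2 * ε} from ⟨hx.2, hx.1, hxε⟩)]
      exact ENNReal.ofReal_le_ofReal (by gcongr; exact profile_le _)
    · rw [profile_of_two_le (by rw [le_div_iff₀ hε]; linarith)]
      simp
  · rw [indicator_of_notMem hx]
    exact bot_le

lemma layerMeasure_apply_compl_closure (Ω : Set (Euc N)) (U : Euc N → ℝ) (ε : ℝ) :
    layerMeasure Ω U ε (closure Ω)ᶜ = 0 := by
  refine withDensity_absolutelyContinuous _ _ ?_
  rw [Measure.restrict_apply isClosed_closure.isOpen_compl.measurableSet]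
  exact measure_mono_null (fun x hx => (hx.1 (subset_closure hx.2)).elim) measure_empty

lemma integral_layerMeasure (hU : Continuous U) {ε : ℝ} (hε : 0 < ε) (f : Euc N → ℝ) :
    ∫ x, f x ∂(layerMeasure Ω U ε) = ∫ x in Ω, profile (-U x / ε) / ε * f x := by
  rw [layerMeasure, integral_withDensity_eq_integral_toReal_smul
    (by have := continuous_profile; fun_prop) (by simp)]
  simp_rw [ENNReal.toReal_ofReal (div_nonneg (profile_nonneg _) hε.le), smul_eq_mul]

namespace IsDefiningFn

/-- On a compact set not meeting the boundary of `Ω` the function `U` is not small. -/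
lemma exists_pos_lt_neg (h : IsDefiningFn σ b m Ω U G) {K : Set (Euc N)} (hK : IsCompact K)
    (hKΩ : Disjoint K (frontier Ω)) : ∃ c > 0, ∀ x ∈ K, x ∈ Ω → c ≤ -U x := by
  have hKc : IsCompact (K ∩ closure Ω) := hK.inter_right isClosed_closure
  obtain hem | hne := (K ∩ closure Ω).eq_empty_or_nonempty
  · exact ⟨1, one_pos, fun x hx hxΩ => by
      have : x ∈ K ∩ closure Ω := ⟨hx, subset_closure hxΩ⟩
      rw [hem] at this
      exact this.elim⟩
  · obtain ⟨y, hy, hmin⟩ := hKc.exists_isMinOn hne h.continuous.neg.continuousOn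
    have hyΩ : y ∈ Ω := by
      by_contra hyΩ
      exact Set.disjoint_left.1 hKΩ hy.1 ⟨hy.2, by rwa [h.isOpen.interior_eq]⟩
    exact ⟨-U y, by linarith [h.neg y hyΩ], fun x hx hxΩ => hmin ⟨hx, subset_closure hxΩ⟩⟩

/-- The boundary layer of height `2 * ε` has volume of order `ε`. -/
lemma exists_volume_totalLayer_le (h : IsDefiningFn σ b m Ω U G) : ∃ C : ℝ≥0, ∃ ε₀ > 0,
    ∀ ε, 0 < ε → ε < ε₀ → volume {x | x ∈ Ω ∧ -U x ≤ 2 * ε} ≤ C * ENNReal.ofReal ε := by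
  obtain ⟨r, hr, hvol⟩ := h.exists_volume_layer_le
  obtain ⟨t, htF, hcov⟩ := h.isCompact_frontier.elim_nhds_subcover (fun p => ball p r)
    (fun p _ => ball_mem_nhds p hr)
  have hKc : IsCompact (closure Ω \ ⋃ p ∈ t, ball p r) :=
    h.isBounded.isCompact_closure.diff (isOpen_biUnion fun _ _ => isOpen_ball)
  obtain ⟨c, hc, hcU⟩ := h.exists_pos_lt_neg hKc
    (Set.disjoint_left.2 fun x hx hxF => hx.2 (hcov hxF))
  set L : ℝ≥0∞ := (ENNReal.ofReal r)⁻¹ * (layerConst N σ m * ENNReal.ofReal r ^ N) with hL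
  have hr0 : ENNReal.ofReal r ≠ 0 := by simpa using hr
  have hLtop : (t.card : ℝ≥0∞) * L ≠ ∞ :=
    ENNReal.mul_ne_top (by simp) (ENNReal.mul_ne_top (by simpa using hr)
      (ENNReal.mul_ne_top (layerConst_ne_top N σ m) (by finiteness)))
  refine ⟨((t.card : ℝ≥0∞) * L).toNNReal, c / 2, by positivity, fun ε hε hεc => ?_⟩
  rw [ENNReal.coe_toNNReal hLtop]
  have hsub : {x | x ∈ Ω ∧ -U x ≤ 2 * ε} ⊆
      ⋃ p ∈ t, {x | x ∈ Ω ∧ dist x p < r ∧ -U x ≤ 2 * ε} := by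
    rintro x ⟨hx, hxε⟩
    have : x ∈ ⋃ p ∈ t, ball p r := by
      by_contra hn
      linarith [hcU x ⟨subset_closure hx, hn⟩ hx]
    simp only [mem_iUnion, mem_ball] at this ⊢
    obtain ⟨p, hp, hxp⟩ := this
    exact ⟨p, hp, hx, hxp, hxε⟩
  calc volume {x | x ∈ Ω ∧ -U x ≤ 2 * ε}
      ≤ ∑ p ∈ t, volume {x | x ∈ Ω ∧ dist x p < r ∧ -U x ≤ 2 * ε} :=
        (measure_mono hsub).trans (measure_biUnion_finset_le _ _)
    _ ≤ ∑ p ∈ t, L * ENNReal.ofReal ε := by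
        refine Finset.sum_le_sum fun p hp => ?_
        have h1 := hvol p (htF p hp) r hr le_rfl ε hε
        rw [hL, mul_assoc, ← ENNReal.div_eq_inv_mul, ENNReal.le_div_iff_mul_le (Or.inl hr0)
          (Or.inl ENNReal.ofReal_ne_top), mul_comm]
        exact h1
    _ = t.card * L * ENNReal.ofReal ε := by
        rw [Finset.sum_const, nsmul_eq_mul, ← mul_assoc]

end IsDefiningFn

end LayerMeasure

section BoundaryMeasure

variable {N : ℕ} {σ b m : ℝ} {Ω : Set (Euc N)} {U : Euc N → ℝ} {G : Euc N → Euc N}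

/-- `ν` is a weak limit, along the filter `l`, of Lebesgue measures concentrated on boundary layers
of `Ω`. -/
structure IsLayerLimit (Ω : Set (Euc N)) (U : Euc N → ℝ) (l : Filter ℝ)
    (ν : Measure (Euc N)) : Prop where
  neBot : l.NeBot
  le_nhdsGT : l ≤ 𝓝[>] 0
  isFiniteMeasure : IsFiniteMeasure ν
  tendsto_lintegral : ∀ f : BoundedContinuousFunction (Euc N) ℝ≥0,
    Tendsto (fun ε => ∫⁻ x, f x ∂(layerMeasure Ω U ε)) l (𝓝 (∫⁻ x, f x ∂ν))
  tendsto_integral_bdd : ∀ f : BoundedContinuousFunction (Euc N) ℝ,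
    Tendsto (fun ε => ∫ x, f x ∂(layerMeasure Ω U ε)) l (𝓝 (∫ x, f x ∂ν))

lemma IsDefiningFn.exists_isLayerLimit (h : IsDefiningFn σ b m Ω U G) :
    ∃ l ν, IsLayerLimit Ω U l ν := by
  obtain ⟨C, ε₀, hε₀, hC⟩ := h.exists_volume_totalLayer_le
  have hmass : ∀ ε, 0 < ε → ε < ε₀ → layerMeasure Ω U ε univ ≤ (2 * C : ℝ≥0) := by
    intro ε hε hεε
    refine (layerMeasure_le h.continuous h.isOpen hε MeasurableSet.univ).trans ?_
    simp only [mem_univ, true_and]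
    refine (mul_le_mul' le_rfl (hC ε hε hεε)).trans (le_of_eq ?_)
    rw [mul_left_comm, ← ENNReal.ofReal_mul (by positivity), div_mul_cancel₀ _ hε.ne', mul_comm]
    simp
  let μ : ℝ → FiniteMeasure (Euc N) := fun ε =>
    if hf : layerMeasure Ω U ε univ < ∞ then ⟨layerMeasure Ω U ε, ⟨hf⟩⟩ else 0
  have hμ : ∀ ε, 0 < ε → ε < ε₀ → (μ ε : Measure (Euc N)) = layerMeasure Ω U ε := by
    intro ε hε hεε
    have : layerMeasure Ω U ε univ < ∞ := (hmass ε hε hεε).trans_lt (by finiteness)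
    rw [show μ ε = ⟨layerMeasure Ω U ε, ⟨this⟩⟩ from dif_pos this]
    rfl
  have hev : ∀ᶠ ε in 𝓝[>] (0 : ℝ), 0 < ε ∧ ε < ε₀ := Ioo_mem_nhdsGT hε₀
  have hK := isCompact_setOfPred_finiteMeasure_le_of_isCompact (2 * C)
    h.isBounded.isCompact_closure
  let l : Ultrafilter ℝ := Ultrafilter.of (𝓝[>] 0)
  have hl : (l : Filter ℝ) ≤ 𝓝[>] 0 := Ultrafilter.of_le _
  have hmem : ∀ᶠ ε in (l : Filter ℝ),
      μ ε ∈ {μ : FiniteMeasure (Euc N) | μ.mass ≤ 2 * C ∧ μ (closure Ω)ᶜ = 0} := by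
    filter_upwards [hl hev] with ε hε
    have h1 := hmass ε hε.1 hε.2
    constructor
    · rw [← ENNReal.coe_le_coe, FiniteMeasure.ennreal_mass, hμ ε hε.1 hε.2]
      exact h1
    · rw [← ENNReal.coe_eq_zero, FiniteMeasure.ennreal_coeFn_eq_coeFn_toMeasure, hμ ε hε.1 hε.2]
      exact layerMeasure_apply_compl_closure Ω U ε
  obtain ⟨ν, -, hν⟩ := hK.ultrafilter_le_nhds' (l.map μ) hmem
  have hlim : Tendsto μ l (𝓝 ν) := hν
  refine ⟨l, ν, inferInstance, hl, inferInstance, fun f => ?_, fun f => ?_⟩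
  · refine (FiniteMeasure.tendsto_iff_forall_lintegral_tendsto.1 hlim f).congr' ?_
    filter_upwards [hl hev] with ε hε
    rw [hμ ε hε.1 hε.2]
  · refine (FiniteMeasure.tendsto_iff_forall_integral_tendsto.1 hlim f).congr' ?_
    filter_upwards [hl hev] with ε hε
    rw [hμ ε hε.1 hε.2]

namespace IsLayerLimit

variable {l : Filter ℝ} {ν : Measure (Euc N)}

lemma measure_closedBall_le (hν : IsLayerLimit Ω U l ν) {x : Euc N} {r : ℝ} (hr : 0 < r)
    {c : ℝ≥0∞} (hc : ∀ᶠ ε in 𝓝[>] (0 : ℝ), layerMeasure Ω U ε (ball x (2 * r)) ≤ c) :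
    ν (closedBall x r) ≤ c := by
  have := hν.neBot
  have h1 : ν (closedBall x r) ≤ ∫⁻ y, thickenedIndicator hr (closedBall x r) y ∂ν := by
    rw [← lintegral_indicator_one isClosed_closedBall.measurableSet]
    refine lintegral_mono fun y => ?_
    by_cases hy : y ∈ closedBall x r
    · simp [indicator_of_mem hy, thickenedIndicator_one hr _ hy]
    · rw [indicator_of_notMem hy]
      exact bot_le
  refine h1.trans (le_of_tendsto (hν.tendsto_lintegral _) ?_)
  filter_upwards [hν.le_nhdsGT hc] with ε hε
  refine le_trans ?_ hε
  rw [← lintegral_indicator_one measurableSet_ball]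
  refine lintegral_mono fun y => ?_
  by_cases hy : y ∈ ball x (2 * r)
  · rw [indicator_of_mem hy]
    simpa using thickenedIndicator_le_one hr (closedBall x r) y
  · rw [indicator_of_notMem hy, thickenedIndicator_zero hr _ fun hy' => hy ?_]
    · simp
    · obtain ⟨z, hz, hyz⟩ := mem_thickening_iff.1 hy'
      rw [mem_ball]
      rw [mem_closedBall] at hz
      linarith [dist_triangle y z x]

lemma measure_compl_frontier (hν : IsLayerLimit Ω U l ν) (h : IsDefiningFn σ b m Ω U G) :
    ν (frontier Ω)ᶜ = 0 := by
  refine measure_null_of_locally_null _ fun x hx => ?_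
  obtain ⟨r, hr, hrx⟩ := Metric.isOpen_iff.1 isClosed_frontier.isOpen_compl x hx
  refine ⟨closedBall x (r / 4), mem_nhdsWithin_of_mem_nhds (closedBall_mem_nhds x (by positivity)),
    le_bot_iff.1 (hν.measure_closedBall_le (by positivity) ?_)⟩
  obtain ⟨c, hc, hcU⟩ := h.exists_pos_lt_neg (isCompact_closedBall x (2 * (r / 4)))
    (Set.disjoint_left.2 fun y hy hyF =>
      hrx (closedBall_subset_ball (by linarith) hy) hyF)
  filter_upwards [Ioo_mem_nhdsGT (show 0 < c / 2 by positivity)] with ε hε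
  refine (layerMeasure_le h.continuous h.isOpen hε.1 measurableSet_ball).trans ?_
  rw [measure_mono_null (t := ∅) ?_ measure_empty, mul_zero]
  · exact bot_le
  · rintro y ⟨hy, hyb, hyε⟩
    linarith [hcU y (ball_subset_closedBall hyb) hy, hε.2]

lemma integrable_of_continuous (hν : IsLayerLimit Ω U l ν) (h : IsDefiningFn σ b m Ω U G)
    {f : Euc N → ℝ} (hf : Continuous f) : Integrable f ν := by
  have := hν.isFiniteMeasure
  have hres : ν.restrict (frontier Ω) = ν :=
    Measure.restrict_eq_self_of_ae_mem (hν.measure_compl_frontier h)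
  rw [← hres]
  exact hf.continuousOn.integrableOn_compact h.isCompact_frontier

lemma tendsto_integral (hν : IsLayerLimit Ω U l ν) (h : IsDefiningFn σ b m Ω U G)
    {f : Euc N → ℝ} (hf : Continuous f) :
    Tendsto (fun ε => ∫ x in Ω, profile (-U x / ε) / ε * f x) l (𝓝 (∫ x, f x ∂ν)) := by
  obtain ⟨M, hM⟩ := h.isBounded.isCompact_closure.exists_bound_of_continuousOn hf.continuousOn
  have hMf : ∀ x ∈ closure Ω, max (-M) (min (f x) M) = f x := fun x hx => by
    have := abs_le.1 (hM x hx)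
    rw [min_eq_left this.2, max_eq_right this.1]
  by_cases hM0 : 0 ≤ M
  swap
  · have hΩ : Ω = ∅ := by
      by_contra hne
      obtain ⟨x, hx⟩ := nonempty_iff_ne_empty.2 hne
      exact hM0 ((norm_nonneg _).trans (hM x (subset_closure hx)))
    have hν0 : ν = 0 := by
      have := hν.measure_compl_frontier h
      rwa [hΩ, frontier_empty, compl_empty, Measure.measure_univ_eq_zero] at this
    simpa [hΩ, hν0] using tendsto_const_nhds
  let F : BoundedContinuousFunction (Euc N) ℝ := BoundedContinuousFunction.ofNormedAddCommGroup
    (fun x => max (-M) (min (f x) M)) (by fun_prop) M fun x =>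
      abs_le.2 ⟨le_max_left _ _, max_le (by linarith) (min_le_right _ _)⟩
  have h1 : ∫ x, F x ∂ν = ∫ x, f x ∂ν := by
    refine integral_congr_ae ?_
    have : ∀ᵐ x ∂ν, x ∈ frontier Ω := hν.measure_compl_frontier h
    filter_upwards [this] with x hx
    exact hMf x (frontier_subset_closure hx)
  rw [← h1]
  refine (hν.tendsto_integral_bdd F).congr' ?_
  filter_upwards [hν.le_nhdsGT self_mem_nhdsWithin] with ε hε
  rw [integral_layerMeasure h.continuous hε]
  refine setIntegral_congr_fun h.isOpen.measurableSet fun x hx => ?_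
  exact congrArg (profile (-U x / ε) / ε * ·) (hMf x (subset_closure hx))

end IsLayerLimit

end BoundaryMeasure

section Hausdorff

variable {N : ℕ} {σ b m : ℝ} {Ω : Set (Euc N)} {U : Euc N → ℝ} {G : Euc N → Euc N}

/-- The constant comparing limits of layer measures with the Hausdorff measure. -/
def surfaceConst (N : ℕ) (σ m : ℝ) : ℝ≥0∞ := 2 * layerConst N σ m * 2 ^ (N - 1) + 1

lemma surfaceConst_ne_top (N : ℕ) (σ m : ℝ) : surfaceConst N σ m ≠ ∞ := by
  have := layerConst_ne_top N σ m
  unfold surfaceConst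
  finiteness

lemma surfaceConst_ne_zero (N : ℕ) (σ m : ℝ) : surfaceConst N σ m ≠ 0 := by simp [surfaceConst]

namespace IsLayerLimit

variable {l : Filter ℝ} {ν : Measure (Euc N)}

lemma exists_measure_closedBall_le (hN : 0 < N) (hν : IsLayerLimit Ω U l ν)
    (h : IsDefiningFn σ b m Ω U G) : ∃ r₀ > 0, ∀ p ∈ frontier Ω, ∀ r, 0 < r → r < r₀ →
      ν (closedBall p r) ≤ surfaceConst N σ m * ENNReal.ofReal r ^ (N - 1) := by
  obtain ⟨r₁, hr₁, hvol⟩ := h.exists_volume_layer_le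
  refine ⟨r₁ / 2, by positivity, fun p hp r hr hrr => ?_⟩
  have key : ∀ ε > 0, layerMeasure Ω U ε (ball p (2 * r)) ≤
      2 * layerConst N σ m * ENNReal.ofReal (2 * r) ^ (N - 1) := by
    intro ε hε
    refine (layerMeasure_le h.continuous h.isOpen hε measurableSet_ball).trans ?_
    have h1 := hvol p hp (2 * r) (by positivity) (by linarith) ε hε
    have hr0 : ENNReal.ofReal (2 * r) ≠ 0 := by simpa using hr
    set v := volume {x | x ∈ Ω ∧ dist x p < 2 * r ∧ -U x ≤ 2 * ε}
    have h2 : v ≤ layerConst N σ m * ENNReal.ofReal (2 * r) ^ (N - 1) * ENNReal.ofReal ε := by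
      rw [← ENNReal.mul_le_mul_iff_right hr0 ENNReal.ofReal_ne_top]
      refine h1.trans (le_of_eq ?_)
      obtain ⟨n, rfl⟩ := Nat.exists_eq_succ_of_ne_zero hN.ne'
      simp only [Nat.succ_eq_add_one, Nat.add_sub_cancel, pow_succ]
      ring
    refine (mul_le_mul' le_rfl h2).trans (le_of_eq ?_)
    rw [mul_left_comm, ← ENNReal.ofReal_mul (by positivity), div_mul_cancel₀ _ hε.ne']
    simp only [ENNReal.ofReal_ofNat]
    ring
  refine (hν.measure_closedBall_le hr
    (eventually_mem_of_tendsto_nhdsWithin tendsto_id |>.mono key)).trans ?_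
  rw [surfaceConst, ENNReal.ofReal_mul (by norm_num), mul_pow, ENNReal.ofReal_ofNat, ← mul_assoc]
  exact mul_le_mul' le_self_add le_rfl

/-- A limit of layer measures is controlled by the Hausdorff measure of codimension one. -/
lemma le_hausdorffMeasure (hN : 0 < N) (hν : IsLayerLimit Ω U l ν)
    (h : IsDefiningFn σ b m Ω U G) : ν ≤ surfaceConst N σ m • μH[(N : ℝ) - 1] := by
  obtain ⟨r₀, hr₀, hball⟩ := hν.exists_measure_closedBall_le hN h
  have hC0 := surfaceConst_ne_zero N σ m
  have hCt := surfaceConst_ne_top N σ m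
  have hexp : (N : ℝ) - 1 = ((N - 1 : ℕ) : ℝ) := by rw [Nat.cast_sub hN, Nat.cast_one]
  have key : (surfaceConst N σ m)⁻¹ • ν ≤ μH[(N : ℝ) - 1] := by
    refine Measure.le_hausdorffMeasure _ _ (ENNReal.ofReal (r₀ / 2)) (by simpa using hr₀)
      fun s hs => ?_
    rw [hexp, ENNReal.rpow_natCast, Measure.smul_apply, smul_eq_mul, ← ENNReal.div_eq_inv_mul,
      ENNReal.div_le_iff_le_mul (Or.inl hC0) (Or.inl hCt), mul_comm]
    have hnull : ν s ≤ ν (s ∩ frontier Ω) := by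
      rw [← measure_inter_add_sdiff s isClosed_frontier.measurableSet,
        measure_mono_null (s := s \ frontier Ω) (t := (frontier Ω)ᶜ) (fun x hx => hx.2)
          (hν.measure_compl_frontier h), add_zero]
    obtain hem | ⟨p, hps, hp⟩ := (s ∩ frontier Ω).eq_empty_or_nonempty
    · rw [hem, measure_empty] at hnull
      exact hnull.trans bot_le
    have hfin : ediam s ≠ ∞ := ne_top_of_le_ne_top ENNReal.ofReal_ne_top hs
    set δ := (ediam s).toReal with hδ
    have hδs : ediam s = ENNReal.ofReal δ := (ENNReal.ofReal_toReal hfin).symm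
    have hδr : δ < r₀ := by
      have := ENNReal.toReal_mono ENNReal.ofReal_ne_top hs
      rw [ENNReal.toReal_ofReal (by positivity)] at this
      linarith
    rw [hδs]
    have hcont : Tendsto (fun r : ℝ => surfaceConst N σ m * ENNReal.ofReal r ^ (N - 1)) (𝓝[>] δ)
        (𝓝 (surfaceConst N σ m * ENNReal.ofReal δ ^ (N - 1))) := by
      refine ENNReal.Tendsto.const_mul ?_ (Or.inr hCt)
      exact ((ENNReal.continuous_pow _).comp ENNReal.continuous_ofReal).continuousAt.tendsto.mono_left
        nhdsWithin_le_nhds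
    refine ge_of_tendsto hcont ?_
    filter_upwards [Ioo_mem_nhdsGT hδr] with r hr
    refine (measure_mono fun x hx => ?_).trans
      (hball p hp r (ENNReal.toReal_nonneg.trans_lt hr.1) hr.2)
    have h1 := edist_le_ediam_of_mem hx hps
    rw [edist_dist, hδs, ENNReal.ofReal_le_ofReal_iff ENNReal.toReal_nonneg] at h1
    exact mem_closedBall.2 (h1.trans hr.1.le)
  refine Measure.le_iff.2 fun s hs => ?_
  have h1 := key s
  rw [Measure.smul_apply, smul_eq_mul, ← ENNReal.div_eq_inv_mul,
    ENNReal.div_le_iff_le_mul (Or.inl hC0) (Or.inl hCt), mul_comm] at h1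
  exact h1

end IsLayerLimit

namespace IsDefiningFn

/-- The boundary has finite Hausdorff measure of codimension one. -/
lemma hausdorffMeasure_frontier_ne_top (hN : 0 < N) (h : IsDefiningFn σ b m Ω U G) :
    μH[(N : ℝ) - 1] (frontier Ω) ≠ ∞ := by
  obtain ⟨C, ε₀, hε₀, hC⟩ := h.exists_volume_totalLayer_le
  obtain ⟨K₁, hK₁⟩ := h.isBounded.isCompact_closure.exists_bound_of_continuousOn
    h.continuous_grad.continuousOn
  set K := max K₁ 1 with hKdef
  have hK0 : 0 < K := lt_max_of_lt_right one_pos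
  have hσ := h.σ_pos
  have hσ1 := h.σ_le_one
  have hexp : (N : ℝ) - 1 = ((N - 1 : ℕ) : ℝ) := by rw [Nat.cast_sub hN, Nat.cast_one]
  set v := volume (ball (0 : Euc N) 1) with hv
  have hv0 : v ≠ 0 := (measure_ball_pos volume _ one_pos).ne'
  have hvt : v ≠ ∞ := measure_ball_lt_top.ne
  -- the boundary points are approached at a controlled height
  have hheight : ∀ p ∈ frontier Ω, ∀ y : Euc N, ∀ t, 0 < t →
      (∀ s, 0 < s → s ≤ t → p + s • y ∈ Ω) → -U (p + t • y) ≤ K * ‖y‖ * t := by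
    intro p hp y t ht hmem
    have h1 := Convex.mul_sub_le_image_sub_of_le_deriv (D := Icc 0 t)
      (f := fun s : ℝ => U (p + s • y)) (C := -(K * ‖y‖)) (convex_Icc 0 t)
      (h.continuous.comp (by fun_prop)).continuousOn
      (fun s hs => by
        rw [interior_Icc] at hs
        exact (h.hasDerivAt_line
          (hmem s hs.1 hs.2.le)).differentiableAt.differentiableWithinAt)
      (fun s hs => by
        rw [interior_Icc] at hs
        have hmem' := hmem s hs.1 hs.2.le
        rw [(h.hasDerivAt_line hmem').deriv]
        have h2 := abs_le.1 (abs_real_inner_le_norm (G (p + s • y)) y)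
        have h3 : ‖G (p + s • y)‖ * ‖y‖ ≤ K * ‖y‖ := mul_le_mul_of_nonneg_right
          ((hK₁ _ (subset_closure hmem')).trans (le_max_left _ _)) (norm_nonneg _)
        linarith [h2.1]) 0 (left_mem_Icc.2 ht.le) t (right_mem_Icc.2 ht.le) ht.le
    simp only [zero_smul, add_zero, sub_zero, h.eq_zero p (h.notMem_of_mem_frontier hp)] at h1
    linarith
  set M : ℝ≥0∞ := 10 ^ (N - 1) * (C * ENNReal.ofReal K * (2 / ENNReal.ofReal σ) ^ N / v) with hM
  -- coverings by balls of radius `5 * δ`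
  have hcover : ∀ δ, 0 < δ → δ ≤ b → K * δ < ε₀ → ∃ u : Set (Euc N),
      u.Countable ∧ frontier Ω ⊆ ⋃ p : u, closedBall (p : Euc N) (5 * δ) ∧
        ∑' p : u, ediam (closedBall (p : Euc N) (5 * δ)) ^ ((N : ℝ) - 1) ≤ M := by
    intro δ hδ hδb hδε
    obtain ⟨u, huF, hdisj, hcov⟩ := Vitali.exists_disjoint_subfamily_covering_enlargement_closedBall
      (frontier Ω) (fun p => p) (fun _ => δ) δ (fun _ _ => le_rfl) 5 (by norm_num)
    have hucount : u.Countable := hdisj.countable_of_nonempty_interior fun p _ =>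
      ⟨p, ball_subset_interior_closedBall (mem_ball_self hδ)⟩
    choose! ω hω hcone using h.cone
    set B : Euc N → Set (Euc N) := fun p => ball (p + (δ / 2) • ω p) (σ * (δ / 2)) with hB
    have hBsub : ∀ p ∈ u, B p ⊆ closedBall p δ := by
      intro p hp x hx
      rw [hB, mem_ball] at hx
      have h1 := dist_triangle x (p + (δ / 2) • ω p) p
      rw [dist_self_add_left, norm_smul, hω p (huF hp), mul_one,
        Real.norm_of_nonneg (by positivity)] at h1
      rw [mem_closedBall]
      nlinarith
    have hBlayer : ∀ p ∈ u, B p ⊆ {x | x ∈ Ω ∧ -U x ≤ 2 * (K * δ)} := by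
      intro p hp x hx
      set e := x - (p + (δ / 2) • ω p) with he
      have hen : ‖e‖ < σ * (δ / 2) := by rwa [hB, mem_ball, dist_eq_norm] at hx
      set y := ω p + (2 / δ) • e with hy
      have hye : ∀ s : ℝ, p + s • y = p + s • ω p + (s * (2 / δ)) • e := fun s => by
        rw [hy, smul_add, smul_smul, add_assoc]
      have hmem : ∀ s, 0 < s → s ≤ δ / 2 → p + s • y ∈ Ω := by
        intro s hs hsδ
        rw [hye]
        refine hcone p (huF hp) p (frontier_subset_closure (huF hp)) (by simpa using h.b_pos) s hs
          (by linarith) _ ?_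
        rw [norm_smul, Real.norm_of_nonneg (by positivity)]
        calc s * (2 / δ) * ‖e‖ < s * (2 / δ) * (σ * (δ / 2)) := by gcongr
          _ = σ * s := by field_simp
      have hx' : p + (δ / 2) • y = x := by
        rw [hye, show δ / 2 * (2 / δ) = 1 by field_simp, one_smul, he]
        abel
      have hyn : ‖y‖ ≤ 2 := by
        refine (norm_add_le _ _).trans ?_
        rw [hω p (huF hp), norm_smul, Real.norm_of_nonneg (by positivity)]
        have : 2 / δ * ‖e‖ ≤ 2 / δ * (σ * (δ / 2)) := by gcongr
        have h2 : 2 / δ * (σ * (δ / 2)) = σ := by field_simp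
        linarith
      have h1 := hheight p (huF hp) y (δ / 2) (by positivity) hmem
      rw [hx'] at h1
      refine ⟨hx' ▸ hmem _ (by positivity) le_rfl, h1.trans ?_⟩
      have h2 : K * ‖y‖ ≤ K * 2 := by gcongr
      nlinarith
    have hvolB : ∀ p, volume (B p) = (ENNReal.ofReal σ * ENNReal.ofReal δ / 2) ^ N * v := by
      intro p
      rw [hB, Measure.addHaar_ball_of_pos volume _ (by positivity), finrank_euclideanSpace_fin,
        ENNReal.ofReal_pow (by positivity), ENNReal.ofReal_mul hσ.le,
        ENNReal.ofReal_div_of_pos (by norm_num), ENNReal.ofReal_ofNat, mul_div_assoc]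
    have hsum : ∑' p : u, volume (B p) ≤ C * (ENNReal.ofReal K * ENNReal.ofReal δ) := by
      rw [← measure_biUnion hucount (hdisj.mono_on hBsub) fun _ _ => measurableSet_ball,
        ← ENNReal.ofReal_mul hK0.le]
      exact (measure_mono (iUnion₂_subset hBlayer)).trans (hC _ (by positivity) hδε)
    refine ⟨u, hucount, fun p hp => ?_, ?_⟩
    · obtain ⟨q, hq, hpq⟩ := hcov p hp
      exact mem_iUnion.2 ⟨⟨q, hq⟩, hpq (mem_closedBall_self hδ.le)⟩
    · have hδ0 : ENNReal.ofReal δ ≠ 0 := by simpa using hδ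
      have hσ0 : ENNReal.ofReal σ ≠ 0 := by simpa using hσ
      have hterm : ∀ p : Euc N, ediam (closedBall p (5 * δ)) ^ ((N : ℝ) - 1) ≤
          10 ^ (N - 1) * ((2 / ENNReal.ofReal σ) ^ N / (v * ENNReal.ofReal δ)) * volume (B p) := by
        intro p
        have h1 : ediam (closedBall p (5 * δ)) ≤ 10 * ENNReal.ofReal δ := by
          rw [← Metric.closedEBall_ofReal (by positivity)]
          refine ediam_closedEBall_le.trans (le_of_eq ?_)
          rw [ENNReal.ofReal_mul (by norm_num), ← mul_assoc, ENNReal.ofReal_ofNat]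
          norm_num
        rw [hexp, ENNReal.rpow_natCast, hvolB]
        refine (pow_le_pow_left₀ bot_le h1 _).trans (le_of_eq ?_)
        rw [mul_pow, mul_assoc]
        congr 1
        have hδN : ENNReal.ofReal δ ^ N = ENNReal.ofReal δ ^ (N - 1) * ENNReal.ofReal δ := by
          rw [← pow_succ, Nat.sub_add_cancel hN]
        have h2 : (2 / ENNReal.ofReal σ) ^ N * (ENNReal.ofReal σ * ENNReal.ofReal δ / 2) ^ N =
            ENNReal.ofReal δ ^ N := by
          rw [← mul_pow]
          congr 1
          rw [mul_div_assoc, ← mul_assoc, ENNReal.div_mul_cancel hσ0 ENNReal.ofReal_ne_top,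
            ENNReal.mul_div_cancel (by norm_num) (by norm_num)]
        calc ENNReal.ofReal δ ^ (N - 1)
            = ENNReal.ofReal δ ^ N * v / (v * ENNReal.ofReal δ) := by
              rw [hδN, mul_assoc, mul_comm v, mul_div_assoc, ENNReal.div_self (by simp [hv0, hδ])
                (by finiteness), mul_one]
          _ = _ := by
              rw [← h2, div_eq_mul_inv, div_eq_mul_inv _ (v * ENNReal.ofReal δ)]
              ring
      refine (ENNReal.tsum_le_tsum fun p : u => hterm p).trans ?_
      rw [ENNReal.tsum_mul_left]
      refine (mul_le_mul' le_rfl hsum).trans (le_of_eq ?_)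
      rw [hM, mul_assoc]
      congr 1
      rw [div_eq_mul_inv, div_eq_mul_inv _ v, ENNReal.mul_inv (Or.inl hv0) (Or.inl hvt)]
      have h3 : (ENNReal.ofReal δ)⁻¹ * ENNReal.ofReal δ = 1 :=
        ENNReal.inv_mul_cancel hδ0 ENNReal.ofReal_ne_top
      calc _ = C * ENNReal.ofReal K * (2 / ENNReal.ofReal σ) ^ N * v⁻¹ *
            ((ENNReal.ofReal δ)⁻¹ * ENNReal.ofReal δ) := by ring
        _ = _ := by rw [h3, mul_one]
  set δ₀ := min b (ε₀ / (2 * K)) with hδ₀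
  have hδ₀pos : 0 < δ₀ := lt_min h.b_pos (by positivity)
  have hδ : ∀ n : ℕ, 0 < δ₀ / (n + 1) ∧ δ₀ / (n + 1) ≤ b ∧ K * (δ₀ / (n + 1)) < ε₀ := by
    intro n
    have h1 : δ₀ / (n + 1) ≤ δ₀ := div_le_self hδ₀pos.le (by linarith [n.cast_nonneg (α := ℝ)])
    refine ⟨by positivity, h1.trans (min_le_left _ _), ?_⟩
    calc K * (δ₀ / (n + 1)) ≤ K * (ε₀ / (2 * K)) := by
          exact mul_le_mul_of_nonneg_left (h1.trans (min_le_right _ _)) hK0.le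
      _ = ε₀ / 2 := by field_simp
      _ < ε₀ := by linarith
  choose u hu hcov hsum using fun n : ℕ => hcover _ (hδ n).1 (hδ n).2.1 (hδ n).2.2
  have : ∀ n, Countable (u n) := fun n => (hu n).to_subtype
  have hr : Tendsto (fun n : ℕ => 2 * ENNReal.ofReal (5 * (δ₀ / (n + 1)))) atTop (𝓝 0) := by
    have h1 : Tendsto (fun n : ℕ => 5 * (δ₀ / ((n : ℝ) + 1))) atTop (𝓝 (5 * 0)) := by
      refine Tendsto.const_mul _ ?_
      exact tendsto_const_nhds.div_atTop (tendsto_atTop_add_const_right _ _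
        tendsto_natCast_atTop_atTop)
    have h2 := ENNReal.Tendsto.const_mul (a := 2) (ENNReal.tendsto_ofReal h1) (Or.inr (by simp))
    simpa using h2
  have hle := Measure.hausdorffMeasure_le_liminf_tsum ((N : ℝ) - 1) (frontier Ω) _ hr
    (fun n (p : u n) => closedBall (p : Euc N) (5 * (δ₀ / (n + 1))))
    (.of_forall fun n p => by
      rw [← Metric.closedEBall_ofReal (by have := (hδ n).1; positivity)]
      exact ediam_closedEBall_le) (.of_forall hcov)
  refine ne_top_of_le_ne_top ?_ (hle.trans
    ((liminf_le_liminf (.of_forall hsum)).trans (liminf_const M).le))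
  have hσ0 : ENNReal.ofReal σ ≠ 0 := by simpa using hσ
  finiteness

end IsDefiningFn

end Hausdorff

namespace IsLayerLimit

variable {N : ℕ} {σ b m : ℝ} {Ω : Set (Euc N)} {U : Euc N → ℝ} {G : Euc N → Euc N}
  {l : Filter ℝ} {ν : Measure (Euc N)}

lemma integral_le_setIntegral_hausdorff (hN : 0 < N) (hν : IsLayerLimit Ω U l ν)
    (h : IsDefiningFn σ b m Ω U G) {f : Euc N → ℝ} (hf : Continuous f) (hf0 : ∀ x, 0 ≤ f x) :
    ∫ x, f x ∂ν ≤ (surfaceConst N σ m).toReal * ∫ x in frontier Ω, f x ∂(μH[(N : ℝ) - 1]) := by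
  have hres : ν.restrict (frontier Ω) = ν :=
    Measure.restrict_eq_self_of_ae_mem (hν.measure_compl_frontier h)
  have hle : ν ≤ surfaceConst N σ m • (μH[(N : ℝ) - 1] : Measure (Euc N)).restrict (frontier Ω) := by
    rw [← hres, ← Measure.restrict_smul]
    exact Measure.restrict_mono le_rfl (hν.le_hausdorffMeasure hN h)
  have hint : IntegrableOn f (frontier Ω) (μH[(N : ℝ) - 1] : Measure (Euc N)) := by
    have : IsFiniteMeasure ((μH[(N : ℝ) - 1] : Measure (Euc N)).restrict (frontier Ω)) :=
      ⟨by rw [Measure.restrict_apply_univ]; exact (h.hausdorffMeasure_frontier_ne_top hN).lt_top⟩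
    have hc := (hf.continuousOn (s := frontier Ω)).integrableOn_compact
      (μ := (μH[(N : ℝ) - 1] : Measure (Euc N)).restrict (frontier Ω)) h.isCompact_frontier
    rwa [IntegrableOn, Measure.restrict_restrict_of_subset subset_rfl] at hc
  refine (integral_mono_measure hle (.of_forall hf0)
    (hint.integrable.smul_measure (surfaceConst_ne_top N σ m))).trans (le_of_eq ?_)
  rw [integral_smul_measure, smul_eq_mul]

end IsLayerLimit

section Cutoff

/-- A cutoff function on the line, equal to `0` before `1` and to `1` after `2`. -/
def cutoff (t : ℝ) : ℝ := ∫ s in (1 : ℝ)..t, profile s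

lemma hasDerivAt_cutoff (t : ℝ) : HasDerivAt cutoff (profile t) t :=
  (continuous_profile.integral_hasStrictDerivAt 1 t).hasDerivAt

lemma contDiff_cutoff : ContDiff ℝ 1 cutoff := by
  refine contDiff_one_iff_deriv.2 ⟨fun t => (hasDerivAt_cutoff t).differentiableAt, ?_⟩
  rw [show deriv cutoff = profile from funext fun t => (hasDerivAt_cutoff t).deriv]
  exact continuous_profile

lemma monotone_cutoff : Monotone cutoff :=
  monotone_of_deriv_nonneg (fun t => (hasDerivAt_cutoff t).differentiableAt) fun t => by
    rw [(hasDerivAt_cutoff t).deriv]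
    exact profile_nonneg t

lemma cutoff_of_le_one {t : ℝ} (ht : t ≤ 1) : cutoff t = 0 := by
  rw [cutoff, intervalIntegral.integral_zero_ae]
  refine .of_forall fun s hs => profile_of_le_one ?_
  rw [uIoc_of_ge ht] at hs
  exact hs.2

lemma cutoff_two : cutoff 2 = 1 := by
  have h1 : cutoff 2 = ∫ s in (1 : ℝ)..2, (6 * (s - 1) * (2 - s)) := by
    refine intervalIntegral.integral_congr fun s hs => max_eq_right ?_
    rw [uIcc_of_le (by norm_num)] at hs
    nlinarith [hs.1, hs.2]
  rw [h1, intervalIntegral.integral_eq_sub_of_hasDerivAt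
    (f := fun s => -2 * s ^ 3 + 9 * s ^ 2 - 12 * s)]
  · norm_num
  · intro s _
    refine ((((hasDerivAt_pow 3 s).const_mul (-2)).add ((hasDerivAt_pow 2 s).const_mul 9)).sub
      ((hasDerivAt_id s).const_mul 12)).congr_deriv ?_
    norm_num
    ring
  · exact Continuous.intervalIntegrable (by fun_prop) _ _

lemma cutoff_of_two_le {t : ℝ} (ht : 2 ≤ t) : cutoff t = 1 := by
  rw [← cutoff_two, cutoff, cutoff, ← sub_eq_zero,
    intervalIntegral.integral_interval_sub_left (continuous_profile.intervalIntegrable _ _)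
      (continuous_profile.intervalIntegrable _ _), intervalIntegral.integral_zero_ae]
  refine .of_forall fun s hs => profile_of_two_le ?_
  rw [uIoc_of_le ht] at hs
  exact hs.1.le

lemma cutoff_nonneg (t : ℝ) : 0 ≤ cutoff t := by
  rcases le_total t 1 with ht | ht
  · rw [cutoff_of_le_one ht]
  · rw [← cutoff_of_le_one le_rfl]
    exact monotone_cutoff ht

lemma cutoff_le_one (t : ℝ) : cutoff t ≤ 1 := by
  rcases le_total 2 t with ht | ht
  · rw [cutoff_of_two_le ht]
  · rw [← cutoff_two]
    exact monotone_cutoff ht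

end Cutoff

section Divergence

variable {N : ℕ}

/-- The `i`-th partial derivative. -/
def pd (i : Fin N) (f : Euc N → ℝ) (x : Euc N) : ℝ :=
  fderiv ℝ f x (EuclideanSpace.single i (1 : ℝ))

lemma ContDiffOn.continuousOn_pd {Ω : Set (Euc N)} {f : Euc N → ℝ} (hf : ContDiffOn ℝ 1 f Ω)
    (hΩ : IsOpen Ω) (i : Fin N) : ContinuousOn (pd i f) Ω :=
  (hf.continuousOn_fderiv_of_isOpen hΩ le_rfl).clm_apply continuousOn_const

lemma contDiff_of_eq_zero_off {Ω K : Set (Euc N)} {f : Euc N → ℝ} (hΩ : IsOpen Ω)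
    (hK : IsClosed K) (hKΩ : K ⊆ Ω) (hf : ContDiffOn ℝ 1 f Ω) (hf0 : ∀ x ∉ K, f x = 0) :
    ContDiff ℝ 1 f := by
  refine contDiff_iff_contDiffAt.2 fun x => ?_
  by_cases hx : x ∈ Ω
  · exact hf.contDiffAt (hΩ.mem_nhds hx)
  · refine (contDiffAt_const (c := 0)).congr_of_eventuallyEq ?_
    filter_upwards [hK.isOpen_compl.mem_nhds fun hxK => hx (hKΩ hxK)] with y hy
    exact hf0 y hy

lemma pd_eq_zero_off {K : Set (Euc N)} {f : Euc N → ℝ} (hK : IsClosed K)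
    (hf0 : ∀ x ∉ K, f x = 0) (i : Fin N) {x : Euc N} (hx : x ∉ K) : pd i f x = 0 := by
  have : f =ᶠ[𝓝 x] fun _ => 0 := by
    filter_upwards [hK.isOpen_compl.mem_nhds hx] with y hy using hf0 y hy
  rw [pd, this.fderiv_eq, fderiv_const_apply, zero_apply]

lemma integral_pd_eq_zero {Ω K : Set (Euc N)} {f : Euc N → ℝ} (hΩ : IsOpen Ω) (hK : IsCompact K)
    (hKΩ : K ⊆ Ω) (hf : ContDiffOn ℝ 1 f Ω) (hf0 : ∀ x ∉ K, f x = 0) (i : Fin N) :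
    IntegrableOn (pd i f) Ω ∧ ∫ x in Ω, pd i f x = 0 := by
  have hC := contDiff_of_eq_zero_off hΩ hK.isClosed hKΩ hf hf0
  have hpd : Continuous (pd i f) := (hC.continuous_fderiv one_ne_zero).clm_apply continuous_const
  have hpd0 : ∀ x ∉ K, pd i f x = 0 := fun x hx => pd_eq_zero_off hK.isClosed hf0 i hx
  have h1 : Integrable (pd i f) := hpd.integrable_of_hasCompactSupport (.intro hK hpd0)
  have h2 : Integrable f := hC.continuous.integrable_of_hasCompactSupport (.intro hK hf0)
  refine ⟨h1.integrableOn, ?_⟩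
  rw [setIntegral_eq_integral_of_forall_compl_eq_zero fun x hx => hpd0 x fun hxK => hx (hKΩ hxK)]
  have h3 := integral_mul_fderiv_eq_neg_fderiv_mul_of_integrable (μ := (volume : Measure (Euc N)))
    (f := fun _ => (1 : ℝ)) (g := f) (v := EuclideanSpace.single i 1) (by simp)
    (by simp only [one_mul]; exact h1) (by simpa using h2) (by fun_prop)
    fun x _ => hC.differentiable one_ne_zero x
  simpa [pd] using h3

lemma pd_mul {f g : Euc N → ℝ} {x : Euc N} (hf : DifferentiableAt ℝ f x)
    (hg : DifferentiableAt ℝ g x) (i : Fin N) :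
    pd i (fun y => f y * g y) x = f x * pd i g x + g x * pd i f x := by
  simp [pd, fderiv_fun_mul hf hg]

lemma pd_comp {f : Euc N → ℝ} {x : Euc N} {φ : ℝ → ℝ} {c : ℝ} (hφ : HasDerivAt φ c (f x))
    (hf : DifferentiableAt ℝ f x) (i : Fin N) :
    pd i (fun y => φ (f y)) x = c * pd i f x := by
  have h := (hφ.comp_hasFDerivAt x hf.hasFDerivAt).fderiv
  simp only [pd]
  rw [show (fun y => φ (f y)) = φ ∘ f from rfl, h]
  simp

namespace IsDefiningFn

variable {σ b m : ℝ} {Ω : Set (Euc N)} {U : Euc N → ℝ} {G : Euc N → Euc N}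

lemma pd_eq (h : IsDefiningFn σ b m Ω U G) (i : Fin N) {x : Euc N} (hx : x ∈ Ω) :
    pd i U x = G x i := by
  rw [pd, (h.hasFDerivAt x hx).fderiv, innerSL_apply_apply, EuclideanSpace.inner_single_right]
  simp

lemma contDiffOn (h : IsDefiningFn σ b m Ω U G) : ContDiffOn ℝ 1 U Ω := by
  refine (contDiffOn_succ_iff_fderiv_of_isOpen (n := 0) h.isOpen).2
    ⟨fun x hx => (h.hasFDerivAt x hx).differentiableAt.differentiableWithinAt, by simp, ?_⟩
  rw [contDiffOn_zero]
  refine ContinuousOn.congr (f := fun x => innerSL ℝ (G x)) ?_ fun x hx => (h.hasFDerivAt x hx).fderiv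
  exact ((innerSL ℝ).continuous.comp h.continuous_grad).continuousOn

/-- The part of `Ω` where `-U` is at least `ε` is compact. -/
lemma isCompact_superlevel (h : IsDefiningFn σ b m Ω U G) (ε : ℝ) :
    IsCompact {x | x ∈ closure Ω ∧ ε ≤ -U x} :=
  h.isBounded.isCompact_closure.inter_right (isClosed_le continuous_const h.continuous.neg)

lemma superlevel_subset (h : IsDefiningFn σ b m Ω U G) {ε : ℝ} (hε : 0 < ε) :
    {x | x ∈ closure Ω ∧ ε ≤ -U x} ⊆ Ω := by
  rintro x ⟨-, hx⟩
  by_contra hxΩ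
  rw [h.eq_zero x hxΩ] at hx
  linarith

lemma cutoff_eq_zero (h : IsDefiningFn σ b m Ω U G) {ε : ℝ} (hε : 0 < ε) {x : Euc N}
    (hx : x ∉ {x | x ∈ closure Ω ∧ ε ≤ -U x}) : cutoff (-U x / ε) = 0 := by
  refine cutoff_of_le_one ((div_le_one hε).2 ?_)
  by_contra! hlt
  refine hx ⟨?_, hlt.le⟩
  by_contra hxc
  rw [h.eq_zero x fun hxΩ => hxc (subset_closure hxΩ)] at hlt
  linarith

lemma pd_cutoff (h : IsDefiningFn σ b m Ω U G) (ε : ℝ) (i : Fin N) {x : Euc N} (hx : x ∈ Ω) :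
    pd i (fun y => cutoff (-U y / ε)) x = -(profile (-U x / ε) / ε * G x i) := by
  have h1 : HasDerivAt (fun t => cutoff (-t / ε)) (profile (-U x / ε) * (-1 / ε)) (U x) :=
    (hasDerivAt_cutoff _).comp (U x) ((hasDerivAt_neg (U x)).div_const ε)
  rw [pd_comp h1 (h.hasFDerivAt x hx).differentiableAt, h.pd_eq i hx]
  ring

lemma contDiffOn_cutoff (h : IsDefiningFn σ b m Ω U G) (ε : ℝ) :
    ContDiffOn ℝ 1 (fun y => cutoff (-U y / ε)) Ω :=
  contDiff_cutoff.comp_contDiffOn (h.contDiffOn.neg.div_const ε)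

lemma tendsto_integral_mul (h : IsDefiningFn σ b m Ω U G) {k : ℝ → ℝ} {M : ℝ} (hk : Continuous k)
    (hkM : ∀ t, 0 ≤ t → |k t| ≤ M) (hk1 : ∀ t, 2 ≤ t → k t = 1) {D : Euc N → ℝ}
    (hD : IntegrableOn D Ω) :
    Tendsto (fun ε => ∫ x in Ω, k (-U x / ε) * D x) (𝓝[>] 0) (𝓝 (∫ x in Ω, D x)) := by
  refine tendsto_integral_filter_of_dominated_convergence (fun x => M * ‖D x‖) ?_ ?_
    (hD.norm.const_mul M) ?_
  · refine .of_forall fun ε => AEStronglyMeasurable.mul ?_ hD.aestronglyMeasurable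
    have := h.continuous
    exact (hk.comp (by fun_prop)).aestronglyMeasurable
  · filter_upwards [self_mem_nhdsWithin] with ε hε
    filter_upwards [ae_restrict_mem h.isOpen.measurableSet] with x hx
    rw [norm_mul]
    have := h.neg x hx
    exact mul_le_mul_of_nonneg_right (hkM _ (div_nonneg (by linarith) (le_of_lt hε))) (norm_nonneg _)
  · filter_upwards [ae_restrict_mem h.isOpen.measurableSet] with x hx
    refine tendsto_const_nhds.congr' ?_
    have := h.neg x hx
    filter_upwards [Ioo_mem_nhdsGT (show 0 < -U x / 2 by linarith)] with ε hε
    rw [hk1 _ ?_, one_mul]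
    rw [le_div_iff₀ hε.1]
    linarith [hε.2]

end IsDefiningFn

/-- The divergence theorem, where the boundary integral is taken with respect to a limit of layer
measures. -/
lemma IsLayerLimit.integral_divergence {σ b m : ℝ} {Ω : Set (Euc N)} {U : Euc N → ℝ}
    {G : Euc N → Euc N} {l : Filter ℝ} {ν : Measure (Euc N)} (hν : IsLayerLimit Ω U l ν)
    (h : IsDefiningFn σ b m Ω U G) {F : Fin N → Euc N → ℝ} {D : Euc N → ℝ}
    (hF : ∀ i, Continuous (F i)) (hF' : ∀ i, ContDiffOn ℝ 1 (F i) Ω) (hD : IntegrableOn D Ω)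
    (hFD : ∀ x ∈ Ω, ∑ i, pd i (F i) x = D x) :
    ∫ x in Ω, D x = ∫ x, ∑ i, F i x * G x i ∂ν := by
  have := hν.neBot
  have hG := h.continuous_grad
  have hcont : Continuous fun x => ∑ i, F i x * G x i :=
    continuous_finsetSum _ fun i _ => (hF i).mul (by fun_prop)
  have hlim := hν.tendsto_integral h hcont
  refine tendsto_nhds_unique ?_ hlim
  have hdct := h.tendsto_integral_mul contDiff_cutoff.continuous
    (fun t _ => abs_le.2 ⟨by linarith [cutoff_nonneg t], cutoff_le_one t⟩)
    (fun t => cutoff_of_two_le) hD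
  refine (hdct.mono_left hν.le_nhdsGT).congr' ?_
  filter_upwards [hν.le_nhdsGT self_mem_nhdsWithin] with ε hε
  have hε : 0 < ε := hε
  have hpd : ∀ i, ∀ x ∈ Ω, pd i (fun y => cutoff (-U y / ε) * F i y) x =
      cutoff (-U x / ε) * pd i (F i) x - profile (-U x / ε) / ε * (F i x * G x i) := by
    intro i x hx
    rw [pd_mul (((h.contDiffOn_cutoff ε).contDiffAt (h.isOpen.mem_nhds hx)).differentiableAt
      one_ne_zero) (((hF' i).contDiffAt (h.isOpen.mem_nhds hx)).differentiableAt one_ne_zero),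
      h.pd_cutoff ε i hx]
    ring
  have hzero := fun i => integral_pd_eq_zero h.isOpen (h.isCompact_superlevel ε)
    (h.superlevel_subset hε) ((h.contDiffOn_cutoff ε).mul (hF' i))
    (fun x hx => by rw [h.cutoff_eq_zero hε hx, zero_mul]) i
  have hsum : ∫ x in Ω, (cutoff (-U x / ε) * D x -
      profile (-U x / ε) / ε * ∑ i, F i x * G x i) = 0 := by
    rw [← Finset.sum_eq_zero (s := Finset.univ) fun i _ => (hzero i).2, ← integral_finsetSum _ fun i _ => (hzero i).1]
    refine setIntegral_congr_fun h.isOpen.measurableSet fun x hx => ?_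
    simp only [hpd _ x hx, Finset.sum_sub_distrib, ← Finset.mul_sum, hFD x hx]
  rw [integral_sub ?_ ?_, sub_eq_zero] at hsum
  · exact hsum
  · refine hD.norm.mono' (AEStronglyMeasurable.mul ?_ hD.aestronglyMeasurable)
      (.of_forall fun x => ?_)
    · have := h.continuous
      exact (contDiff_cutoff.continuous.comp (by fun_prop)).aestronglyMeasurable
    · rw [norm_mul, Real.norm_of_nonneg (cutoff_nonneg _)]
      exact mul_le_of_le_one_left (norm_nonneg _) (cutoff_le_one _)
  · have h1 := h.continuous
    have h2 := continuous_profile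
    have h3 : Continuous fun x => profile (-U x / ε) / ε * ∑ i, F i x * G x i :=
      Continuous.mul (by fun_prop) hcont
    exact (h3.continuousOn.integrableOn_compact h.isBounded.isCompact_closure).mono_set
      subset_closure

end Divergence

section WeaklyHarmonic

variable {N : ℕ}

lemma measurable_pd (i : Fin N) (f : Euc N → ℝ) : Measurable (pd i f) :=
  measurable_fderiv_apply_const ℝ f _

/-- The partial derivatives of a divergence free field are divergence free in the sense of
distributions. -/
lemma integral_sum_pd_mul_pd_eq_zero {Ω K : Set (Euc N)} {q : Fin N → Euc N → ℝ} {φ : Euc N → ℝ}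
    (hΩ : IsOpen Ω) (hK : IsCompact K) (hKΩ : K ⊆ Ω) (hq : ∀ j, Continuous (q j))
    (hq' : ∀ j, ContDiffOn ℝ 1 (q j) Ω) (hdiv : ∀ x ∈ Ω, ∑ j, pd j (q j) x = 0)
    (hφ : ContDiffOn ℝ 1 φ Ω) (hφ0 : ∀ x ∉ K, φ x = 0) (i : Fin N) :
    ∫ x in Ω, ∑ j, pd i (q j) x * pd j φ x = 0 := by
  have hφC := contDiff_of_eq_zero_off hΩ hK.isClosed hKΩ hφ hφ0
  have hpd : ∀ j, Continuous (pd j φ) := fun j =>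
    (hφC.continuous_fderiv one_ne_zero).clm_apply continuous_const
  have hpd0 : ∀ j, ∀ x ∉ K, pd j φ x = 0 := fun j x hx => pd_eq_zero_off hK.isClosed hφ0 j hx
  have hpdint : ∀ j, Integrable (pd j φ) := fun j =>
    (hpd j).integrable_of_hasCompactSupport (.intro hK (hpd0 j))
  obtain ⟨δ, hδ, hδΩ⟩ := hK.exists_cthickening_subset_open hΩ hKΩ
  set e : Euc N := EuclideanSpace.single i 1 with he
  have hen : ‖e‖ = 1 := by simp [he]
  have hmem : ∀ x ∈ K, ∀ t ∈ ball (0 : ℝ) δ, x + t • e ∈ cthickening δ K := by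
    intro x hx t ht
    refine mem_cthickening_of_dist_le _ x _ _ hx ?_
    rw [dist_self_add_left, norm_smul, hen, mul_one]
    exact (mem_ball_zero_iff.1 ht).le
  have hdiff : ∀ j, ∀ x ∈ Ω, DifferentiableAt ℝ (q j) x := fun j x hx =>
    ((hq' j).contDiffAt (hΩ.mem_nhds hx)).differentiableAt one_ne_zero
  have hzero : ∀ t ∈ ball (0 : ℝ) δ, ∫ x, ∑ j, q j (x + t • e) * pd j φ x = 0 := by
    intro t ht
    set Ω' := Ω ∩ (fun x => x + t • e) ⁻¹' Ω with hΩ'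
    have hΩ'o : IsOpen Ω' := hΩ.inter (hΩ.preimage (by fun_prop))
    have hKΩ' : K ⊆ Ω' := fun x hx => ⟨hKΩ hx, hδΩ (hmem x hx t ht)⟩
    have hshift : ∀ j, ContDiffOn ℝ 1 (fun x => q j (x + t • e)) Ω' := fun j =>
      (hq' j).comp (contDiff_id.add contDiff_const).contDiffOn fun x hx => hx.2
    have hpds : ∀ j, ∀ x, pd j (fun x => q j (x + t • e)) x = pd j (q j) (x + t • e) := fun j x => by
      rw [pd, pd, fderiv_comp_add_right]
    have hz := fun j => integral_pd_eq_zero hΩ'o hK hKΩ' ((hshift j).mul (hφ.mono inter_subset_left))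
      (fun x hx => by rw [hφ0 x hx, mul_zero]) j
    rw [← setIntegral_eq_integral_of_forall_compl_eq_zero (s := Ω') fun x hx =>
      Finset.sum_eq_zero fun j _ => by rw [hpd0 j x fun hxK => hx (hKΩ' hxK), mul_zero],
      ← Finset.sum_eq_zero (s := Finset.univ) fun j _ => (hz j).2,
      ← integral_finsetSum _ fun j _ => (hz j).1]
    refine setIntegral_congr_fun hΩ'o.measurableSet fun x hx => ?_
    have h1 : ∀ j, pd j (fun y => q j (y + t • e) * φ y) x =
        q j (x + t • e) * pd j φ x + φ x * pd j (q j) (x + t • e) := fun j => by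
      rw [pd_mul (((hshift j).contDiffAt (hΩ'o.mem_nhds hx)).differentiableAt one_ne_zero)
        (hφC.differentiable one_ne_zero x), hpds]
    simp only [h1, Finset.sum_add_distrib, ← Finset.mul_sum, hdiv _ hx.2, mul_zero, add_zero]
  have hbdd : ∀ j, ∃ M, ∀ x ∈ cthickening δ K, ‖pd i (q j) x‖ ≤ M := fun j =>
    hK.cthickening.exists_bound_of_continuousOn (((hq' j).continuousOn_pd hΩ i).mono hδΩ)
  choose M hM using hbdd
  have hderiv := hasDerivAt_integral_of_dominated_loc_of_deriv_le (μ := (volume : Measure (Euc N)))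
    (x₀ := (0 : ℝ)) (s := ball 0 δ) (bound := fun x => ∑ j, M j * ‖pd j φ x‖)
    (F := fun t x => ∑ j, q j (x + t • e) * pd j φ x)
    (F' := fun t x => ∑ j, pd i (q j) (x + t • e) * pd j φ x) (ball_mem_nhds 0 hδ)
    (.of_forall fun t => (continuous_finsetSum _ fun j _ =>
      ((hq j).comp (by fun_prop)).mul (hpd j)).aestronglyMeasurable)
    (by
      refine (continuous_finsetSum _ fun j _ =>
        ((hq j).comp (by fun_prop)).mul (hpd j)).integrable_of_hasCompactSupport (.intro hK ?_)
      exact fun x hx => Finset.sum_eq_zero fun j _ => mul_eq_zero_of_right _ (hpd0 j x hx))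
    (Measurable.aestronglyMeasurable (Finset.measurable_fun_sum _ fun j _ =>
      ((measurable_pd i (q j)).comp (by fun_prop)).mul (hpd j).measurable))
    (.of_forall fun x t ht => by
      refine (norm_sum_le _ _).trans (Finset.sum_le_sum fun j _ => ?_)
      rw [norm_mul]
      by_cases hx : x ∈ K
      · exact mul_le_mul_of_nonneg_right (hM j _ (hmem x hx t ht)) (norm_nonneg _)
      · simp [hpd0 j x hx])
    (integrable_finsetSum _ fun j _ => (hpdint j).norm.const_mul _)
    (.of_forall fun x t ht => by
      by_cases hx : x ∈ K
      · exact HasDerivAt.fun_sum fun j _ =>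
          (hasDerivAt_comp_add_smul (hdiff j _ (hδΩ (hmem x hx t ht)))).mul_const _
      · simp only [hpd0 _ x hx, mul_zero, Finset.sum_const_zero]
        exact hasDerivAt_const _ _)
  have hconst : (fun t : ℝ => ∫ x, ∑ j, q j (x + t • e) * pd j φ x) =ᶠ[𝓝 0] fun _ => 0 := by
    filter_upwards [ball_mem_nhds (0 : ℝ) hδ] with t ht using hzero t ht
  have h0 := hderiv.2.unique ((hasDerivAt_const (0 : ℝ) (0 : ℝ)).congr_of_eventuallyEq hconst)
  simp only [zero_smul, add_zero] at h0
  rw [setIntegral_eq_integral_of_forall_compl_eq_zero fun x hx =>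
    Finset.sum_eq_zero fun j _ => by rw [hpd0 j x fun hxK => hx (hKΩ hxK), mul_zero]]
  exact h0

end WeaklyHarmonic

section TorsionField

/-- The field `G` is the gradient of the negative function `U`, has divergence `N`, and has square
integrable derivatives. -/
structure IsTorsionField {N : ℕ} (σ b m : ℝ) (Ω : Set (Euc N)) (U : Euc N → ℝ)
    (G : Euc N → Euc N) : Prop extends IsDefiningFn σ b m Ω U G where
  contDiffOn_grad : ∀ i, ContDiffOn ℝ 1 (fun x => G x i) Ω
  pd_symm : ∀ i j, ∀ x ∈ Ω, pd i (fun y => G y j) x = pd j (fun y => G y i) x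
  sum_pd : ∀ x ∈ Ω, ∑ i, pd i (fun y => G y i) x = N
  integrableOn_sq : ∀ i j, IntegrableOn (fun x => pd i (fun y => G y j) x ^ 2) Ω

/-- The `i`-th component of the gradient of `|x - z|² / 2 - U`, where `G` is the gradient of
`U`. -/
def defect {N : ℕ} (z : Euc N) (G : Euc N → Euc N) (i : Fin N) (x : Euc N) : ℝ :=
  x i - z i - G x i

namespace IsTorsionField

variable {N : ℕ} {σ b m : ℝ} {Ω : Set (Euc N)} {U : Euc N → ℝ} {G : Euc N → Euc N}

lemma differentiableAt_grad (h : IsTorsionField σ b m Ω U G) (i : Fin N) {x : Euc N}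
    (hx : x ∈ Ω) : DifferentiableAt ℝ (fun y => G y i) x :=
  ((h.contDiffOn_grad i).contDiffAt (h.isOpen.mem_nhds hx)).differentiableAt one_ne_zero

lemma continuous_apply (h : IsTorsionField σ b m Ω U G) (i : Fin N) :
    Continuous fun x => G x i := by
  have := h.continuous_grad
  fun_prop

lemma continuous_defect (h : IsTorsionField σ b m Ω U G) (z : Euc N) (i : Fin N) :
    Continuous (defect z G i) := by
  have := h.continuous_grad
  unfold defect
  fun_prop

lemma contDiffOn_defect (h : IsTorsionField σ b m Ω U G) (z : Euc N) (i : Fin N) :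
    ContDiffOn ℝ 1 (defect z G i) Ω := by
  refine ContDiffOn.sub (f := fun x : Euc N => x i - z i) ?_ (h.contDiffOn_grad i)
  fun_prop

lemma differentiableAt_defect (h : IsTorsionField σ b m Ω U G) (z : Euc N) (i : Fin N) {x : Euc N}
    (hx : x ∈ Ω) : DifferentiableAt ℝ (defect z G i) x :=
  ((h.contDiffOn_defect z i).contDiffAt (h.isOpen.mem_nhds hx)).differentiableAt one_ne_zero

lemma pd_defect (h : IsTorsionField σ b m Ω U G) (z : Euc N) (i j : Fin N) {x : Euc N}
    (hx : x ∈ Ω) :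
    pd j (defect z G i) x = (if i = j then 1 else 0) - pd j (fun y => G y i) x := by
  have h1 : HasFDerivAt (fun y : Euc N => y i - z i) (EuclideanSpace.proj i : Euc N →L[ℝ] ℝ) x :=
    (EuclideanSpace.proj (𝕜 := ℝ) i).hasFDerivAt.sub_const _
  have h2 := (h1.sub (h.differentiableAt_grad i hx).hasFDerivAt).fderiv
  rw [pd, show defect z G i = (fun y : Euc N => y i - z i) - fun y => G y i from rfl, h2]
  simp [pd]

lemma pd_grad (h : IsTorsionField σ b m Ω U G) (z : Euc N) (i j : Fin N) {x : Euc N}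
    (hx : x ∈ Ω) :
    pd j (fun y => G y i) x = (if i = j then 1 else 0) - pd j (defect z G i) x := by
  rw [h.pd_defect z i j hx]
  ring

lemma pd_defect_symm (h : IsTorsionField σ b m Ω U G) (z : Euc N) (i j : Fin N) {x : Euc N}
    (hx : x ∈ Ω) : pd i (defect z G j) x = pd j (defect z G i) x := by
  rw [h.pd_defect z _ _ hx, h.pd_defect z _ _ hx, h.pd_symm i j x hx]
  simp only [eq_comm]

lemma sum_pd_defect (h : IsTorsionField σ b m Ω U G) (z : Euc N) {x : Euc N} (hx : x ∈ Ω) :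
    ∑ i, pd i (defect z G i) x = 0 := by
  simp only [h.pd_defect z _ _ hx, if_true, Finset.sum_sub_distrib, h.sum_pd x hx]
  simp

lemma integrableOn_continuous_mul (h : IsTorsionField σ b m Ω U G) {f w : Euc N → ℝ}
    (hf : Continuous f) (hw : IntegrableOn w Ω) : IntegrableOn (fun x => f x * w x) Ω :=
  hw.continuousOn_mul_of_subset hf.continuousOn h.isBounded.isCompact_closure
    h.isOpen.measurableSet subset_closure

lemma integrableOn_of_continuous (h : IsTorsionField σ b m Ω U G) {f : Euc N → ℝ}
    (hf : Continuous f) : IntegrableOn f Ω :=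
  (hf.continuousOn.integrableOn_compact h.isBounded.isCompact_closure).mono_set subset_closure

lemma integrableOn_pd_grad (h : IsTorsionField σ b m Ω U G) (i j : Fin N) :
    IntegrableOn (fun x => pd j (fun y => G y i) x) Ω := by
  have h1 : IntegrableOn (fun _ : Euc N => (1 : ℝ)) Ω := h.integrableOn_of_continuous continuous_const
  refine (h1.add (h.integrableOn_sq j i)).mono' (measurable_pd j _).aestronglyMeasurable
    (.of_forall fun x => ?_)
  rw [Real.norm_eq_abs, Pi.add_apply, ← sq_abs (pd j (fun y => G y i) x)]
  nlinarith [sq_nonneg (|pd j (fun y => G y i) x| - 1), abs_nonneg (pd j (fun y => G y i) x)]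

lemma integrableOn_pd_defect (h : IsTorsionField σ b m Ω U G) (z : Euc N) (i j : Fin N) :
    IntegrableOn (pd j (defect z G i)) Ω :=
  ((h.integrableOn_of_continuous (f := fun _ => if i = j then 1 else 0) continuous_const).sub
    (h.integrableOn_pd_grad i j)).congr_fun (fun _ hx => (h.pd_defect z i j hx).symm)
    h.isOpen.measurableSet

lemma integrableOn_pd_defect_sq (h : IsTorsionField σ b m Ω U G) (z : Euc N) (i j : Fin N) :
    IntegrableOn (fun x => pd j (defect z G i) x ^ 2) Ω := by
  refine (((h.integrableOn_of_continuous (f := fun _ => if i = j then 1 else 0)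
    continuous_const).sub ((h.integrableOn_pd_grad i j).const_mul
      (2 * if i = j then 1 else 0))).add (h.integrableOn_sq j i)).congr_fun (fun x hx => ?_)
    h.isOpen.measurableSet
  simp only [Pi.add_apply, Pi.sub_apply, h.pd_defect z i j hx]
  split_ifs <;> ring

/-- The integrand of the weighted Hessian deficit, one row at a time. -/
lemma integrableOn_neg_mul_sum_sq (h : IsTorsionField σ b m Ω U G) (z : Euc N) (i : Fin N) :
    IntegrableOn (fun x => -U x * ∑ j, pd j (defect z G i) x ^ 2) Ω :=
  h.integrableOn_continuous_mul h.continuous.neg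
    (integrable_finsetSum _ fun j _ => h.integrableOn_pd_defect_sq z i j)

lemma integrableOn_defect_mul_sum (h : IsTorsionField σ b m Ω U G) (z : Euc N) (i : Fin N) :
    IntegrableOn (fun x => defect z G i x * ∑ j, G x j * pd j (defect z G i) x) Ω :=
  h.integrableOn_continuous_mul (h.continuous_defect z i) (integrable_finsetSum _ fun j _ =>
    h.integrableOn_continuous_mul (h.continuous_apply j) (h.integrableOn_pd_defect z i j))

lemma integral_neg_mul_sum_sq (h : IsTorsionField σ b m Ω U G) (z : Euc N) (i : Fin N) :
    ∫ x in Ω, -U x * ∑ j, pd j (defect z G i) x ^ 2 =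
      ∫ x in Ω, defect z G i x * ∑ j, G x j * pd j (defect z G i) x := by
  have hk : Continuous fun t => cutoff t + t * profile t :=
    contDiff_cutoff.continuous.add (continuous_id.mul continuous_profile)
  have hk2 : ∀ t, 2 ≤ t → cutoff t + t * profile t = 1 := fun t ht => by
    rw [cutoff_of_two_le ht, profile_of_two_le ht, mul_zero, add_zero]
  have hkM : ∀ t, 0 ≤ t → |cutoff t + t * profile t| ≤ 5 := fun t ht => by
    rcases le_total 2 t with h2 | h2
    · rw [hk2 t h2]
      norm_num
    · have h3 := cutoff_nonneg t
      have h4 := cutoff_le_one t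
      have h5 := profile_nonneg t
      have h6 := profile_le t
      rw [abs_of_nonneg (by positivity)]
      nlinarith
  have hl1 := h.tendsto_integral_mul contDiff_cutoff.continuous
    (fun t _ => abs_le.2 ⟨by linarith [cutoff_nonneg t], cutoff_le_one t⟩)
    (fun t => cutoff_of_two_le) (h.integrableOn_neg_mul_sum_sq z i)
  have hl2 := h.tendsto_integral_mul hk hkM hk2 (h.integrableOn_defect_mul_sum z i)
  refine tendsto_nhds_unique (hl1.congr' ?_) hl2
  filter_upwards [self_mem_nhdsWithin] with ε hε
  have hε : 0 < ε := hε
  have hUd : ∀ x ∈ Ω, DifferentiableAt ℝ U x := fun x hx => (h.hasFDerivAt x hx).differentiableAt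
  have hζ : ∀ t, HasDerivAt (fun t => -t * cutoff (-t / ε))
      (-(cutoff (-t / ε) + -t / ε * profile (-t / ε))) t := fun t => by
    refine ((hasDerivAt_neg t).mul ((hasDerivAt_cutoff (-t / ε)).comp t
      ((hasDerivAt_neg t).div_const ε))).congr_deriv ?_
    simp only [Function.comp_apply]
    ring
  have hC : ContDiffOn ℝ 1 (fun x => -U x * cutoff (-U x / ε)) Ω :=
    h.contDiffOn.neg.mul (h.contDiffOn_cutoff ε)
  have hpd : ∀ j, ∀ x ∈ Ω, pd j (fun y => -U y * cutoff (-U y / ε) * defect z G i y) x =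
      cutoff (-U x / ε) * (-U x * pd j (defect z G i) x) -
      (cutoff (-U x / ε) + -U x / ε * profile (-U x / ε)) * (defect z G i x * G x j) := by
    intro j x hx
    rw [pd_mul ((hC.contDiffAt (h.isOpen.mem_nhds hx)).differentiableAt one_ne_zero)
      (h.differentiableAt_defect z i hx), pd_comp (hζ (U x)) (hUd x hx), h.pd_eq j hx]
    ring
  have hzero := integral_sum_pd_mul_pd_eq_zero h.isOpen (h.isCompact_superlevel ε)
    (h.superlevel_subset hε) (h.continuous_defect z) (h.contDiffOn_defect z)
    (fun x hx => h.sum_pd_defect z hx) (hC.mul (h.contDiffOn_defect z i))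
    (fun x hx => by rw [h.cutoff_eq_zero hε hx, mul_zero, zero_mul]) i
  have hc1 : Continuous fun x => cutoff (-U x / ε) :=
    contDiff_cutoff.continuous.comp (h.continuous.neg.div_const ε)
  have hc2 : Continuous fun x => cutoff (-U x / ε) + -U x / ε * profile (-U x / ε) :=
    hk.comp (h.continuous.neg.div_const ε)
  rw [← sub_eq_zero, ← integral_sub
    (h.integrableOn_continuous_mul hc1 (h.integrableOn_neg_mul_sum_sq z i))
    (h.integrableOn_continuous_mul hc2 (h.integrableOn_defect_mul_sum z i)), ← hzero]
  refine setIntegral_congr_fun h.isOpen.measurableSet fun x hx => ?_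
  simp only [hpd _ x hx, h.pd_defect_symm z i _ hx, Finset.mul_sum, ← Finset.sum_sub_distrib]
  refine Finset.sum_congr rfl fun j _ => ?_
  ring

end IsTorsionField

end TorsionField

lemma pd_sum_sq {N : ℕ} {f : Fin N → Euc N → ℝ} {x : Euc N}
    (hf : ∀ k, DifferentiableAt ℝ (f k) x) (i : Fin N) :
    pd i (fun y => ∑ k, f k y ^ 2) x = 2 * ∑ k, f k x * pd i (f k) x := by
  have h1 : HasFDerivAt (fun y => ∑ k, f k y ^ 2)
      (∑ k, (2 * f k x) • fderiv ℝ (f k) x) x := HasFDerivAt.fun_sum fun k _ => by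
    simpa using (hf k).hasFDerivAt.pow 2
  rw [pd, h1.fderiv, sum_apply, Finset.mul_sum]
  exact Finset.sum_congr rfl fun k _ => by simp [pd, mul_assoc]

namespace IsTorsionField

variable {N : ℕ} {σ b m : ℝ} {Ω : Set (Euc N)} {U : Euc N → ℝ} {G : Euc N → Euc N}
  {l : Filter ℝ} {ν : Measure (Euc N)}

lemma integral_inner_boundary (h : IsTorsionField σ b m Ω U G) (hν : IsLayerLimit Ω U l ν)
    (z : Euc N) : ∫ x, ∑ j, defect z G j x * G x j ∂ν = 0 := by
  rw [← hν.integral_divergence h.toIsDefiningFn (D := fun _ => 0) (h.continuous_defect z)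
    (h.contDiffOn_defect z) integrableOn_zero fun x hx => h.sum_pd_defect z hx]
  simp

lemma integral_mul_boundary_eq_zero (h : IsTorsionField σ b m Ω U G) (hν : IsLayerLimit Ω U l ν)
    (f : Euc N → ℝ) : ∫ x, U x * f x ∂ν = 0 := by
  refine integral_eq_zero_of_ae ?_
  have h1 : ∀ᵐ x ∂ν, x ∈ frontier Ω := hν.measure_compl_frontier h.toIsDefiningFn
  filter_upwards [h1] with x hx
  rw [h.eq_zero x (h.notMem_of_mem_frontier hx), zero_mul, Pi.zero_apply]

lemma integral_inner (h : IsTorsionField σ b m Ω U G) (hν : IsLayerLimit Ω U l ν) (z : Euc N) :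
    ∫ x in Ω, ∑ j, defect z G j x * G x j = 0 := by
  rw [hν.integral_divergence h.toIsDefiningFn (F := fun j x => U x * defect z G j x)
    (D := fun x => ∑ j, defect z G j x * G x j)
    (fun j => h.continuous.mul (h.continuous_defect z j))
    (fun j => h.contDiffOn.mul (h.contDiffOn_defect z j))
    (h.integrableOn_of_continuous (continuous_finsetSum _ fun j _ =>
      (h.continuous_defect z j).mul (h.continuous_apply j))) fun x hx => ?_]
  · simp only [mul_assoc, ← Finset.mul_sum]
    exact h.integral_mul_boundary_eq_zero hν _
  · simp only [pd_mul (h.hasFDerivAt x hx).differentiableAt (h.differentiableAt_defect z _ hx),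
      h.pd_eq _ hx, Finset.sum_add_distrib, ← Finset.mul_sum, h.sum_pd_defect z hx, mul_zero,
      zero_add]

lemma integral_grad (h : IsTorsionField σ b m Ω U G) (hν : IsLayerLimit Ω U l ν) (i : Fin N) :
    ∫ x in Ω, G x i = 0 := by
  have hc : ∀ j, ContDiffOn ℝ 1 (fun _ : Euc N => if j = i then (1 : ℝ) else 0) Ω :=
    fun j => contDiffOn_const
  rw [hν.integral_divergence h.toIsDefiningFn (F := fun j x => U x * if j = i then 1 else 0)
    (fun j => h.continuous.mul continuous_const) (fun j => h.contDiffOn.mul (hc j))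
    (h.integrableOn_of_continuous (h.continuous_apply i)) fun x hx => ?_]
  · simp only [mul_assoc, ← Finset.mul_sum]
    exact h.integral_mul_boundary_eq_zero hν _
  · simp only [pd_mul (h.hasFDerivAt x hx).differentiableAt (differentiableAt_const _),
      h.pd_eq _ hx]
    simp [pd]

/-- The weighted Hessian deficit in terms of the boundary values of the gradient. -/
lemma integral_sum_sq_mul_inner (h : IsTorsionField σ b m Ω U G) (hν : IsLayerLimit Ω U l ν)
    (z : Euc N) : ∫ x, (∑ k, G x k ^ 2) * ∑ j, defect z G j x * G x j ∂ν =
      -2 * ∑ i, ∫ x in Ω, -U x * ∑ j, pd j (defect z G i) x ^ 2 := by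
  have hP : ∀ x ∈ Ω, ∀ j, HasFDerivAt (fun y => G y j) (fderiv ℝ (fun y => G y j) x) x :=
    fun x hx j => (h.differentiableAt_grad j hx).hasFDerivAt
  have hPc : Continuous fun x => ∑ k, G x k ^ 2 :=
    continuous_finsetSum _ fun k _ => (h.continuous_apply k).pow 2
  have hPd : ContDiffOn ℝ 1 (fun x => ∑ k, G x k ^ 2) Ω :=
    ContDiffOn.sum fun k _ => (h.contDiffOn_grad k).pow 2
  have hint : IntegrableOn (fun x => ∑ j, defect z G j x * G x j) Ω :=
    h.integrableOn_of_continuous (continuous_finsetSum _ fun j _ =>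
      (h.continuous_defect z j).mul (h.continuous_apply j))
  have hintB : IntegrableOn
      (fun x => ∑ i, defect z G i x * ∑ j, G x j * pd j (defect z G i) x) Ω :=
    integrable_finsetSum _ fun i _ => h.integrableOn_defect_mul_sum z i
  have hdiv := hν.integral_divergence h.toIsDefiningFn
    (F := fun j x => (∑ k, G x k ^ 2) * defect z G j x)
    (D := fun x => 2 * ∑ j, defect z G j x * G x j -
      2 * ∑ i, defect z G i x * ∑ j, G x j * pd j (defect z G i) x)
    (fun j => hPc.mul (h.continuous_defect z j)) (fun j => hPd.mul (h.contDiffOn_defect z j))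
    ((hint.const_mul 2).sub (hintB.const_mul 2)) fun x hx => ?_
  · simp only [mul_assoc, ← Finset.mul_sum] at hdiv
    rw [← hdiv, integral_sub (hint.const_mul 2) (hintB.const_mul 2), integral_const_mul,
      integral_const_mul, h.integral_inner hν z,
      integral_finsetSum _ fun i _ => h.integrableOn_defect_mul_sum z i]
    simp only [h.integral_neg_mul_sum_sq z]
    ring
  · have h1 : ∀ j, pd j (fun y => ∑ k, G y k ^ 2) x =
        2 * G x j - 2 * ∑ k, G x k * pd k (defect z G j) x := fun j => by
      rw [pd_sum_sq (f := fun k y => G y k) fun k => h.differentiableAt_grad k hx, ← mul_sub]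
      simp only [h.pd_grad z _ j hx, h.pd_defect_symm z _ j hx, mul_sub, Finset.sum_sub_distrib]
      simp
    have h3 : ∀ j, pd j (fun y => (∑ k, G y k ^ 2) * defect z G j y) x =
        (∑ k, G x k ^ 2) * pd j (defect z G j) x + (2 * (defect z G j x * G x j) -
          2 * (defect z G j x * ∑ k, G x k * pd k (defect z G j) x)) := fun j => by
      rw [pd_mul ((hPd.contDiffAt (h.isOpen.mem_nhds hx)).differentiableAt one_ne_zero)
        (h.differentiableAt_defect z j hx), h1]
      ring
    simp only [h3, Finset.sum_add_distrib, Finset.sum_sub_distrib, ← Finset.mul_sum,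
      h.sum_pd_defect z hx]
    ring

lemma integral_sum_defect_sq_mul (h : IsTorsionField σ b m Ω U G) (hν : IsLayerLimit Ω U l ν)
    (z : Euc N) : ∫ x, (∑ k, defect z G k x ^ 2) * ∑ j, G x j ^ 2 ∂ν =
      2 * (∑ i, ∫ x in Ω, -U x * ∑ j, pd j (defect z G i) x ^ 2) +
        N * ∑ i, ∫ x in Ω, defect z G i x ^ 2 := by
  have hQc : Continuous fun x => ∑ k, defect z G k x ^ 2 :=
    continuous_finsetSum _ fun k _ => (h.continuous_defect z k).pow 2
  have hQd : ContDiffOn ℝ 1 (fun x => ∑ k, defect z G k x ^ 2) Ω :=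
    ContDiffOn.sum fun k _ => (h.contDiffOn_defect z k).pow 2
  have hint : IntegrableOn (fun x => ∑ k, defect z G k x ^ 2) Ω :=
    h.integrableOn_of_continuous hQc
  have hintB : IntegrableOn
      (fun x => ∑ i, defect z G i x * ∑ j, G x j * pd j (defect z G i) x) Ω :=
    integrable_finsetSum _ fun i _ => h.integrableOn_defect_mul_sum z i
  have hdiv := hν.integral_divergence h.toIsDefiningFn
    (F := fun j x => (∑ k, defect z G k x ^ 2) * G x j)
    (D := fun x => 2 * ∑ i, defect z G i x * ∑ j, G x j * pd j (defect z G i) x +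
      N * ∑ k, defect z G k x ^ 2)
    (fun j => hQc.mul (h.continuous_apply j)) (fun j => hQd.mul (h.contDiffOn_grad j))
    ((hintB.const_mul 2).add (hint.const_mul _)) fun x hx => ?_
  · simp only [mul_assoc, ← Finset.mul_sum, ← pow_two] at hdiv
    rw [← hdiv, integral_add (hintB.const_mul 2) (hint.const_mul _), integral_const_mul,
      integral_const_mul, integral_finsetSum _ fun i _ => h.integrableOn_defect_mul_sum z i,
      integral_finsetSum (f := fun i x => defect z G i x ^ 2) _ fun i _ =>
        h.integrableOn_of_continuous ((h.continuous_defect z i).pow 2)]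
    simp only [h.integral_neg_mul_sum_sq z]
  · have h1 := pd_sum_sq fun k => h.differentiableAt_defect z k hx
    have h3 : ∀ j, pd j (fun y => (∑ k, defect z G k y ^ 2) * G y j) x =
        (∑ k, defect z G k x ^ 2) * pd j (fun y => G y j) x +
          2 * ∑ k, defect z G k x * (G x j * pd j (defect z G k) x) := fun j => by
      rw [pd_mul ((hQd.contDiffAt (h.isOpen.mem_nhds hx)).differentiableAt one_ne_zero)
        (h.differentiableAt_grad j hx), h1, Finset.mul_sum, Finset.mul_sum, Finset.mul_sum]
      congr 1
      refine Finset.sum_congr rfl fun k _ => ?_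
      ring
    simp only [h3, Finset.sum_add_distrib, ← Finset.mul_sum, h.sum_pd x hx]
    rw [Finset.sum_comm]
    simp only [← Finset.mul_sum]
    ring

end IsTorsionField

namespace IsTorsionField

variable {N : ℕ} {σ b m : ℝ} {Ω : Set (Euc N)} {U : Euc N → ℝ} {G : Euc N → Euc N}
  {l : Filter ℝ} {ν : Measure (Euc N)}

lemma sum_integral_le_of_poincare (h : IsTorsionField σ b m Ω U G) (hν : IsLayerLimit Ω U l ν)
    (z : Euc N) (R : ℝ) {C : ℝ} (hC : 0 ≤ C)
    (hp : ∑ i, ∫ x in Ω, defect z G i x ^ 2 ≤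
      C * ∑ i, ∫ x in Ω, -U x * ∑ j, pd j (defect z G i) x ^ 2) :
    ∑ i, ∫ x in Ω, -U x * ∑ j, pd j (defect z G i) x ^ 2 ≤
      (2 + N * C) / 3 * ∫ x, (∑ k, G x k ^ 2 - R ^ 2) ^ 2 ∂ν := by
  set W := ∑ i, ∫ x in Ω, -U x * ∑ j, pd j (defect z G i) x ^ 2 with hW
  set α : ℝ := 2 + N * C with hα
  have hα0 : 0 < α := by positivity
  have hSc : Continuous fun x => ∑ j, defect z G j x * G x j :=
    continuous_finsetSum _ fun j _ => (h.continuous_defect z j).mul (h.continuous_apply j)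
  have hPc : Continuous fun x => ∑ k, G x k ^ 2 :=
    continuous_finsetSum _ fun k _ => (h.continuous_apply k).pow 2
  have hQc : Continuous fun x => ∑ k, defect z G k x ^ 2 :=
    continuous_finsetSum _ fun k _ => (h.continuous_defect z k).pow 2
  have hPS : Continuous fun x => (∑ k, G x k ^ 2) * ∑ j, defect z G j x * G x j := hPc.mul hSc
  have hQP : Continuous fun x => (∑ k, defect z G k x ^ 2) * ∑ j, G x j ^ 2 := hQc.mul hPc
  have hint : ∀ {f : Euc N → ℝ}, Continuous f → Integrable f ν := fun hf =>
    hν.integrable_of_continuous h.toIsDefiningFn hf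
  have h1 : ∫ x, -((∑ k, G x k ^ 2 - R ^ 2) * ∑ j, defect z G j x * G x j) ∂ν = 2 * W := by
    simp only [sub_mul]
    rw [integral_neg, integral_sub (hint hPS) ((hint hSc).const_mul _),
      integral_const_mul, h.integral_inner_boundary hν z, h.integral_sum_sq_mul_inner hν z]
    ring
  have h2 : ∫ x, (∑ k, defect z G k x ^ 2) * ∑ j, G x j ^ 2 ∂ν ≤ α * W := by
    rw [h.integral_sum_defect_sq_mul hν z, hα, add_mul]
    have := mul_le_mul_of_nonneg_left hp (Nat.cast_nonneg (α := ℝ) N)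
    linarith
  have hcI : Continuous fun x => (∑ k, G x k ^ 2 - R ^ 2) ^ 2 := (hPc.sub continuous_const).pow 2
  have h3 : 2 * W ≤ ∫ x, (α / 2 * (∑ k, G x k ^ 2 - R ^ 2) ^ 2 +
      1 / (2 * α) * ((∑ k, defect z G k x ^ 2) * ∑ j, G x j ^ 2)) ∂ν := by
    rw [← h1]
    refine integral_mono (hint ((hPc.sub continuous_const).mul hSc).neg)
      (((hint hcI).const_mul _).add ((hint hQP).const_mul _)) fun x => ?_
    have hcs := Finset.sum_mul_sq_le_sq_mul_sq Finset.univ (fun j => defect z G j x)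
      (fun j => G x j)
    set S := ∑ j, defect z G j x * G x j
    set T := ∑ k, G x k ^ 2 - R ^ 2
    have hsq : 0 ≤ (α * T + S) ^ 2 / (2 * α) := by positivity
    have hexp : (α * T + S) ^ 2 / (2 * α) = α / 2 * T ^ 2 + T * S + 1 / (2 * α) * S ^ 2 := by
      field_simp
      ring
    have h4 : 1 / (2 * α) * S ^ 2 ≤
        1 / (2 * α) * ((∑ k, defect z G k x ^ 2) * ∑ j, G x j ^ 2) :=
      mul_le_mul_of_nonneg_left hcs (by positivity)
    simp only
    linarith
  rw [integral_add ((hint hcI).const_mul _) ((hint hQP).const_mul _),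
    integral_const_mul, integral_const_mul] at h3
  have h5 := mul_le_mul_of_nonneg_left h2 (show 0 ≤ 1 / (2 * α) by positivity)
  have h6 : 1 / (2 * α) * (α * W) = W / 2 := by field_simp
  linarith

end IsTorsionField

lemma norm_fderiv_sq_le {N : ℕ} (f : Euc N → ℝ) (x : Euc N) :
    ‖fderiv ℝ f x‖ ^ 2 ≤ ∑ j, pd j f x ^ 2 := by
  have hle : ‖fderiv ℝ f x‖ ≤ √(∑ j, pd j f x ^ 2) := by
    refine ContinuousLinearMap.opNorm_le_bound _ (Real.sqrt_nonneg _) fun y => ?_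
    have hy : fderiv ℝ f x y = ∑ j, pd j f x * y j := by
      conv_lhs => rw [← (EuclideanSpace.basisFun (Fin N) ℝ).sum_repr y]
      simp [pd, mul_comm]
    rw [hy, Real.norm_eq_abs, EuclideanSpace.norm_eq, ← Real.sqrt_mul (by positivity)]
    refine Real.abs_le_sqrt ?_
    simpa using Finset.sum_mul_sq_le_sq_mul_sq Finset.univ (fun j => pd j f x) fun j => y j
  calc ‖fderiv ℝ f x‖ ^ 2 ≤ √(∑ j, pd j f x ^ 2) ^ 2 := by gcongr
    _ = ∑ j, pd j f x ^ 2 := Real.sq_sqrt (by positivity)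

/-- The estimate for the weighted Hessian deficit, with a constant depending only on the dimension,
the cone condition, a bound of the diameter and a lower bound of the gradient at the boundary. -/
theorem exists_sum_integral_le (N : ℕ) (hN : 0 < N) {σ b m : ℝ} (d : ℝ) (hσ : 0 < σ) (hσ1 : σ ≤ 1)
    (hb : 0 < b) : ∃ C : ℝ, 0 ≤ C ∧ ∀ (Ω : Set (Euc N)) (U : Euc N → ℝ) (G : Euc N → Euc N),
      IsTorsionField σ b m Ω U G → IsConnected Ω → (Ωᶜ).Nonempty →
      (∀ x ∈ Ω, ∀ y ∈ Ω, dist x y ≤ d) → (∀ x ∈ Ω, infDist x Ωᶜ ^ 2 / 2 ≤ -U x) →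
      ∀ z : Euc N, (∀ i, ∫ x in Ω, (x i - z i) = 0) → ∀ R : ℝ,
      ∑ i, ∫ x in Ω, -U x * ∑ j, pd j (defect z G i) x ^ 2 ≤
        C * ∫ x in frontier Ω, (∑ k, G x k ^ 2 - R ^ 2) ^ 2 ∂(μH[(N : ℝ) - 1]) := by
  obtain ⟨C, hC, hpoin⟩ := exists_weighted_poincare_of_integral_eq_zero N d hσ hσ1 hb
  refine ⟨(2 + N * (2 * C)) / 3 * (surfaceConst N σ m).toReal, by positivity, ?_⟩
  intro Ω U G h hconn hne hdist hinf z hz R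
  obtain ⟨l, ν, hν⟩ := h.toIsDefiningFn.exists_isLayerLimit
  have hp : ∀ i, ∫ x in Ω, defect z G i x ^ 2 ≤
      2 * C * ∫ x in Ω, -U x * ∑ j, pd j (defect z G i) x ^ 2 := by
    intro i
    have h0 : ∫ x in Ω, defect z G i x = 0 := by
      have hc : Continuous fun x : Euc N => x i - z i := by fun_prop
      simp only [defect]
      rw [integral_sub (h.integrableOn_of_continuous hc)
        (h.integrableOn_of_continuous (h.continuous_apply i)), hz, h.integral_grad hν, sub_zero]
    refine (hpoin Ω h.isOpen hconn h.isBounded hne hdist h.cone _ (h.continuous_defect z i)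
      (h.contDiffOn_defect z i) h0 _ ((h.integrableOn_neg_mul_sum_sq z i).const_mul 2)
      fun x hx => ?_).trans (le_of_eq ?_)
    · have h1 := mul_le_mul (hinf x hx) (norm_fderiv_sq_le (defect z G i) x) (sq_nonneg _)
        (neg_nonneg.2 (h.neg x hx).le)
      linarith
    · rw [integral_const_mul]
      ring
  refine (h.sum_integral_le_of_poincare hν z R (C := 2 * C) (by positivity) ?_).trans ?_
  · rw [Finset.mul_sum]
    exact Finset.sum_le_sum fun i _ => hp i
  · rw [mul_assoc]
    refine mul_le_mul_of_nonneg_left (hν.integral_le_setIntegral_hausdorff hN h.toIsDefiningFn ?_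
      fun x => sq_nonneg _) (by positivity)
    exact ((continuous_finsetSum _ fun k _ => (h.continuous_apply k).pow 2).sub
      continuous_const).pow 2

section TorsionFunction

variable {N : ℕ} {Ω : Set (Euc N)} {u : Euc N → ℝ} {G : Euc N → Euc N}

lemma gradient_apply (u : Euc N → ℝ) (x : Euc N) (i : Fin N) :
    gradient u x i = pd i u x := by
  have h : ⟪gradient u x, EuclideanSpace.single i (1 : ℝ)⟫ = pd i u x := by
    rw [gradient, InnerProductSpace.toDual_symm_apply, pd]
  rw [← h, EuclideanSpace.inner_single_right]
  simp

lemma pd_congr {f g : Euc N → ℝ} (hΩ : IsOpen Ω) (hfg : ∀ y ∈ Ω, f y = g y) (i : Fin N) {x : Euc N}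
    (hx : x ∈ Ω) : pd i f x = pd i g x := by
  have : f =ᶠ[𝓝 x] g := by
    filter_upwards [hΩ.mem_nhds hx] with y hy using hfg y hy
  rw [pd, pd, this.fderiv_eq]

lemma contDiffOn_pd (hΩ : IsOpen Ω) (hu : ContDiffOn ℝ 2 u Ω) (i : Fin N) :
    ContDiffOn ℝ 1 (pd i u) Ω :=
  (hu.fderiv_of_isOpen hΩ (m := 1) (by norm_num)).clm_apply contDiffOn_const

lemma hessEntry_symm (hΩ : IsOpen Ω) (hu : ContDiffOn ℝ 2 u Ω) (i j : Fin N) {x : Euc N}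
    (hx : x ∈ Ω) : hessEntry u x i j = hessEntry u x j i := by
  have hs := (hu.contDiffAt (hΩ.mem_nhds hx)).isSymmSndFDerivAt (by simp)
  have hd : DifferentiableAt ℝ (fderiv ℝ u) x :=
    ((hu.fderiv_of_isOpen hΩ (m := 1) (by norm_num)).contDiffAt
      (hΩ.mem_nhds hx)).differentiableAt one_ne_zero
  have h : ∀ k l, hessEntry u x k l =
      fderiv ℝ (fderiv ℝ u) x (EuclideanSpace.single k 1) (EuclideanSpace.single l 1) := by
    intro k l
    rw [hessEntry, fderiv_clm_apply hd (differentiableAt_const _)]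
    simp
  rw [h, h]
  exact hs _ _

lemma IsTorsion.isTorsionField {θ a m : ℝ} (hN : 0 < N) (hθ : θ ∈ Ioc (0 : ℝ) (π / 2))
    (ha : 0 < a) (hm : 0 < m) (hu : IsTorsion Ω u) (hΩ : IsOpen Ω) (hb : Bornology.IsBounded Ω)
    (hne : (Ωᶜ).Nonempty) (hcone : UnifConeCond θ a Ω) (hG : Continuous G)
    (hGu : ∀ x ∈ Ω, G x = gradient u x) (hGm : ∀ x ∈ frontier Ω, m ≤ ‖G x‖)
    (hint : IntegrableOn (fun x => hessNormSq u x) Ω) :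
    IsTorsionField (Real.sin θ) (a / 4) m Ω (Ω.indicator u) G := by
  have hGi : ∀ i, ∀ x ∈ Ω, G x i = pd i u x := fun i x hx => by rw [hGu x hx, gradient_apply]
  have hpd : ∀ i j, ∀ x ∈ Ω, pd i (fun y => G y j) x = hessEntry u x i j := fun i j x hx =>
    pd_congr hΩ (hGi j) i hx
  refine ⟨⟨?_, Real.sin_le_one θ, by positivity, hm, hΩ, hb, hcone.ballConeCond hθ, ?_, hG,
    fun x hx => indicator_of_notMem hx u, fun x hx => ?_, fun x hx => ?_, hGm⟩, fun i => ?_,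
    fun i j x hx => ?_, fun x hx => ?_, fun i j => ?_⟩
  · exact Real.sin_pos_of_pos_of_lt_pi hθ.1 (by linarith [hθ.2, Real.pi_pos])
  · exact continuous_indicator hu.2.2.2 hu.1
  · rw [indicator_of_mem hx]
    exact hu.neg_of_mem hN hΩ hb hne hx
  · have h1 : DifferentiableAt ℝ u x :=
      (hu.2.1.contDiffAt (hΩ.mem_nhds hx)).differentiableAt two_ne_zero
    have h2 : HasFDerivAt u (innerSL ℝ (G x)) x := by
      rw [hGu x hx]
      exact h1.hasGradientAt.hasFDerivAt
    refine h2.congr_of_eventuallyEq ?_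
    filter_upwards [hΩ.mem_nhds hx] with y hy using indicator_of_mem hy u
  · exact (contDiffOn_pd hΩ hu.2.1 i).congr (hGi i)
  · rw [hpd i j x hx, hpd j i x hx, hessEntry_symm hΩ hu.2.1 i j hx]
  · simp only [hpd _ _ x hx]
    exact hu.2.2.1 x hx
  · refine hint.mono' ((measurable_pd i _).pow_const 2).aestronglyMeasurable ?_
    filter_upwards [ae_restrict_mem hΩ.measurableSet] with x hx
    rw [hpd i j x hx, Real.norm_of_nonneg (sq_nonneg _)]
    calc hessEntry u x i j ^ 2 ≤ ∑ l, hessEntry u x i l ^ 2 :=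
          Finset.single_le_sum (f := fun l => hessEntry u x i l ^ 2) (fun l _ => sq_nonneg _)
            (Finset.mem_univ j)
      _ ≤ hessNormSq u x := Finset.single_le_sum (f := fun k => ∑ l, hessEntry u x k l ^ 2)
          (fun k _ => Finset.sum_nonneg fun l _ => sq_nonneg _) (Finset.mem_univ i)

lemma hessNormSq_eq_sum_defect (hΩ : IsOpen Ω) (hu : ContDiffOn ℝ 2 u Ω)
    (hGu : ∀ x ∈ Ω, G x = gradient u x) (z : Euc N) {x : Euc N} (hx : x ∈ Ω) :
    hessNormSq (fun y => ‖y - z‖ ^ 2 / 2 - u y) x = ∑ i, ∑ j, pd j (defect z G i) x ^ 2 := by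
  have h1 : ∀ j, ∀ y ∈ Ω, pd j (fun y => ‖y - z‖ ^ 2 / 2 - u y) y = defect z G j y := by
    intro j y hy
    have hd : DifferentiableAt ℝ u y :=
      (hu.contDiffAt (hΩ.mem_nhds hy)).differentiableAt two_ne_zero
    have hn : HasFDerivAt (fun y => ‖y - z‖ ^ 2 / 2) (innerSL ℝ (y - z)) y := by
      refine ((((hasFDerivAt_id y).sub_const z).norm_sq).mul_const (1 / 2 : ℝ)).congr_fderiv ?_ |>.congr_of_eventuallyEq ?_
      · ext v
        simp
      · exact .of_forall fun y => by simp [div_eq_mul_inv]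
    rw [defect, hGu y hy, gradient_apply, pd, (hn.fun_sub hd.hasFDerivAt).fderiv, sub_apply,
      innerSL_apply_apply, EuclideanSpace.inner_single_right]
    simp [pd]
  rw [hessNormSq, Finset.sum_comm]
  refine Finset.sum_congr rfl fun i _ => Finset.sum_congr rfl fun j _ => ?_
  rw [← pd_congr hΩ (h1 i) j hx]
  rfl

lemma integral_apply_sub_average_eq_zero (hΩ : IsOpen Ω) (hb : Bornology.IsBounded Ω)
    (hne : Ω.Nonempty) (i : Fin N) : ∫ x in Ω, (x i - (⨍ y in Ω, y : Euc N) i) = 0 := by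
  have hid : IntegrableOn (fun x : Euc N => x) Ω :=
    (continuous_id.continuousOn.integrableOn_compact hb.isCompact_closure).mono_set subset_closure
  have hvol : volume Ω ≠ ∞ := hb.measure_lt_top.ne
  have hvol0 : volume.real Ω ≠ 0 :=
    (ENNReal.toReal_pos (hΩ.measure_pos volume hne).ne' hvol).ne'
  have hproj := (EuclideanSpace.proj (𝕜 := ℝ) i).integral_comp_comm hid
  have hproj' : ∫ x in Ω, x i = (∫ x in Ω, x) i := hproj
  have hi : IntegrableOn (fun x : Euc N => x i) Ω :=
    (EuclideanSpace.proj (𝕜 := ℝ) i).integrable_comp hid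
  rw [integral_sub hi (integrableOn_const hvol), setIntegral_const, setAverage_eq, hproj',
    PiLp.smul_apply, smul_eq_mul, smul_eq_mul, mul_inv_cancel_left₀ hvol0, sub_self]

end TorsionFunction

end Auxiliary

/-- bound for the weighted Hessian deficit integral in terms of `u_ν² - R²`. -/
theorem stmt_11 (N : ℕ) (hN : 2 ≤ N) (θ a d m : ℝ) (hθ : θ ∈ Ioc (0:ℝ) (π / 2))
    (ha : 0 < a) (hd : 0 < d) (hm : 0 < m) :
    ∃ C > (0:ℝ), ∀ Ω : Set (Euc N), IsOpen Ω → IsConnected Ω → Bornology.IsBounded Ω →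
      Metric.diam Ω ≤ d → UnifConeCond θ a Ω →
      ∀ u : Euc N → ℝ, IsTorsion Ω u →
      ∀ g : Euc N → Euc N, ContinuousOn g (closure Ω) → (∀ x ∈ Ω, g x = gradient u x) →
      (∀ x ∈ frontier Ω, m ≤ ‖g x‖) →
      IntegrableOn (fun x => hessNormSq u x) Ω volume →
      ∀ z : Euc N, z = (⨍ x in Ω, x) →
      ∀ h : Euc N → ℝ, h = (fun x => ‖x - z‖ ^ 2 / 2 - u x) →
      ∀ R : ℝ, R = N * (volume Ω).toReal / (μH[(N:ℝ) - 1] (frontier Ω)).toReal →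
      (∫ x in Ω, (-u x) * hessNormSq h x) ≤
        C * ∫ x in frontier Ω, (‖g x‖ ^ 2 - R ^ 2) ^ 2 ∂(μH[(N:ℝ) - 1]) := by
  have hN0 : 0 < N := by omega
  have hsin : 0 < Real.sin θ := Real.sin_pos_of_pos_of_lt_pi hθ.1 (by linarith [hθ.2, Real.pi_pos])
  obtain ⟨C, hC, hmain⟩ := exists_sum_integral_le N hN0 (m := m) d hsin (Real.sin_le_one θ)
    (show 0 < a / 4 by positivity)
  refine ⟨C + 1, by positivity, ?_⟩
  intro Ω hΩ hconn hb hdiam hcone u hu g hgc hgu hgm hint z hz h hh R _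
  have : Nontrivial (Fin N) := Fin.nontrivial_iff_two_le.2 hN
  have hne : (Ωᶜ).Nonempty := by
    rw [nonempty_compl]
    rintro rfl
    exact NormedSpace.unbounded_univ ℝ (Euc N) hb
  obtain ⟨G, hG⟩ := ContinuousMap.exists_restrict_eq isClosed_closure
    (⟨(closure Ω).domRestrict g, hgc.domRestrict⟩ : C(closure Ω, Euc N))
  have hGg : ∀ x ∈ closure Ω, G x = g x := fun x hx => congrArg (fun f => f ⟨x, hx⟩) hG
  have hGu : ∀ x ∈ Ω, G x = gradient u x := fun x hx => by
    rw [hGg x (subset_closure hx), hgu x hx]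
  have hGm : ∀ x ∈ frontier Ω, m ≤ ‖G x‖ := fun x hx => by
    rw [hGg x (frontier_subset_closure hx)]
    exact hgm x hx
  have hfield := hu.isTorsionField hN0 hθ ha hm hΩ hb hne hcone G.continuous hGu hGm hint
  have hfinal := hmain Ω _ G hfield hconn hne
    (fun x hx y hy => (dist_le_diam_of_mem hb hx hy).trans hdiam)
    (fun x hx => by
      rw [indicator_of_mem hx]
      exact hu.infDist_sq_le hN0 hΩ hb hx)
    z (fun i => by
      rw [hz]
      exact integral_apply_sub_average_eq_zero hΩ hb hconn.nonempty i) R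
  rw [← integral_finsetSum _ fun i _ => hfield.integrableOn_neg_mul_sum_sq z i,
    setIntegral_congr_fun (g := fun x => (‖g x‖ ^ 2 - R ^ 2) ^ 2)
      isClosed_frontier.measurableSet fun x hx => by
        simp only [hGg x (frontier_subset_closure hx), EuclideanSpace.real_norm_sq_eq]] at hfinal
  have hnonneg : 0 ≤ ∫ x in frontier Ω, (‖g x‖ ^ 2 - R ^ 2) ^ 2 ∂(μH[(N : ℝ) - 1]) :=
    integral_nonneg fun x => sq_nonneg _
  rw [setIntegral_congr_fun (g := fun x => ∑ i, -Ω.indicator u x * ∑ j, pd j (defect z G i) x ^ 2)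
    hΩ.measurableSet fun x hx => by
      simp only [hh, hessNormSq_eq_sum_defect hΩ hu.2.1 hGu z hx, indicator_of_mem hx,
        Finset.mul_sum]]
  linarith
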